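/- arXiv:1412.7002 — 3 statements merged into one kernel-verified Lean document; each statement's English description precedes it below -/
import Mathlib

section
/- Let b(x) = −β(|x|²) x on ℝ^d, where β ≥ 0 is bounded and continuous on [0,∞) and for every interval [0,N] there exists Λ_N > 0 such that s ↦ β(s) − Λ_N s is decreasing on [0,N]. Then for every locally bounded Borel measure ν on ℝ^d, the Cauchy problem ∂_t μ + div(b μ) = 0, μ|_{t=0} = ν has at most one solution in the class of all locally bounded measures μ given by families of locally bounded measures (μ_t)_{t∈[0,T]} such that |μ_t|(∂Z ∖ {0}) = 0 for almost all t ∈ [0,T], where ∂Z is the topological boundary of the set Z = {x : β(|x|²) = 0}. -/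
open MeasureTheory Metric Set Filter
open scoped Topology ENNReal RealInnerProductSpace

noncomputable section

/-- The total variation measure `|a - b|` of the (formal) difference of two
locally finite nonnegative measures, defined via measure subtraction. -/
def tvDiff {α : Type*} [MeasurableSpace α] (a b : Measure α) : Measure α :=
  (a - b) + (b - a)

/-- A family `(μ_t)_{t∈[0,T]}` of locally bounded signed Borel measures on `ℝ^d`,
represented by its Jordan decomposition `μ_t = p t - n t`:  each `p t`, `n t` is
finite on compact sets and they are mutually singular, `t ↦ μ_t(B)` is measurable
for bounded Borel `B`, and `t ↦ |μ_t|(K)` is in `L¹[0,T]` for every compact `K`. -/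
def IsLocFamily {d : ℕ} (T : ℝ)
    (p n : ℝ → Measure (EuclideanSpace ℝ (Fin d))) : Prop :=
  (∀ t ∈ Icc (0:ℝ) T, ∀ K : Set (EuclideanSpace ℝ (Fin d)), IsCompact K →
      p t K < ⊤ ∧ n t K < ⊤) ∧
  (∀ t ∈ Icc (0:ℝ) T, p t ⟂ₘ n t) ∧
  (∀ B : Set (EuclideanSpace ℝ (Fin d)), MeasurableSet B → Bornology.IsBounded B →
      Measurable (fun t => p t B) ∧ Measurable (fun t => n t B)) ∧
  (∀ K : Set (EuclideanSpace ℝ (Fin d)), IsCompact K →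
      IntegrableOn (fun t => (p t K).toReal + (n t K).toReal) (Icc (0:ℝ) T))

/-- Integral of `f` against the signed measure `μ_t = p t - n t`. -/
def sint {d : ℕ} (p n : ℝ → Measure (EuclideanSpace ℝ (Fin d))) (t : ℝ)
    (f : EuclideanSpace ℝ (Fin d) → ℝ) : ℝ :=
  (∫ x, f x ∂(p t)) - ∫ x, f x ∂(n t)

/-- The family `μ_t = p t - n t` is a solution of the Cauchy problem
`∂_t μ + div (b μ) = 0`, `μ|_{t=0} = ν` (`ν = νp - νn`) on `[0,T]`:
`b` is `|μ|`-integrable on `U × [0,T]` for every ball `U` and the weak identity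
`∫ u(x,t) μ_t(dx) = ∫ u(x,0) ν(dx) + ∫₀ᵗ ∫ [∂_t u + ⟨b,∇u⟩] μ_s(dx) ds`
holds for a.e. `t ∈ [0,T]`, for every `C¹` test function `u` vanishing for
`|x| > R` for some `R`. -/
def IsSolution {d : ℕ} (T : ℝ)
    (b : EuclideanSpace ℝ (Fin d) → ℝ → EuclideanSpace ℝ (Fin d))
    (νp νn : Measure (EuclideanSpace ℝ (Fin d)))
    (p n : ℝ → Measure (EuclideanSpace ℝ (Fin d))) : Prop :=
  (∀ (x₀ : EuclideanSpace ℝ (Fin d)) (R : ℝ), 0 < R →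
      (∫⁻ t in Icc (0:ℝ) T,
        ∫⁻ x in ball x₀ R, ENNReal.ofReal ‖b x t‖ ∂(p t + n t)) < ⊤) ∧
  ∀ u : EuclideanSpace ℝ (Fin d) → ℝ → ℝ,
    ContDiff ℝ 1 (fun q : EuclideanSpace ℝ (Fin d) × ℝ => u q.1 q.2) →
    (∃ R > 0, ∀ x t, R < ‖x‖ → u x t = 0) →
    ∀ᵐ t ∂(volume.restrict (Icc (0:ℝ) T)),
      sint p n t (fun x => u x t)
        = ((∫ x, u x 0 ∂νp) - ∫ x, u x 0 ∂νn)
          + ∫ s in Icc (0:ℝ) t,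
              sint p n s (fun x => deriv (u x) s
                + ⟪b x s, gradient (fun y => u y s) x⟫)

/-- A travel-time coordinate `G` for the scalar flow `y' = γ y`, together with its inverse `H`. -/
lemma exists_travelTime {γ : ℝ → ℝ} (hc : Continuous γ) {ε M : ℝ} (hε : 0 < ε)
    (hγ : ∀ y, ε ≤ γ y) (hM : ∀ y, γ y ≤ M) :
    ∃ G H : ℝ → ℝ, (∀ y, HasDerivAt G (γ y)⁻¹ y) ∧ (∀ z, HasDerivAt H (γ (H z)) z) ∧
      ∀ y, H (G y) = y := by
  have hpos : ∀ y, 0 < γ y := fun y => hε.trans_le (hγ y)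
  have hMpos : 0 < M := (hpos 0).trans_le (hM 0)
  have hci : Continuous fun y => (γ y)⁻¹ := hc.inv₀ fun y => (hpos y).ne'
  set G : ℝ → ℝ := fun y => ∫ s in (0 : ℝ)..y, (γ s)⁻¹ with hG
  have hd : ∀ y, HasDerivAt G (γ y)⁻¹ y := fun y =>
    intervalIntegral.integral_hasDerivAt_right (hci.intervalIntegrable _ _)
      (hci.stronglyMeasurableAtFilter _ _) hci.continuousAt
  have hmono : StrictMono G := strictMono_of_deriv_pos fun y => by
    rw [(hd y).deriv]; exact inv_pos.2 (hpos y)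
  have hGc : Continuous G := continuous_iff_continuousAt.2 fun y => (hd y).continuousAt
  have hd' : ∀ y, HasDerivAt (fun y => G y - M⁻¹ * y) ((γ y)⁻¹ - M⁻¹) y := fun y => by
    simpa using (hd y).fun_sub ((hasDerivAt_id y).const_mul M⁻¹)
  have hmono' : Monotone fun y => G y - M⁻¹ * y :=
    monotone_of_deriv_nonneg (fun y => (hd' y).differentiableAt) fun y => by
      rw [(hd' y).deriv, sub_nonneg]
      exact inv_anti₀ (hpos y) (hM y)
  have hG0 : G 0 = 0 := by simp [hG]
  have htop : Tendsto G atTop atTop := by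
    refine tendsto_atTop_mono' atTop ?_ (tendsto_id.const_mul_atTop (inv_pos.2 hMpos))
    filter_upwards [eventually_ge_atTop 0] with y hy
    have := hmono' hy
    simp only [hG0, mul_zero, sub_zero] at this
    simpa using this
  have hbot : Tendsto G atBot atBot := by
    refine tendsto_atBot_mono' atBot ?_ (tendsto_id.const_mul_atBot (inv_pos.2 hMpos))
    filter_upwards [eventually_le_atBot 0] with y hy
    have := hmono' hy
    simp only [hG0, mul_zero, sub_zero] at this
    simpa using this
  let e : ℝ ≃o ℝ := hmono.orderIsoOfSurjective G (hGc.surjective htop hbot)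
  have hGH : ∀ z, G (e.symm z) = z := fun z => e.apply_symm_apply z
  refine ⟨G, e.symm, hd, fun z => ?_, fun y => e.symm_apply_apply y⟩
  have := HasDerivAt.of_local_left_inverse (f := G) (g := e.symm) (a := z)
    e.symm.continuous.continuousAt (hd _) (inv_pos.2 (hpos _)).ne' (Eventually.of_forall hGH)
  simpa using this

/-- Transporting `ψ` along the radial flow with logarithmic speed `γ` gives a `C¹` function which
equals `ψ` at time `τ`, has bounded time derivative and solves the radial transport equation. -/
lemma exists_transported {E : Type*} [NormedAddCommGroup E] [InnerProductSpace ℝ E]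
    {γ : ℝ → ℝ} (hc : Continuous γ) {ε M : ℝ} (hε : 0 < ε)
    (hγ : ∀ y, ε ≤ γ y) (hM : ∀ y, γ y ≤ M)
    {ψ : E → ℝ} (hψ : ContDiff ℝ 1 ψ) {r R C : ℝ} (hr : 0 < r)
    (hψr : ∀ x, ‖x‖ < r → ψ x = ψ 0) (hψR : ∀ x, R < ‖x‖ → ψ x = 0)
    (hC : ∀ y, |fderiv ℝ ψ y y| ≤ C) (τ : ℝ) :
    ∃ u : E → ℝ → ℝ, ContDiff ℝ 1 (fun q : E × ℝ => u q.1 q.2) ∧ (∀ x, u x τ = ψ x) ∧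
      (∀ x t, |deriv (u x) t| ≤ C * M) ∧
      (∀ x t, R * Real.exp (M * |t - τ|) < ‖x‖ → u x t = 0) ∧
      (∀ t x, x ≠ 0 →
        γ (Real.log ‖x‖) * fderiv ℝ (fun y => u y t) x x = deriv (u x) t) ∧
      ∀ t, deriv (u 0) t = 0 := by
  obtain ⟨G, H, hG, hH, hHG⟩ := exists_travelTime hc hε hγ hM
  have hpos : ∀ y, 0 < γ y := fun y => hε.trans_le (hγ y)
  have hMpos : 0 < M := (hpos 0).trans_le (hM 0)
  have hGc : Continuous G := continuous_iff_continuousAt.2 fun y => (hG y).continuousAt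
  have hHc : Continuous H := continuous_iff_continuousAt.2 fun y => (hH y).continuousAt
  have hG1 : ContDiff ℝ 1 G := by
    refine contDiff_one_iff_deriv.2 ⟨fun y => (hG y).differentiableAt, ?_⟩
    rw [show deriv G = fun y => (γ y)⁻¹ from funext fun y => (hG y).deriv]
    exact hc.inv₀ fun y => (hpos y).ne'
  have hH1 : ContDiff ℝ 1 H := by
    refine contDiff_one_iff_deriv.2 ⟨fun y => (hH y).differentiableAt, ?_⟩
    rw [show deriv H = fun y => γ (H y) from funext fun y => (hH y).deriv]
    exact hc.comp hHc
  have hS : ∀ y s, |H (G y + s) - y| ≤ M * |s| := by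
    intro y s
    have h := Convex.norm_image_sub_le_of_norm_hasDerivWithin_le (f := H) (f' := fun z => γ (H z))
      (s := univ) (C := M) (fun z _ => (hH z).hasDerivWithinAt)
      (fun z _ => by rw [Real.norm_of_nonneg (hpos _).le]; exact hM _) convex_univ
      (mem_univ (G y)) (mem_univ (G y + s))
    simpa [hHG] using h
  set Φ : E → ℝ → E := fun x t =>
    Real.exp (H (G (Real.log ‖x‖) + (t - τ)) - Real.log ‖x‖) • x with hΦ
  have hΦn : ∀ x t, ‖Φ x t‖ = Real.exp (H (G (Real.log ‖x‖) + (t - τ)) - Real.log ‖x‖) * ‖x‖ := by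
    intro x t
    rw [hΦ, norm_smul, Real.norm_of_nonneg (Real.exp_pos _).le]
  have hΦle : ∀ x t, ‖Φ x t‖ ≤ Real.exp (M * |t - τ|) * ‖x‖ := by
    intro x t
    rw [hΦn]
    gcongr
    exact (le_abs_self _).trans (hS _ _)
  have hΦge : ∀ x t, ‖x‖ ≤ ‖Φ x t‖ * Real.exp (M * |t - τ|) := by
    intro x t
    rw [hΦn, mul_right_comm, ← Real.exp_add]
    refine le_mul_of_one_le_left (norm_nonneg _) (Real.one_le_exp ?_)
    linarith [(abs_le.1 (hS (Real.log ‖x‖) (t - τ))).1]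
  have hdt : ∀ x t, HasDerivAt (fun t => ψ (Φ x t))
      (γ (H (G (Real.log ‖x‖) + (t - τ))) * fderiv ℝ ψ (Φ x t) (Φ x t)) t := by
    intro x t
    have h1 : HasDerivAt (fun t => G (Real.log ‖x‖) + (t - τ)) 1 t :=
      ((hasDerivAt_id t).sub_const τ).const_add _
    have h2 := ((hH _).comp t h1).sub_const (Real.log ‖x‖)
    have h3 := h2.exp.smul_const x
    have h4 := ((hψ.differentiable one_ne_zero) (Φ x t)).hasFDerivAt.comp_hasDerivAt t h3
    refine HasDerivAt.congr_deriv (f := fun t => ψ (Φ x t)) h4 ?_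
    simp only [hΦ, Function.comp, map_smul, smul_eq_mul, mul_one]
    ring
  have hu1 : ContDiff ℝ 1 (fun q : E × ℝ => ψ (Φ q.1 q.2)) := by
    refine contDiff_iff_contDiffAt.2 fun q => ?_
    by_cases hq : q.1 = 0
    · have hev : ∀ᶠ q' : E × ℝ in 𝓝 q, Real.exp (M * |q'.2 - τ|) * ‖q'.1‖ < r := by
        have hcont : Continuous fun q' : E × ℝ => Real.exp (M * |q'.2 - τ|) * ‖q'.1‖ := by
          fun_prop
        refine hcont.continuousAt.eventually_lt_const ?_
        simpa [hq] using hr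
      refine (contDiffAt_const (c := ψ 0)).congr_of_eventuallyEq ?_
      filter_upwards [hev] with q' hq'
      exact hψr _ ((hΦle _ _).trans_lt hq')
    · refine hψ.contDiffAt.comp q ?_
      have hl : ContDiffAt ℝ 1 (fun q : E × ℝ => Real.log ‖q.1‖) q :=
        (contDiffAt_fst.norm ℝ hq).log (norm_ne_zero_iff.2 hq)
      refine ContDiffAt.smul (Real.contDiff_exp.contDiffAt.comp q (ContDiffAt.sub ?_ hl))
        contDiffAt_fst
      exact hH1.contDiffAt.comp q
        ((hG1.contDiffAt.comp q hl).add (contDiffAt_snd.sub contDiffAt_const))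
  refine ⟨fun x t => ψ (Φ x t), hu1, fun x => ?_, fun x t => ?_, fun x t hx => ?_,
    fun t x hx => ?_, fun t => ?_⟩
  · simp [hΦ, hHG]
  · rw [(hdt x t).deriv, abs_mul, abs_of_pos (hpos _), mul_comm]
    exact mul_le_mul (hC _) (hM _) (hpos _).le ((abs_nonneg _).trans (hC 0))
  · refine hψR _ ?_
    by_contra! h
    exact absurd (hx.trans_le (hΦge x t)) (not_lt.2 (by gcongr))
  · set l := Real.log ‖x‖ with hl
    have hxn : ‖x‖ ≠ 0 := norm_ne_zero_iff.2 hx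
    have hflow : ∀ s : ℝ, ψ (Φ (Real.exp s • x) t) = ψ (Φ x (t + (G (l + s) - G l))) := by
      intro s
      have h1 : Real.log ‖Real.exp s • x‖ = l + s := by
        rw [norm_smul, Real.norm_of_nonneg (Real.exp_pos _).le,
          Real.log_mul (Real.exp_pos _).ne' hxn, Real.log_exp, add_comm]
      simp only [hΦ, h1, smul_smul, ← Real.exp_add, ← hl]
      congr 3
      rw [show G l + (t + (G (l + s) - G l) - τ) = G (l + s) + (t - τ) by ring]
      ring
    have hux : DifferentiableAt ℝ (fun y => ψ (Φ y t)) x :=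
      ((hu1.comp (contDiff_id.prodMk contDiff_const)).differentiable one_ne_zero) x
    have hL : HasDerivAt (fun s : ℝ => ψ (Φ (Real.exp s • x) t))
        (fderiv ℝ (fun y => ψ (Φ y t)) x x) 0 := by
      have h1 : HasDerivAt (fun s : ℝ => Real.exp s • x) x 0 := by
        simpa using (Real.hasDerivAt_exp 0).smul_const x
      have h2 : HasFDerivAt (fun y => ψ (Φ y t)) (fderiv ℝ (fun y => ψ (Φ y t)) x)
          (Real.exp 0 • x) := by simpa using hux.hasFDerivAt
      exact HasFDerivAt.comp_hasDerivAt (l := fun y => ψ (Φ y t)) (0 : ℝ) h2 h1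
    have hR' : HasDerivAt (fun s : ℝ => ψ (Φ x (t + (G (l + s) - G l))))
        (deriv (fun t => ψ (Φ x t)) t * (γ l)⁻¹) 0 := by
      have h1 : HasDerivAt (fun s : ℝ => t + (G (l + s) - G l)) (γ l)⁻¹ 0 := by
        have h0 : HasDerivAt G (γ l)⁻¹ (l + 0) := by simpa using hG l
        exact ((h0.comp_const_add l 0).sub_const _).const_add _
      have h2 : HasDerivAt (fun t => ψ (Φ x t)) (deriv (fun t => ψ (Φ x t)) t)
          (t + (G (l + 0) - G l)) := by
        simpa using (hdt x t).differentiableAt.hasDerivAt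
      exact h2.comp (0 : ℝ) h1
    rw [funext hflow] at hL
    rw [hL.unique hR', mul_comm, mul_assoc, inv_mul_cancel₀ (hpos l).ne', mul_one]
  · rw [(hdt 0 t).deriv]
    simp [hΦ]

/-- A countable family of open sets whose traces on balls determine locally finite measures. -/
lemma exists_countable_determining_opens (E : Type*) [NormedAddCommGroup E]
    [SecondCountableTopology E] [MeasurableSpace E] [BorelSpace E] :
    ∃ S : Set (Set E), S.Countable ∧ (∀ U ∈ S, IsOpen U) ∧ ∀ P N : Measure E,
      (∀ k : ℕ, P (ball 0 k) < ⊤) →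
      (∀ U ∈ S, ∀ k : ℕ, P (U ∩ ball 0 k) = N (U ∩ ball 0 k)) → P = N := by
  obtain ⟨B, hBc, -, hB⟩ := TopologicalSpace.exists_countable_basis E
  refine ⟨sInter '' {F | F.Finite ∧ F ⊆ B}, (countable_ofPred_finite_subset hBc).image _, ?_, ?_⟩
  · rintro _ ⟨F, ⟨hF, hFB⟩, rfl⟩
    exact hF.isOpen_sInter fun s hs => hB.isOpen (hFB hs)
  · intro P N hP h
    have huniv : (univ : Set E) ∈ sInter '' {F | F.Finite ∧ F ⊆ B} :=
      ⟨∅, ⟨finite_empty, empty_subset _⟩, sInter_empty⟩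
    refine Measure.ext_of_generateFrom_of_cover
      (S := sInter '' {F | F.Finite ∧ F ⊆ B}) (T := range fun k : ℕ => ball (0 : E) k)
      ?_ (countable_range _) ?_ ?_ ?_ ?_ ?_
    · rw [BorelSpace.measurable_eq (α := E), hB.borel_eq_generateFrom]
      refine le_antisymm (MeasurableSpace.generateFrom_mono fun s hs =>
        ⟨{s}, ⟨finite_singleton _, singleton_subset_iff.2 hs⟩, sInter_singleton _⟩)
        (MeasurableSpace.generateFrom_le ?_)
      rintro _ ⟨F, ⟨hF, hFB⟩, rfl⟩
      exact MeasurableSet.sInter hF.countable fun s hs =>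
        MeasurableSpace.measurableSet_generateFrom (hFB hs)
    · rintro _ ⟨F, ⟨hF, hFB⟩, rfl⟩ _ ⟨F', ⟨hF', hFB'⟩, rfl⟩ -
      exact ⟨F ∪ F', ⟨hF.union hF', union_subset hFB hFB'⟩, sInter_union _ _⟩
    · rw [sUnion_range]; exact iUnion_ball_nat 0
    · rintro _ ⟨k, rfl⟩; exact (hP k).ne
    · rintro _ ⟨k, rfl⟩ U hU; exact h U hU k
    · rintro _ ⟨k, rfl⟩; simpa using h _ huniv k

/-- Two measures agree on `U` if they agree on functions converging boundedly to `1_U`. -/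
lemma measure_eq_of_tendsto_indicator {E : Type*} [TopologicalSpace E] [MeasurableSpace E]
    [BorelSpace E] {P N : Measure E} {K U : Set E} (hK : MeasurableSet K) (hU : MeasurableSet U)
    (hUK : U ⊆ K) (hP : P K < ⊤) (hN : N K < ⊤) {ψ : ℕ → E → ℝ} (hc : ∀ k, Continuous (ψ k))
    (h1 : ∀ k x, |ψ k x| ≤ 1) (h0 : ∀ k, ∀ x ∉ K, ψ k x = 0)
    (hlim : ∀ x, Tendsto (fun k => ψ k x) atTop (𝓝 (U.indicator 1 x)))
    (heq : ∀ k, ∫ x, ψ k x ∂P = ∫ x, ψ k x ∂N) : P U = N U := by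
  have key : ∀ Q : Measure E, Q K < ⊤ →
      Tendsto (fun k => ∫ x, ψ k x ∂Q) atTop (𝓝 (Q.real U)) := by
    intro Q hQ
    rw [← integral_indicator_one hU]
    refine tendsto_integral_of_dominated_convergence (K.indicator 1)
      (fun k => ((hc k).measurable).aestronglyMeasurable) ?_ (fun k => ?_)
      (Eventually.of_forall hlim)
    · exact (integrable_indicator_iff hK).2 (integrableOn_const hQ.ne)
    · refine Eventually.of_forall fun x => ?_
      by_cases hx : x ∈ K
      · simpa [hx] using h1 k x
      · simp [hx, h0 k x hx]
  have h := tendsto_nhds_unique (key P hP) ((key N hN).congr fun k => (heq k).symm)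
  rwa [measureReal_def, measureReal_def, ENNReal.toReal_eq_toReal_iff'
    ((measure_mono hUK).trans_lt hP).ne ((measure_mono hUK).trans_lt hN).ne] at h

section Approximation

variable {E : Type*} [NormedAddCommGroup E] [InnerProductSpace ℝ E] [FiniteDimensional ℝ E]

/-- `C¹` approximation of the indicator of an open set from inside. -/
lemma exists_tendsto_indicator {U : Set E} (hU : IsOpen U) :
    ∃ ψ : ℕ → E → ℝ, (∀ k, ContDiff ℝ 1 (ψ k)) ∧ (∀ k x, 0 ≤ ψ k x ∧ ψ k x ≤ 1) ∧
      (∀ k, ∀ x ∉ U, ψ k x = 0) ∧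
      ∀ x, Tendsto (fun k => ψ k x) atTop (𝓝 (U.indicator 1 x)) := by
  obtain ⟨f, hfU, hf, hf01⟩ := hU.exists_contDiff_support_eq (n := 1)
  have hfx : ∀ x ∉ U, f x = 0 := fun x hx => by
    rw [← hfU] at hx; exact Function.notMem_support.1 hx
  refine ⟨fun k x => Real.smoothTransition (k * f x), fun k => ?_, fun k x => ?_, fun k x hx => ?_,
    fun x => ?_⟩
  · exact Real.smoothTransition.contDiff.comp (contDiff_const.mul hf)
  · exact ⟨Real.smoothTransition.nonneg _, Real.smoothTransition.le_one _⟩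
  · simp [hfx x hx]
  · by_cases hx : x ∈ U
    · have hpos : 0 < f x := by
        refine lt_of_le_of_ne (hf01 (mem_range_self x)).1 (Ne.symm ?_)
        rw [← hfU] at hx; exact hx
      refine tendsto_const_nhds.congr' ?_
      have ht : Tendsto (fun k : ℕ => (k : ℝ) * f x) atTop atTop :=
        tendsto_natCast_atTop_atTop.atTop_mul_const hpos
      filter_upwards [ht.eventually_ge_atTop 1] with k hk
      simp [hx, Real.smoothTransition.one_of_one_le hk]
    · simp [hx, hfx x hx]

/-- `C¹` approximation of the indicator of an open set by functions constant near the origin. -/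
lemma exists_tendsto_indicator_const_near_zero {U : Set E} (hU : IsOpen U) {R : ℝ} (hR : 0 ≤ R)
    (hUR : U ⊆ closedBall 0 R) :
    ∃ ψ : ℕ → E → ℝ, (∀ k, ContDiff ℝ 1 (ψ k)) ∧ (∀ k x, |ψ k x| ≤ 1) ∧
      (∀ k x, R + 1 < ‖x‖ → ψ k x = 0) ∧ (∀ k, ∃ r > 0, ∀ x, ‖x‖ < r → ψ k x = ψ k 0) ∧
      ∀ x, Tendsto (fun k => ψ k x) atTop (𝓝 (U.indicator 1 x)) := by
  obtain ⟨φ, hφ, hφ01, hφU, hφlim⟩ := exists_tendsto_indicator hU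
  have hrad : ∀ k : ℕ, (0 : ℝ) < 1 / (k + 1) := fun k => Nat.one_div_pos_of_nat
  let η : ∀ k : ℕ, ContDiffBump (0 : E) := fun k =>
    ⟨1 / (k + 1) / 2, 1 / (k + 1), half_pos (hrad k), half_lt_self (hrad k)⟩
  set c : ℝ := U.indicator 1 (0 : E) with hc
  have hc01 : 0 ≤ c ∧ c ≤ 1 := by
    by_cases h : (0 : E) ∈ U <;> simp [hc, h]
  have hη1 : ∀ (k : ℕ) (x : E), ‖x‖ < 1 / ((k : ℝ) + 1) / 2 → η k x = 1 := fun k x hx =>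
    (η k).one_of_mem_closedBall (by simpa [η] using hx.le)
  have hη0 : ∀ (k : ℕ) (x : E), 1 / ((k : ℝ) + 1) ≤ ‖x‖ → η k x = 0 := fun k x hx =>
    (η k).zero_of_le_dist (by simpa [η] using hx)
  refine ⟨fun k x => φ k x * (1 - η k x) + c * η k x, fun k => ?_, fun k x => ?_, fun k x hx => ?_,
    fun k => ⟨1 / ((k : ℝ) + 1) / 2, half_pos (hrad k), fun x hx => ?_⟩, fun x => ?_⟩
  · exact ((hφ k).mul (contDiff_const.sub (η k).contDiff)).add (contDiff_const.mul (η k).contDiff)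
  · obtain ⟨h1, h2⟩ := hφ01 k x
    have h3 : 0 ≤ η k x := (η k).nonneg
    have h4 : η k x ≤ 1 := (η k).le_one
    rw [abs_le]
    constructor <;> nlinarith [mul_nonneg h1 (sub_nonneg.2 h4), mul_nonneg hc01.1 h3]
  · have hxU : x ∉ U := fun h => by
      have := mem_closedBall_zero_iff.1 (hUR h); linarith
    have hk : 1 / ((k : ℝ) + 1) ≤ 1 := by
      rw [div_le_one (by positivity)]; simp
    simp [hφU k x hxU, hη0 k x (by linarith)]
  · simp only [hη1 k x hx, hη1 k 0 (by simpa using half_pos (hrad k))]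
    simp
  · by_cases hx : x = 0
    · subst hx
      refine tendsto_const_nhds.congr fun k => ?_
      simp only [hη1 k 0 (by simpa using half_pos (hrad k))]
      simp [hc]
    · refine (hφlim x).congr' ?_
      filter_upwards [tendsto_one_div_add_atTop_nhds_zero_nat.eventually_lt_const
        (norm_pos_iff.2 hx)] with k hk
      simp [hη0 k x hk.le]

end Approximation

section Family

variable {E : Type*} [NormedAddCommGroup E] [MeasurableSpace E]

/-- A measurable family of nonnegative locally finite measures, locally integrable in time. -/
structure IsPosFamily (T : ℝ) (q : ℝ → Measure E) : Prop where
  finite : ∀ t ∈ Icc (0 : ℝ) T, ∀ K, IsCompact K → q t K < ⊤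
  measurable : ∀ B, MeasurableSet B → Bornology.IsBounded B → Measurable fun t => q t B
  lintegral : ∀ K, IsCompact K → ∫⁻ t in Icc 0 T, q t K < ⊤

lemma IsPosFamily.add {T : ℝ} {q q' : ℝ → Measure E} [BorelSpace E] (hq : IsPosFamily T q)
    (hq' : IsPosFamily T q') : IsPosFamily T (fun t => q t + q' t) where
  finite t ht K hK := by
    simpa using ⟨hq.finite t ht K hK, hq'.finite t ht K hK⟩
  measurable B hB hB' := by
    simpa using (hq.measurable B hB hB').fun_add (hq'.measurable B hB hB')
  lintegral K hK := by
    simp only [Measure.coe_add, Pi.add_apply]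
    rw [lintegral_add_left (hq.measurable K hK.measurableSet hK.isBounded)]
    exact ENNReal.add_lt_top.2 ⟨hq.lintegral K hK, hq'.lintegral K hK⟩

lemma IsPosFamily.measurable_restrict {T : ℝ} {q : ℝ → Measure E} (hq : IsPosFamily T q)
    {A : Set E} (hA : MeasurableSet A) (hAb : Bornology.IsBounded A) :
    Measurable fun t => (q t).restrict A := by
  refine Measure.measurable_of_measurable_coe _ fun B hB => ?_
  simp only [Measure.restrict_apply hB]
  exact hq.measurable _ (hB.inter hA) (hAb.subset inter_subset_right)

lemma IsPosFamily.tendsto_lintegral_lintegral {T : ℝ} {q : ℝ → Measure E} (hq : IsPosFamily T q)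
    {A K : Set E} (hA : MeasurableSet A) (hK : IsCompact K) (hAK : A ⊆ K) {g : ℕ → E → ℝ≥0∞}
    (hg : ∀ n, Measurable (g n)) (hg1 : ∀ n x, g n x ≤ 1)
    (hlim : ∀ x ∈ A, Tendsto (fun n => g n x) atTop (𝓝 0)) :
    Tendsto (fun n => ∫⁻ t in Icc 0 T, ∫⁻ x in A, g n x ∂(q t)) atTop (𝓝 0) := by
  have hb : ∀ n t, ∫⁻ x in A, g n x ∂(q t) ≤ q t K := fun n t =>
    (lintegral_mono (hg1 n)).trans (by simpa using measure_mono hAK)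
  have := tendsto_lintegral_of_dominated_convergence
    (μ := volume.restrict (Icc 0 T)) (F := fun n t => ∫⁻ x in A, g n x ∂(q t)) (f := 0)
    (fun t => q t K)
    (fun n => (Measure.measurable_lintegral (hg n)).comp
      (hq.measurable_restrict hA (hK.isBounded.subset hAK)))
    (fun n => Eventually.of_forall (hb n)) (hq.lintegral K hK).ne ?_
  · simpa using this
  · filter_upwards [ae_restrict_mem measurableSet_Icc] with t ht
    have := tendsto_lintegral_of_dominated_convergence (μ := (q t).restrict A) (F := g)
      (f := 0) (fun _ => 1) hg (fun n => Eventually.of_forall (hg1 n))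
      (by simpa using ((measure_mono hAK).trans_lt (hq.finite t ht K hK)).ne)
      ((ae_restrict_iff' hA).2 (Eventually.of_forall hlim))
    simpa using this

variable [BorelSpace E] [ProperSpace E]

lemma IsPosFamily.integrable_of_continuous {T : ℝ} {q : ℝ → Measure E} (hq : IsPosFamily T q)
    {t : ℝ} (ht : t ∈ Icc 0 T) {f : E → ℝ} (hf : Continuous f) {R : ℝ}
    (hR : ∀ x, R < ‖x‖ → f x = 0) : Integrable f (q t) := by
  have hK := isCompact_closedBall (0 : E) R
  have hsupp : Function.support f ⊆ closedBall 0 R := fun x hx => by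
    by_contra h
    exact hx (hR x (by simpa using h))
  rw [← integrableOn_iff_integrable_of_support_subset hsupp]
  exact hf.continuousOn.integrableOn_of_subset_isCompact hK hK.measurableSet subset_rfl
    (hq.finite t ht _ hK).ne

lemma IsPosFamily.integrableOn_integral {T : ℝ} {q : ℝ → Measure E} (hq : IsPosFamily T q)
    {F : E → ℝ → ℝ} (hF : Continuous (fun z : E × ℝ => F z.1 z.2)) {R : ℝ}
    (hR : ∀ x t, R < ‖x‖ → F x t = 0) :
    IntegrableOn (fun t => ∫ x, F x t ∂(q t)) (Icc 0 T) := by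
  set K := closedBall (0 : E) R with hKdef
  have hK : IsCompact K := isCompact_closedBall _ _
  have hKm : MeasurableSet K := hK.measurableSet
  have hFK : ∀ x t, x ∉ K → F x t = 0 := fun x t hx => hR x t (by simpa [hKdef] using hx)
  let κ : ℝ → Measure E := (Icc 0 T).indicator fun t => (q t).restrict K
  have hκ : Measurable κ := (hq.measurable_restrict hKm hK.isBounded).indicator measurableSet_Icc
  have hκfin : ∀ s, IsFiniteMeasure (κ s) := fun s => by
    by_cases hs : s ∈ Icc 0 T
    · simp only [κ, indicator_of_mem hs]
      exact ⟨by simpa using hq.finite s hs K hK⟩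
    · simp only [κ, indicator_of_notMem hs]
      infer_instance
  have hv_meas : ∀ τ, StronglyMeasurable fun s => ∫ x in K, F x τ ∂(κ s) := by
    intro τ
    have hf : Continuous fun x => F x τ := hF.comp (by fun_prop : Continuous fun x => (x, τ))
    have hint : ∀ s, IntegrableOn (fun x => F x τ) K (κ s) := fun s =>
      hf.continuousOn.integrableOn_compact hK
    have hκK : Measurable fun s => (κ s).restrict K := by
      refine Measure.measurable_of_measurable_coe _ fun B hB => ?_
      simp only [Measure.restrict_apply hB]
      exact (Measure.measurable_coe (hB.inter hKm)).comp hκ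
    refine Measurable.stronglyMeasurable ?_
    simp only [fun s => integral_eq_lintegral_pos_part_sub_lintegral_neg_part (hint s)]
    exact ((Measure.measurable_lintegral hf.measurable.ennreal_ofReal).comp hκK).ennreal_toReal.sub
      ((Measure.measurable_lintegral hf.measurable.neg.ennreal_ofReal).comp hκK).ennreal_toReal
  have hv_cont : ∀ s, Continuous fun τ => ∫ x in K, F x τ ∂(κ s) := fun s =>
    continuous_parametric_integral_of_continuous (f := fun τ x => F x τ)
      (hF.comp continuous_swap) hK
  have hdiag : StronglyMeasurable fun s => ∫ x in K, F x s ∂(κ s) :=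
    (stronglyMeasurable_uncurry_of_continuous_of_stronglyMeasurable
      (u := fun τ s => ∫ x in K, F x τ ∂(κ s)) hv_cont hv_meas).comp_measurable
      (measurable_id.prodMk measurable_id)
  obtain ⟨C, hC⟩ := (hK.prod (isCompact_Icc (a := (0 : ℝ)) (b := T))).exists_bound_of_continuousOn
    hF.continuousOn
  have hqK : IntegrableOn (fun t => (q t K).toReal) (Icc 0 T) :=
    integrable_toReal_of_lintegral_ne_top (hq.measurable K hKm hK.isBounded).aemeasurable
      (hq.lintegral K hK).ne
  refine (hqK.const_mul C).mono' (hdiag.aestronglyMeasurable.congr ?_) ?_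
  · filter_upwards [ae_restrict_mem measurableSet_Icc] with s hs
    simp only [κ, indicator_of_mem hs, Measure.restrict_restrict hKm, inter_self]
    exact setIntegral_eq_integral_of_forall_compl_eq_zero fun x hx => hFK x s hx
  · filter_upwards [ae_restrict_mem measurableSet_Icc] with s hs
    rw [← setIntegral_eq_integral_of_forall_compl_eq_zero (s := K) fun x hx => hFK x s hx]
    exact norm_setIntegral_le_of_norm_le_const (hq.finite s hs K hK) fun x hx => hC (x, s) ⟨hx, hs⟩

end Family

/-- If `P` and `N` agree on `O`, the difference of integrals only sees the complement of `O`. -/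
lemma enorm_integral_sub_integral_le {E : Type*} [MeasurableSpace E] {P N : Measure E}
    {O A : Set E} (hO : MeasurableSet O) (hA : MeasurableSet A)
    (hPN : P.restrict O = N.restrict O) {f : E → ℝ} (hfP : Integrable f P) (hfN : Integrable f N)
    (hf0 : ∀ᵐ x ∂(P + N), x ∉ O → x ∉ A → f x = 0) {g : E → ℝ≥0∞} {c : ℝ≥0∞} (hc : c ≠ ⊤)
    (hfg : ∀ x, ‖f x‖ₑ ≤ c * g x) :
    ‖(∫ x, f x ∂P) - ∫ x, f x ∂N‖ₑ ≤ c * ∫⁻ x in A, g x ∂(P + N) := by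
  have hb : ∀ Q : Measure E, (∀ᵐ x ∂Q, x ∉ O → x ∉ A → f x = 0) →
      ‖∫ x in Oᶜ, f x ∂Q‖ₑ ≤ c * ∫⁻ x in A, g x ∂Q := by
    intro Q hQ
    calc ‖∫ x in Oᶜ, f x ∂Q‖ₑ ≤ ∫⁻ x in Oᶜ, ‖f x‖ₑ ∂Q := enorm_integral_le_lintegral_enorm _
      _ = ∫⁻ x, Oᶜ.indicator (fun x => ‖f x‖ₑ) x ∂Q := (lintegral_indicator hO.compl _).symm
      _ ≤ ∫⁻ x, A.indicator (fun x => c * g x) x ∂Q := by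
        refine lintegral_mono_ae ?_
        filter_upwards [hQ] with x hx
        by_cases hxO : x ∈ O
        · simp [hxO]
        · by_cases hxA : x ∈ A
          · simpa [hxO, hxA] using hfg x
          · simp [hxA, hx hxO hxA]
      _ = c * ∫⁻ x in A, g x ∂Q := by
        rw [lintegral_indicator hA, lintegral_const_mul' _ _ hc]
  rw [ae_add_measure_iff] at hf0
  rw [← integral_add_compl hO hfP, ← integral_add_compl hO hfN, hPN, add_sub_add_left_eq_sub,
    Measure.restrict_add, lintegral_add_measure, mul_add]
  exact enorm_sub_le.trans (add_le_add (hb P hf0.1) (hb N hf0.2))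

/-- The transport operator applied to a `C¹` function is continuous. -/
lemma continuous_transport {E : Type*} [NormedAddCommGroup E] [NormedSpace ℝ E]
    {B : E → ℝ} (hB : Continuous B) {u : E → ℝ → ℝ}
    (hu : ContDiff ℝ 1 (fun q : E × ℝ => u q.1 q.2)) :
    Continuous fun z : E × ℝ =>
      deriv (u z.1) z.2 - B z.1 * fderiv ℝ (fun y => u y z.2) z.1 z.1 := by
  have hd : ∀ z : E × ℝ, HasFDerivAt (fun q : E × ℝ => u q.1 q.2)
      (fderiv ℝ (fun q : E × ℝ => u q.1 q.2) z) z := fun z =>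
    (hu.differentiable one_ne_zero z).hasFDerivAt
  have ht : ∀ z : E × ℝ, deriv (u z.1) z.2 =
      fderiv ℝ (fun q : E × ℝ => u q.1 q.2) z (0, 1) := fun z =>
    ((hd z).comp_hasDerivAt (f := fun t => (z.1, t)) z.2
      ((hasDerivAt_const z.2 z.1).prodMk (hasDerivAt_id z.2))).deriv
  have hx : ∀ z : E × ℝ, fderiv ℝ (fun y => u y z.2) z.1 z.1 =
      fderiv ℝ (fun q : E × ℝ => u q.1 q.2) z (z.1, 0) := fun z => by
    have := (HasFDerivAt.comp (f := fun y => (y, z.2)) z.1 (hd z) (hasFDerivAt_prodMk_left z.1 z.2))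
    rw [show fderiv ℝ (fun y => u y z.2) z.1 = _ from this.fderiv]
    simp
  have hc := hu.continuous_fderiv one_ne_zero
  simp only [ht, hx]
  exact (hc.clm_apply continuous_const).sub
    ((hB.comp continuous_fst).mul (hc.clm_apply (by fun_prop)))

lemma transport_eq_zero {E : Type*} [NormedAddCommGroup E] [NormedSpace ℝ E]
    {b R : ℝ} {u : E → ℝ → ℝ} (hu : ∀ x t, R < ‖x‖ → u x t = 0) {x : E}
    (t : ℝ) (hx : R < ‖x‖) :
    deriv (u x) t - b * fderiv ℝ (fun y => u y t) x x = 0 := by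
  have h1 : u x = fun _ => 0 := funext fun t => hu x t hx
  have h2 : (fun y => u y t) =ᶠ[𝓝 x] fun _ => 0 := by
    filter_upwards [continuous_norm.continuousAt.eventually_const_lt hx] with y hy
    exact hu y t hy
  simp [h1, h2.fderiv_eq]

section Uniqueness

variable {E : Type*} [NormedAddCommGroup E] [InnerProductSpace ℝ E] [FiniteDimensional ℝ E]
  [MeasurableSpace E] [BorelSpace E]

/-- The differences `P t - N t` solve the continuity equation with drift `-β(|x|²) x` and zero
initial condition. -/
def IsNullSolution (T : ℝ) (β : ℝ → ℝ) (P N : ℝ → Measure E) : Prop :=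
  ∀ u : E → ℝ → ℝ, ContDiff ℝ 1 (fun q : E × ℝ => u q.1 q.2) →
    (∃ R > 0, ∀ x t, R < ‖x‖ → u x t = 0) →
    ∀ᵐ t ∂(volume.restrict (Icc (0 : ℝ) T)),
      (∫ x, u x t ∂(P t)) - ∫ x, u x t ∂(N t) =
        ∫ s in Icc (0 : ℝ) t,
          ((∫ x, deriv (u x) s - β (‖x‖ ^ 2) * fderiv ℝ (fun y => u y s) x x ∂(P s)) -
            ∫ x, deriv (u x) s - β (‖x‖ ^ 2) * fderiv ℝ (fun y => u y s) x x ∂(N s))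

/-- On the interior of the zero set of the drift a null solution vanishes. -/
lemma IsNullSolution.restrict_interior_eq {T : ℝ} {β : ℝ → ℝ} {P N : ℝ → Measure E}
    (h : IsNullSolution T β P N) (hP : IsPosFamily T P) (hN : IsPosFamily T N) :
    ∀ᵐ t ∂(volume.restrict (Icc (0 : ℝ) T)),
      (P t).restrict (interior {x : E | β (‖x‖ ^ 2) = 0}) =
        (N t).restrict (interior {x : E | β (‖x‖ ^ 2) = 0}) := by
  set O := interior {x : E | β (‖x‖ ^ 2) = 0} with hO
  have hOo : IsOpen O := isOpen_interior
  obtain ⟨S, hSc, hSo, hS⟩ := exists_countable_determining_opens E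
  have key : ∀ U ∈ S, ∀ k : ℕ, ∀ᵐ t ∂(volume.restrict (Icc (0 : ℝ) T)),
      P t (U ∩ ball 0 k ∩ O) = N t (U ∩ ball 0 k ∩ O) := by
    intro U hU k
    have hV : IsOpen (U ∩ ball 0 k ∩ O) := ((hSo U hU).inter isOpen_ball).inter hOo
    obtain ⟨ψ, hψ, hψ01, hψ0, hψlim⟩ := exists_tendsto_indicator hV
    have hVK : U ∩ ball 0 k ∩ O ⊆ closedBall 0 (k : ℝ) := fun x hx =>
      ball_subset_closedBall hx.1.2
    have hK : IsCompact (closedBall (0 : E) k) := isCompact_closedBall _ _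
    have hψeq : ∀ j, ∀ᵐ t ∂(volume.restrict (Icc (0 : ℝ) T)),
        ∫ x, ψ j x ∂(P t) = ∫ x, ψ j x ∂(N t) := by
      intro j
      have hzero : ∀ x, β (‖x‖ ^ 2) * fderiv ℝ (ψ j) x x = 0 := by
        intro x
        by_cases hx : x ∈ O
        · have h0 : β (‖x‖ ^ 2) = 0 := interior_subset (s := {x : E | β (‖x‖ ^ 2) = 0}) hx
          simp [h0]
        · have hmin : IsLocalMin (ψ j) x := Eventually.of_forall fun y => by
            rw [hψ0 j x fun h => hx h.2]; exact (hψ01 j y).1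
          simp [hmin.fderiv_eq_zero]
      have := h (fun x _ => ψ j x) ((hψ j).comp contDiff_fst)
        ⟨k + 1, by positivity, fun x _ hx => hψ0 j x fun hxV => by
          have := mem_closedBall_zero_iff.1 (hVK hxV); linarith⟩
      filter_upwards [this] with t ht
      simpa [hzero, sub_eq_zero] using ht
    filter_upwards [ae_all_iff.2 hψeq, ae_restrict_mem measurableSet_Icc] with t ht htT
    exact measure_eq_of_tendsto_indicator hK.measurableSet hV.measurableSet hVK
      (hP.finite t htT _ hK) (hN.finite t htT _ hK) (fun j => (hψ j).continuous)
      (fun j x => abs_le.2 ⟨by linarith [(hψ01 j x).1], (hψ01 j x).2⟩)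
      (fun j x hx => hψ0 j x fun hxV => hx (hVK hxV)) hψlim ht
  have key' := (ae_ball_iff hSc).2 fun U hU => ae_all_iff.2 (key U hU)
  filter_upwards [key', ae_restrict_mem measurableSet_Icc] with t ht htT
  refine hS _ _ (fun k => ?_) fun U hU k => ?_
  · exact (Measure.restrict_apply_le _ _).trans_lt ((measure_mono ball_subset_closedBall).trans_lt
      (hP.finite t htT _ (isCompact_closedBall _ _)))
  · have hm : MeasurableSet (U ∩ ball 0 (k : ℝ)) := ((hSo U hU).inter isOpen_ball).measurableSet
    rw [Measure.restrict_apply hm, Measure.restrict_apply hm]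
    exact ht U hU k

/-- A null solution which does not charge the boundary of the zero set of the drift (away from the
origin) annihilates test functions that are constant near the origin. -/
lemma IsNullSolution.integral_eq {T : ℝ} (hT : 0 < T) {β : ℝ → ℝ}
    (hβc : ContinuousOn β (Ici 0)) (hβ0 : ∀ s ∈ Ici (0 : ℝ), 0 ≤ β s) {M : ℝ}
    (hM : ∀ s ∈ Ici (0 : ℝ), β s ≤ M) {P N : ℝ → Measure E}
    (h : IsNullSolution T β P N) (hP : IsPosFamily T P) (hN : IsPosFamily T N)
    (hZ : ∀ᵐ t ∂(volume.restrict (Icc (0 : ℝ) T)),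
      (P t + N t) (frontier {x : E | β (‖x‖ ^ 2) = 0} \ {0}) = 0)
    {ψ : E → ℝ} (hψ : ContDiff ℝ 1 ψ) {r R : ℝ} (hr : 0 < r) (hR : 0 < R)
    (hψr : ∀ x, ‖x‖ < r → ψ x = ψ 0) (hψR : ∀ x, R < ‖x‖ → ψ x = 0) :
    ∀ᵐ t ∂(volume.restrict (Icc (0 : ℝ) T)), ∫ x, ψ x ∂(P t) = ∫ x, ψ x ∂(N t) := by
  have hBc : Continuous fun x : E => β (‖x‖ ^ 2) :=
    hβc.comp_continuous (by fun_prop) fun x => sq_nonneg ‖x‖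
  have hB0 : ∀ x : E, 0 ≤ β (‖x‖ ^ 2) := fun x => hβ0 _ (sq_nonneg ‖x‖)
  have hM0 : 0 ≤ M := (hβ0 0 self_mem_Ici).trans (hM 0 self_mem_Ici)
  have hε : ∀ n : ℕ, (0 : ℝ) < 1 / (n + 1) := fun n => Nat.one_div_pos_of_nat
  have hε1 : ∀ n : ℕ, (1 : ℝ) / (n + 1) ≤ 1 := fun n => by
    rw [div_le_one (by positivity)]; simp
  obtain ⟨C, hC⟩ : ∃ C, ∀ y, |fderiv ℝ ψ y y| ≤ C := by
    obtain ⟨C, hC⟩ := (isCompact_closedBall (0 : E) R).exists_bound_of_continuousOn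
      (f := fun y => fderiv ℝ ψ y y)
      (((hψ.continuous_fderiv one_ne_zero).clm_apply continuous_id).continuousOn)
    refine ⟨C, fun y => ?_⟩
    by_cases hy : ‖y‖ ≤ R
    · exact hC y (by simpa using hy)
    · have h0 := transport_eq_zero (b := -1) (u := fun y _ => ψ y) (fun x _ => hψR x) 0
        (not_le.1 hy)
      have hC0 := (norm_nonneg _).trans (hC 0 (by simpa using hR.le))
      simp only [deriv_const, zero_sub, neg_mul, one_mul, neg_neg] at h0
      simpa [h0] using hC0
  have hC0 : 0 ≤ C := (abs_nonneg _).trans (hC 0)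
  choose u hu huτ hut huR huE hu0 using fun (n : ℕ) (τ : ℝ) =>
    exists_transported (E := E) (γ := fun y => β (Real.exp y ^ 2) + 1 / ((n : ℝ) + 1)) (M := M + 1)
      ((hβc.comp_continuous (by fun_prop) fun y => sq_nonneg (Real.exp y)).add continuous_const)
      (hε n) (fun y => le_add_of_nonneg_left (hβ0 _ (sq_nonneg (Real.exp y))))
      (fun y => add_le_add (hM _ (sq_nonneg (Real.exp y))) (hε1 n)) hψ hr hψr hψR hC τ
  set R' := R * Real.exp ((M + 1) * (5 / 2 * T)) with hR'
  have hR'pos : 0 < R' := by positivity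
  set K := closedBall (0 : E) R' with hKdef
  have hK : IsCompact K := isCompact_closedBall _ _
  have huK : ∀ n τ x t, |t - τ| ≤ 5 / 2 * T → R' < ‖x‖ → u n τ x t = 0 := by
    intro n τ x t ht hx
    refine huR n τ x t (lt_of_le_of_lt ?_ hx)
    rw [hR']
    gcongr
  set A : Set E := K ∩ {x | 0 < β (‖x‖ ^ 2)} with hAdef
  have hA : MeasurableSet A :=
    hK.measurableSet.inter (isOpen_lt continuous_const hBc).measurableSet
  let g : ℕ → E → ℝ≥0∞ := fun n x =>
    ENNReal.ofReal (1 / ((n : ℝ) + 1) / (β (‖x‖ ^ 2) + 1 / ((n : ℝ) + 1)))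
  set c : ℝ≥0∞ := ENNReal.ofReal (C * (M + 1)) with hc
  set e : ℕ → ℝ≥0∞ := fun n =>
    c * ∫⁻ t in Icc 0 T, ∫⁻ x in A, g n x ∂(P t + N t) with he
  have he0 : Tendsto e atTop (𝓝 0) := by
    have := (hP.add hN).tendsto_lintegral_lintegral hA hK inter_subset_left (g := g)
      (fun n => (measurable_const.div (hBc.measurable.add_const _)).ennreal_ofReal)
      (fun n x => ENNReal.ofReal_le_one.2 ((div_le_one (add_pos_of_nonneg_of_pos (hB0 x)
        (hε n))).2 (le_add_of_nonneg_left (hB0 x)))) fun x hx => ?_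
    · have := ENNReal.Tendsto.const_mul this (Or.inr ENNReal.ofReal_ne_top : _ ∨ c ≠ ⊤)
      rwa [mul_zero] at this
    · have h1 : Tendsto (fun n : ℕ => (1 : ℝ) / (n + 1)) atTop (𝓝 0) :=
        tendsto_one_div_add_atTop_nhds_zero_nat
      have h2 := h1.div (h1.const_add (β (‖x‖ ^ 2))) (by simpa using hx.2.ne')
      have h3 := ENNReal.tendsto_ofReal h2
      rwa [zero_div, ENNReal.ofReal_zero] at h3
  let χ : ContDiffBump (T / 2) := ⟨T, 2 * T, hT, by linarith⟩
  have hχ1 : ∀ t ∈ Icc 0 T, ∀ᶠ t' in 𝓝 t, χ t' = 1 := fun t ht => by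
    filter_upwards [Ioo_mem_nhds (show -T / 2 < t by linarith [ht.1])
      (show t < 3 * T / 2 by linarith [ht.2])] with t' ht'
    refine χ.one_of_mem_closedBall ?_
    rw [mem_closedBall, Real.dist_eq, abs_le]
    constructor <;> simp only [χ] <;> linarith [ht'.1, ht'.2]
  have hχ0 : ∀ t, χ t ≠ 0 → ∀ τ ∈ Icc 0 T, |t - τ| ≤ 5 / 2 * T := fun t ht τ hτ => by
    by_contra! hlt
    refine ht (χ.zero_of_le_dist ?_)
    rw [Real.dist_eq]
    simp only [χ]
    rcases lt_abs.1 hlt with h | h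
    · exact le_abs.2 (Or.inl (by linarith [hτ.1]))
    · exact le_abs.2 (Or.inr (by linarith [hτ.2]))
  have hest : ∀ n, ∀ τ ∈ Icc 0 T, ∀ᵐ t ∂(volume.restrict (Icc (0 : ℝ) T)),
      ‖(∫ x, u n τ x t ∂(P t)) - ∫ x, u n τ x t ∂(N t)‖ₑ ≤ e n := by
    intro n τ hτ
    let w : E → ℝ → ℝ := fun x t => χ t * u n τ x t
    have hw : ContDiff ℝ 1 (fun q : E × ℝ => w q.1 q.2) :=
      (χ.contDiff.comp contDiff_snd).mul (hu n τ)
    have hwR : ∀ x t, R' < ‖x‖ → w x t = 0 := fun x t hx => by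
      by_cases ht : χ t = 0
      · simp [w, ht]
      · simp [w, huK n τ x t (hχ0 t ht τ hτ) hx]
    have hwF : ∀ s ∈ Icc 0 T, ∀ x,
        |deriv (w x) s - β (‖x‖ ^ 2) * fderiv ℝ (fun y => w y s) x x| ≤
          C * (M + 1) * (1 / ((n : ℝ) + 1) / (β (‖x‖ ^ 2) + 1 / ((n : ℝ) + 1))) ∧
        (x = 0 → deriv (w x) s - β (‖x‖ ^ 2) * fderiv ℝ (fun y => w y s) x x = 0) := by
      intro s hs x
      have h1 : deriv (w x) s = deriv (u n τ x) s := by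
        refine Filter.EventuallyEq.deriv_eq ?_
        filter_upwards [hχ1 s hs] with t ht
        simp [w, ht]
      have h2 : (fun y => w y s) = fun y => u n τ y s := funext fun y => by
        simp [w, (hχ1 s hs).self_of_nhds]
      rw [h1, h2]
      have hpos := add_pos_of_nonneg_of_pos (hB0 x) (hε n)
      by_cases hx : x = 0
      · subst hx
        have hpos' := (hε n).le
        simp only [hu0, map_zero, mul_zero, sub_zero, abs_zero, implies_true, and_true]
        positivity
      · refine ⟨?_, fun h => absurd h hx⟩
        have hE := huE n τ s x hx
        rw [Real.exp_log (norm_pos_iff.2 hx)] at hE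
        have : deriv (u n τ x) s - β (‖x‖ ^ 2) * fderiv ℝ (fun y => u n τ y s) x x =
            deriv (u n τ x) s * (1 / ((n : ℝ) + 1) / (β (‖x‖ ^ 2) + 1 / ((n : ℝ) + 1))) := by
          rw [mul_div_assoc', eq_div_iff hpos.ne', ← hE]
          ring
        rw [this, abs_mul, abs_of_pos (div_pos (hε n) hpos)]
        exact mul_le_mul_of_nonneg_right (hut n τ x s) (div_pos (hε n) hpos).le
    filter_upwards [h w hw ⟨R', hR'pos, hwR⟩, ae_restrict_mem measurableSet_Icc] with t ht htT
    have hwt : ∀ x, w x t = u n τ x t := fun x => by simp [w, (hχ1 t htT).self_of_nhds]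
    simp only [hwt] at ht
    rw [ht]
    refine (enorm_integral_le_lintegral_enorm _).trans
      ((lintegral_mono_set (Icc_subset_Icc_right htT.2)).trans ?_)
    simp only [he]
    rw [← lintegral_const_mul' _ _ (show c ≠ ⊤ from ENNReal.ofReal_ne_top)]
    refine lintegral_mono_ae ?_
    filter_upwards [h.restrict_interior_eq hP hN, hZ, ae_restrict_mem measurableSet_Icc] with
      s hs hZs hsT
    have hFc := (continuous_transport hBc hw).comp (Continuous.prodMk_left s)
    refine enorm_integral_sub_integral_le isOpen_interior.measurableSet hA hs
      (hP.integrable_of_continuous hsT hFc fun x hx => transport_eq_zero hwR s hx)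
      (hN.integrable_of_continuous hsT hFc fun x hx => transport_eq_zero hwR s hx) ?_
      ENNReal.ofReal_ne_top fun x => ?_
    · filter_upwards [measure_eq_zero_iff_ae_notMem.1 hZs] with x hx hxO hxA
      by_cases hx0 : x = 0
      · exact (hwF s hsT x).2 hx0
      by_cases hxK : x ∈ K
      · have hxZ : x ∈ {x : E | β (‖x‖ ^ 2) = 0} :=
          le_antisymm (not_lt.1 fun hlt => hxA ⟨hxK, hlt⟩) (hB0 x)
        exact absurd ⟨⟨subset_closure hxZ, hxO⟩, hx0⟩ hx
      · exact transport_eq_zero hwR s (by simpa [hKdef] using hxK)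
    · rw [← ENNReal.ofReal_mul (by positivity), Real.enorm_eq_ofReal_abs]
      exact ENNReal.ofReal_le_ofReal (hwF s hsT x).1
  have hest' : ∀ᵐ t ∂(volume.restrict (Icc (0 : ℝ) T)), ∀ (n : ℕ) (q : ℚ), (q : ℝ) ∈ Icc 0 T →
      ‖(∫ x, u n q x t ∂(P t)) - ∫ x, u n q x t ∂(N t)‖ₑ ≤ e n := by
    refine ae_all_iff.2 fun n => ae_all_iff.2 fun q => ?_
    by_cases hq : (q : ℝ) ∈ Icc 0 T
    · filter_upwards [hest n q hq] with t ht _ using ht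
    · exact Eventually.of_forall fun t h => absurd h hq
  filter_upwards [hest', ae_restrict_mem measurableSet_Icc] with t ht htT
  have hψR' : ∀ x, R' < ‖x‖ → ψ x = 0 := fun x hx =>
    hψR x (lt_of_le_of_lt (le_mul_of_one_le_right hR.le (Real.one_le_exp (by positivity))) hx)
  have hdiff : ∀ Q : ℝ → Measure E, IsPosFamily T Q → ∀ n, ∀ τ ∈ Icc 0 T,
      |(∫ x, ψ x ∂(Q t)) - ∫ x, u n τ x t ∂(Q t)| ≤ C * (M + 1) * |t - τ| * (Q t).real K := by
    intro Q hQ n τ hτ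
    have htτ : |t - τ| ≤ 5 / 2 * T := by
      rw [abs_le]; constructor <;> linarith [htT.1, htT.2, hτ.1, hτ.2]
    have hut_cont : Continuous fun x => u n τ x t :=
      (hu n τ).continuous.comp (Continuous.prodMk_left t)
    rw [← integral_sub (hQ.integrable_of_continuous htT hψ.continuous hψR')
      (hQ.integrable_of_continuous htT hut_cont fun x hx => huK n τ x t htτ hx)]
    rw [← setIntegral_eq_integral_of_forall_compl_eq_zero (s := K) fun x hx => by
      have hx : R' < ‖x‖ := by simpa [hKdef] using hx
      rw [hψR' x hx, huK n τ x t htτ hx, sub_zero]]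
    rw [← Real.norm_eq_abs]
    refine norm_setIntegral_le_of_norm_le_const (hQ.finite t htT K hK) fun x _ => ?_
    have hdx : Differentiable ℝ (u n τ x) :=
      ContDiff.differentiable ((hu n τ).comp (g := fun q : E × ℝ => u n τ q.1 q.2)
        (contDiff_prodMk_right x)) one_ne_zero
    have := Convex.norm_image_sub_le_of_norm_deriv_le (f := u n τ x) (s := univ) (C := C * (M + 1))
      (fun z _ => hdx z) (fun z _ => hut n τ x z) convex_univ (mem_univ t) (mem_univ τ)
    rwa [huτ, Real.norm_eq_abs (τ - t), abs_sub_comm τ t] at this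
  set a := (∫ x, ψ x ∂(P t)) - ∫ x, ψ x ∂(N t) with ha
  set D := C * (M + 1) * ((P t).real K + (N t).real K) with hD
  have hD0 : 0 ≤ D := by positivity
  have hδ : ∀ δ > 0, |a| ≤ δ * (D + 1) := by
    intro δ hδ
    obtain ⟨n, hn⟩ := (he0.eventually_le_const (ENNReal.ofReal_pos.2 hδ)).exists
    obtain ⟨q, hq1, hq2⟩ := exists_rat_btwn (show max 0 (t - δ) < min T (t + δ) from
      max_lt (lt_min hT (by linarith [htT.1])) (lt_min (by linarith [htT.2]) (by linarith)))
    have hqT : (q : ℝ) ∈ Icc 0 T := ⟨(max_lt_iff.1 hq1).1.le, (lt_min_iff.1 hq2).1.le⟩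
    have htq : |t - q| ≤ δ := by
      rw [abs_le]
      constructor <;> linarith [(max_lt_iff.1 hq1).2, (lt_min_iff.1 hq2).2]
    have h1 := (ht n q hqT).trans hn
    rw [Real.enorm_eq_ofReal_abs, ENNReal.ofReal_le_ofReal_iff hδ.le] at h1
    have h2 := hdiff P hP n q hqT
    have h3 := hdiff N hN n q hqT
    have h4 : C * (M + 1) * |t - q| * (P t).real K + C * (M + 1) * |t - q| * (N t).real K ≤
        δ * D := by
      calc _ = |t - q| * D := by rw [hD]; ring
        _ ≤ δ * D := by gcongr
    rw [abs_le] at *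
    constructor <;> linarith [h1.1, h1.2, h2.1, h2.2, h3.1, h3.2]
  have ha0 : |a| ≤ 0 := by
    refine le_of_forall_pos_le_add fun δ hδ' => ?_
    have := hδ (δ / (D + 1)) (by positivity)
    rwa [div_mul_cancel₀ _ (by positivity), ← zero_add δ] at this
  exact sub_eq_zero.1 (abs_nonpos_iff.1 ha0)

/-- A null solution which does not charge the boundary of the zero set of the drift (away from the
origin) vanishes. -/
lemma IsNullSolution.ae_eq {T : ℝ} (hT : 0 < T) {β : ℝ → ℝ}
    (hβc : ContinuousOn β (Ici 0)) (hβ0 : ∀ s ∈ Ici (0 : ℝ), 0 ≤ β s) {M : ℝ}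
    (hM : ∀ s ∈ Ici (0 : ℝ), β s ≤ M) {P N : ℝ → Measure E}
    (h : IsNullSolution T β P N) (hP : IsPosFamily T P) (hN : IsPosFamily T N)
    (hZ : ∀ᵐ t ∂(volume.restrict (Icc (0 : ℝ) T)),
      (P t + N t) (frontier {x : E | β (‖x‖ ^ 2) = 0} \ {0}) = 0) :
    ∀ᵐ t ∂(volume.restrict (Icc (0 : ℝ) T)), P t = N t := by
  obtain ⟨S, hSc, hSo, hS⟩ := exists_countable_determining_opens E
  have key : ∀ U ∈ S, ∀ k : ℕ, ∀ᵐ t ∂(volume.restrict (Icc (0 : ℝ) T)),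
      P t (U ∩ ball 0 k) = N t (U ∩ ball 0 k) := by
    intro U hU k
    have hV : IsOpen (U ∩ ball 0 (k : ℝ)) := (hSo U hU).inter isOpen_ball
    have hVK : U ∩ ball 0 k ⊆ closedBall 0 (k : ℝ) := fun x hx => ball_subset_closedBall hx.2
    obtain ⟨ψ, hψ, hψ1, hψ0, hψr, hψlim⟩ :=
      exists_tendsto_indicator_const_near_zero hV (Nat.cast_nonneg k) hVK
    have hK : IsCompact (closedBall (0 : E) ((k : ℝ) + 1)) := isCompact_closedBall _ _
    have hψeq : ∀ j, ∀ᵐ t ∂(volume.restrict (Icc (0 : ℝ) T)),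
        ∫ x, ψ j x ∂(P t) = ∫ x, ψ j x ∂(N t) := fun j => by
      obtain ⟨r, hr, hψjr⟩ := hψr j
      exact h.integral_eq hT hβc hβ0 hM hP hN hZ (hψ j) hr (by positivity) hψjr (hψ0 j)
    filter_upwards [ae_all_iff.2 hψeq, ae_restrict_mem measurableSet_Icc] with t ht htT
    exact measure_eq_of_tendsto_indicator hK.measurableSet hV.measurableSet
      (hVK.trans (closedBall_subset_closedBall (by linarith)))
      (hP.finite t htT _ hK) (hN.finite t htT _ hK) (fun j => (hψ j).continuous) hψ1
      (fun j x hx => hψ0 j x (by simpa using hx)) hψlim ht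
  filter_upwards [(ae_ball_iff hSc).2 fun U hU => ae_all_iff.2 (key U hU),
    ae_restrict_mem measurableSet_Icc] with t ht htT
  exact hS _ _ (fun k => (measure_mono ball_subset_closedBall).trans_lt
    (hP.finite t htT _ (isCompact_closedBall _ _))) ht

end Uniqueness

lemma isPosFamily_of_integrableOn {E : Type*} [NormedAddCommGroup E] [MeasurableSpace E]
    [BorelSpace E] {T : ℝ} {q q' : ℝ → Measure E}
    (hfin : ∀ t ∈ Icc (0 : ℝ) T, ∀ K, IsCompact K → q t K < ⊤)
    (hmeas : ∀ B, MeasurableSet B → Bornology.IsBounded B → Measurable fun t => q t B)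
    (hint : ∀ K, IsCompact K →
      IntegrableOn (fun t => (q t K).toReal + (q' t K).toReal) (Icc (0 : ℝ) T)) :
    IsPosFamily T q where
  finite := hfin
  measurable := hmeas
  lintegral K hK := by
    have h : IntegrableOn (fun t => (q t K).toReal) (Icc (0 : ℝ) T) :=
      (hint K hK).mono' (hmeas K hK.measurableSet hK.isBounded).ennreal_toReal.aestronglyMeasurable
        (Eventually.of_forall fun t => by
          rw [Real.norm_of_nonneg ENNReal.toReal_nonneg]
          exact le_add_of_nonneg_right ENNReal.toReal_nonneg)
    refine lt_of_eq_of_lt (setLIntegral_congr_fun measurableSet_Icc fun t ht => ?_)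
      h.lintegral_lt_top
    exact (ENNReal.ofReal_toReal (hfin t ht K hK).ne).symm

lemma IsLocFamily.isPosFamily_left {d : ℕ} {T : ℝ} {p n : ℝ → Measure (EuclideanSpace ℝ (Fin d))}
    (h : IsLocFamily T p n) : IsPosFamily T p :=
  isPosFamily_of_integrableOn (fun t ht K hK => (h.1 t ht K hK).1)
    (fun B hB hB' => (h.2.2.1 B hB hB').1) h.2.2.2

lemma IsLocFamily.isPosFamily_right {d : ℕ} {T : ℝ} {p n : ℝ → Measure (EuclideanSpace ℝ (Fin d))}
    (h : IsLocFamily T p n) : IsPosFamily T n :=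
  isPosFamily_of_integrableOn (q' := p) (fun t ht K hK => (h.1 t ht K hK).2)
    (fun B hB hB' => (h.2.2.1 B hB hB').2) fun K hK => by
      simpa only [add_comm] using h.2.2.2 K hK

/-- The difference of two solutions with the same initial condition is a null solution. -/
lemma IsSolution.isNullSolution {d : ℕ} {T : ℝ} {β : ℝ → ℝ} (hβc : ContinuousOn β (Ici 0))
    {b : EuclideanSpace ℝ (Fin d) → ℝ → EuclideanSpace ℝ (Fin d)}
    (hb : ∀ x t, b x t = -(β (‖x‖ ^ 2)) • x) {νp νn : Measure (EuclideanSpace ℝ (Fin d))}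
    {p₁ n₁ p₂ n₂ : ℝ → Measure (EuclideanSpace ℝ (Fin d))}
    (hfam₁ : IsLocFamily T p₁ n₁) (hfam₂ : IsLocFamily T p₂ n₂)
    (hsol₁ : IsSolution T b νp νn p₁ n₁) (hsol₂ : IsSolution T b νp νn p₂ n₂) :
    IsNullSolution T β (fun t => p₁ t + n₂ t) (fun t => p₂ t + n₁ t) := by
  intro u hu ⟨R, hR, huR⟩
  have hBc : Continuous fun x : EuclideanSpace ℝ (Fin d) => β (‖x‖ ^ 2) :=
    hβc.comp_continuous (by fun_prop) fun x => sq_nonneg ‖x‖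
  have hF : ∀ s, (fun x => deriv (u x) s + ⟪b x s, gradient (fun y => u y s) x⟫) =
      fun x => deriv (u x) s - β (‖x‖ ^ 2) * fderiv ℝ (fun y => u y s) x x := fun s => by
    funext x
    rw [hb, inner_smul_left, real_inner_comm, gradient, InnerProductSpace.toDual_symm_apply]
    simp [sub_eq_add_neg]
  have hFc := continuous_transport hBc hu
  have hF0 : ∀ x s, R < ‖x‖ →
      deriv (u x) s - β (‖x‖ ^ 2) * fderiv ℝ (fun y => u y s) x x = 0 := fun x s hx =>
    transport_eq_zero huR s hx
  have hp₁ := hfam₁.isPosFamily_left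
  have hn₁ := hfam₁.isPosFamily_right
  have hp₂ := hfam₂.isPosFamily_left
  have hn₂ := hfam₂.isPosFamily_right
  have hadd : ∀ {q q' : ℝ → Measure (EuclideanSpace ℝ (Fin d))}, IsPosFamily T q →
      IsPosFamily T q' → ∀ {f : EuclideanSpace ℝ (Fin d) → ℝ → ℝ},
      Continuous (fun z : EuclideanSpace ℝ (Fin d) × ℝ => f z.1 z.2) →
      (∀ x s, R < ‖x‖ → f x s = 0) → ∀ s ∈ Icc 0 T,
      ∫ x, f x s ∂(q s + q' s) = (∫ x, f x s ∂(q s)) + ∫ x, f x s ∂(q' s) := by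
    intro q q' hq hq' f hf hfR s hs
    have hfs : Continuous fun x => f x s := hf.comp (Continuous.prodMk_left s)
    exact integral_add_measure (hq.integrable_of_continuous hs hfs fun x hx => hfR x s hx)
      (hq'.integrable_of_continuous hs hfs fun x hx => hfR x s hx)
  filter_upwards [hsol₁.2 u hu ⟨R, hR, huR⟩, hsol₂.2 u hu ⟨R, hR, huR⟩,
    ae_restrict_mem measurableSet_Icc] with t h₁ h₂ ht
  have hint : ∀ {q : ℝ → Measure (EuclideanSpace ℝ (Fin d))}, IsPosFamily T q →
      IntegrableOn (fun s => ∫ x, deriv (u x) s - β (‖x‖ ^ 2) *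
        fderiv ℝ (fun y => u y s) x x ∂(q s)) (Icc 0 t) := fun hq =>
    (hq.integrableOn_integral hFc hF0).mono_set (Icc_subset_Icc_right ht.2)
  simp only [sint, hF] at h₁ h₂
  rw [hadd hp₁ hn₂ hu.continuous huR t ht, hadd hp₂ hn₁ hu.continuous huR t ht]
  have hsplit : ∀ s ∈ Icc 0 t,
      (∫ x, deriv (u x) s - β (‖x‖ ^ 2) * fderiv ℝ (fun y => u y s) x x ∂(p₁ s + n₂ s)) -
        ∫ x, deriv (u x) s - β (‖x‖ ^ 2) * fderiv ℝ (fun y => u y s) x x ∂(p₂ s + n₁ s) =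
      ((∫ x, deriv (u x) s - β (‖x‖ ^ 2) * fderiv ℝ (fun y => u y s) x x ∂(p₁ s)) -
        ∫ x, deriv (u x) s - β (‖x‖ ^ 2) * fderiv ℝ (fun y => u y s) x x ∂(n₁ s)) -
      ((∫ x, deriv (u x) s - β (‖x‖ ^ 2) * fderiv ℝ (fun y => u y s) x x ∂(p₂ s)) -
        ∫ x, deriv (u x) s - β (‖x‖ ^ 2) * fderiv ℝ (fun y => u y s) x x ∂(n₂ s)) := by
    intro s hs
    have hsT := Icc_subset_Icc_right ht.2 hs
    rw [hadd hp₁ hn₂ hFc hF0 s hsT, hadd hp₂ hn₁ hFc hF0 s hsT]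
    ring
  rw [setIntegral_congr_fun measurableSet_Icc hsplit,
    integral_sub ((hint hp₁).fun_sub (hint hn₁)) ((hint hp₂).fun_sub (hint hn₂))]
  linarith

/-- **Example (radially symmetric drift).** Let `b(x) = -β(|x|²) x` where
`β ≥ 0` is bounded and continuous on `[0,∞)` and for every `N > 0` there is
`Λ_N > 0` such that `s ↦ β(s) - Λ_N s` is decreasing on `[0,N]`.  Then the
Cauchy problem `∂_t μ + div(b μ) = 0`, `μ|_{t=0} = ν` has at most one solution
in the class of all locally bounded measures given by families `(μ_t)` with
`|μ_t|(∂Z ∖ {0}) = 0` for a.e. `t`, where `Z = {x : β(|x|²) = 0}`. -/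
theorem uniqueness_radial_drift
    {d : ℕ} (T : ℝ) (hT : 0 < T)
    (β : ℝ → ℝ)
    (hβcont : ContinuousOn β (Ici (0:ℝ)))
    (hβ0 : ∀ s ∈ Ici (0:ℝ), 0 ≤ β s)
    (hβbdd : ∃ M : ℝ, ∀ s ∈ Ici (0:ℝ), β s ≤ M)
    (hβdec : ∀ N : ℝ, 0 < N → ∃ Λ : ℝ, 0 < Λ ∧
      AntitoneOn (fun s => β s - Λ * s) (Icc (0:ℝ) N))
    (b : EuclideanSpace ℝ (Fin d) → ℝ → EuclideanSpace ℝ (Fin d))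
    (hbdef : ∀ x t, b x t = -(β (‖x‖ ^ 2)) • x)
    (νp νn : Measure (EuclideanSpace ℝ (Fin d)))
    (hν : ∀ K : Set (EuclideanSpace ℝ (Fin d)), IsCompact K → νp K < ⊤ ∧ νn K < ⊤)
    (p₁ n₁ p₂ n₂ : ℝ → Measure (EuclideanSpace ℝ (Fin d)))
    (hfam₁ : IsLocFamily T p₁ n₁) (hfam₂ : IsLocFamily T p₂ n₂)
    (hsol₁ : IsSolution T b νp νn p₁ n₁) (hsol₂ : IsSolution T b νp νn p₂ n₂)
    (hZ₁ : ∀ᵐ t ∂(volume.restrict (Icc (0:ℝ) T)),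
      (p₁ t + n₁ t)
        (frontier {x : EuclideanSpace ℝ (Fin d) | β (‖x‖ ^ 2) = 0} \ {0}) = 0)
    (hZ₂ : ∀ᵐ t ∂(volume.restrict (Icc (0:ℝ) T)),
      (p₂ t + n₂ t)
        (frontier {x : EuclideanSpace ℝ (Fin d) | β (‖x‖ ^ 2) = 0} \ {0}) = 0) :
    ∀ᵐ t ∂(volume.restrict (Icc (0:ℝ) T)), p₁ t + n₂ t = p₂ t + n₁ t := by
  obtain ⟨M, hM⟩ := hβbdd
  refine IsNullSolution.ae_eq hT hβcont hβ0 hM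
    (hsol₁.isNullSolution hβcont hbdef hfam₁ hfam₂ hsol₂)
    (hfam₁.isPosFamily_left.add hfam₂.isPosFamily_right)
    (hfam₂.isPosFamily_left.add hfam₁.isPosFamily_right) ?_
  filter_upwards [hZ₁, hZ₂] with t h₁ h₂
  rw [Measure.add_apply, add_eq_zero] at h₁ h₂
  simp [h₁, h₂]
end
end

section
/- Let b(x) = −β(W(x)) ∇W(x) on ℝ^d, where W is a smooth bounded function on ℝ^d with bounded derivatives and β is a nonnegative continuous function on ℝ such that s ↦ β(s) − Λ s is decreasing for some number Λ > 0. Then for every bounded Borel measure ν on ℝ^d, the Cauchy problem ∂_t μ + div(b μ) = 0, μ|_{t=0} = ν has at most one solution in the class of all bounded measures μ given by families of bounded measures (μ_t)_{t∈[0,T]} such that |μ_t|(∂Z ∖ 𝒲) = 0 for almost all t ∈ [0,T], where ∂Z is the topological boundary of the set Z = {x : β(W(x)) = 0} and 𝒲 = {x : |∇W(x)| = 0}. -/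
open MeasureTheory Metric Set Filter
open scoped Topology ENNReal RealInnerProductSpace

noncomputable section

/-- A bounded Lipschitz vector field on a Banach space has a globally defined flow. -/
theorem exists_global_flow {E : Type*} [NormedAddCommGroup E] [NormedSpace ℝ E] [CompleteSpace E]
    {v : E → E} {K B : NNReal} (hv : LipschitzWith K v) (hB : ∀ x, ‖v x‖ ≤ B) :
    ∃ Φ : ℝ → E → E, (∀ x, Φ 0 x = x) ∧
      ∀ x t, HasDerivAt (fun s => Φ s x) (v (Φ t x)) t := by
  have key : ∀ (N : ℕ) (x : E), ∃ α : ℝ → E, α 0 = x ∧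
      ∀ t ∈ Ioo (-((N : ℝ) + 1)) ((N : ℝ) + 1), HasDerivAt α (v (α t)) t := by
    intro N x
    have hN : (0 : ℝ) < (N : ℝ) + 1 := by positivity
    have hpl : IsPicardLindelof (fun _ : ℝ => v)
        (⟨0, by constructor <;> linarith⟩ : Icc (-((N : ℝ) + 1)) ((N : ℝ) + 1)) x
        (B * (N + 1)) 0 B K :=
      { lipschitzOnWith := fun _ _ => hv.lipschitzOnWith
        continuousOn := fun _ _ => continuousOn_const
        norm_le := fun _ _ y _ => hB y
        mul_max_le := by simp }
    obtain ⟨α, h0, hα⟩ := hpl.exists_eq_forall_mem_Icc_hasDerivWithinAt₀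
    exact ⟨α, h0, fun t ht => (hα t (Ioo_subset_Icc_self ht)).hasDerivAt
      (Icc_mem_nhds ht.1 ht.2)⟩
  choose α h0 hα using key
  have huniq : ∀ (n m : ℕ) (x : E) (t : ℝ), n ≤ m → |t| < n + 1 → α n x t = α m x t := by
    intro n m x t hnm ht
    have hnm' : (n : ℝ) ≤ m := by exact_mod_cast hnm
    have hn : (0 : ℝ) ≤ n := by positivity
    refine ODE_solution_unique_of_mem_Ioo (v := fun _ => v) (s := fun _ => univ) (K := K)
      (a := -((n : ℝ) + 1)) (b := (n : ℝ) + 1) (t₀ := 0)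
      (fun _ _ => hv.lipschitzOnWith) ⟨by linarith, by linarith⟩
      (fun s hs => ⟨hα n x s hs, mem_univ _⟩)
      (fun s hs => ⟨hα m x s ⟨by linarith [hs.1], by linarith [hs.2]⟩, mem_univ _⟩)
      (by rw [h0, h0]) (abs_lt.1 ht)
  refine ⟨fun t x => α ⌈|t|⌉₊ x t, fun x => h0 _ x, fun x t => ?_⟩
  have hev : (fun s => α ⌈|s|⌉₊ x s) =ᶠ[𝓝 t] fun s => α (⌈|t|⌉₊ + 1) x s := by
    have : ∀ᶠ s : ℝ in 𝓝 t, |s| < |t| + 1 :=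
      (continuous_abs.tendsto t).eventually_lt_const (by linarith)
    filter_upwards [this] with s hs
    refine huniq _ _ _ _ ?_ (by linarith [Nat.le_ceil |s|])
    refine Nat.ceil_le.2 ?_
    push_cast
    linarith [Nat.le_ceil |t|]
  have hd := hα (⌈|t|⌉₊ + 1) x t (abs_lt.1 (by push_cast; linarith [Nat.le_ceil |t|]))
  have := hd.congr_of_eventuallyEq hev
  rwa [← hev.eq_of_nhds] at this

/-- The flow maps of an autonomous Lipschitz vector field form a one-parameter group. -/
theorem flow_add {E : Type*} [NormedAddCommGroup E] [NormedSpace ℝ E]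
    {v : E → E} {K : NNReal} (hv : LipschitzWith K v) {Φ : ℝ → E → E} (hΦ0 : ∀ x, Φ 0 x = x)
    (hΦ : ∀ x t, HasDerivAt (fun s => Φ s x) (v (Φ t x)) t) (s t : ℝ) (x : E) :
    Φ t (Φ s x) = Φ (t + s) x := by
  have h := ODE_solution_unique_univ (v := fun _ => v) (s := fun _ => univ) (K := K) (t₀ := 0)
    (f := fun r => Φ r (Φ s x)) (g := fun r => Φ (r + s) x)
    (fun _ => hv.lipschitzOnWith) (fun r => ⟨hΦ _ r, mem_univ _⟩)
    (fun r => ⟨(hΦ x (r + s)).comp_add_const r s, mem_univ _⟩) (by simp [hΦ0])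
  exact congrFun h t

/-- Lipschitz dependence of the flow on the initial condition. -/
theorem dist_flow_le {E : Type*} [NormedAddCommGroup E] [NormedSpace ℝ E]
    {v : E → E} {K : NNReal} (hv : LipschitzWith K v) {Φ : ℝ → E → E} (hΦ0 : ∀ x, Φ 0 x = x)
    (hΦ : ∀ x t, HasDerivAt (fun s => Φ s x) (v (Φ t x)) t) (t : ℝ) (x y : E) :
    dist (Φ t x) (Φ t y) ≤ dist x y * Real.exp (K * |t|) := by
  rcases le_total 0 t with ht | ht
  · have := dist_le_of_trajectories_ODE (v := fun _ => v) (K := K) (a := 0) (b := t)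
      (f := fun r => Φ r x) (g := fun r => Φ r y) (δ := dist x y) (fun _ => hv)
      (fun r _ => (hΦ x r).continuousAt.continuousWithinAt)
      (fun r _ => (hΦ x r).hasDerivWithinAt)
      (fun r _ => (hΦ y r).continuousAt.continuousWithinAt)
      (fun r _ => (hΦ y r).hasDerivWithinAt) (by simp [hΦ0]) t ⟨ht, le_rfl⟩
    simpa [abs_of_nonneg ht] using this
  · have hd : ∀ z r, HasDerivAt (fun s => Φ (-s) z) (-v (Φ (-r) z)) r := by
      intro z r
      simpa [Function.comp_def] using (hΦ z (-r)).scomp r (hasDerivAt_neg r)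
    have := dist_le_of_trajectories_ODE (v := fun _ z => -v z) (K := K) (a := 0) (b := -t)
      (f := fun r => Φ (-r) x) (g := fun r => Φ (-r) y) (δ := dist x y) (fun _ => hv.neg)
      (fun r _ => (hd x r).continuousAt.continuousWithinAt)
      (fun r _ => (hd x r).hasDerivWithinAt)
      (fun r _ => (hd y r).continuousAt.continuousWithinAt)
      (fun r _ => (hd y r).hasDerivWithinAt) (by simp [hΦ0]) (-t) ⟨by linarith, le_rfl⟩
    simpa [abs_of_nonpos ht] using this

/-- The flow of a vector field bounded by `B` moves points with speed at most `B`. -/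
theorem norm_flow_sub_le {E : Type*} [NormedAddCommGroup E] [NormedSpace ℝ E]
    {v : E → E} {B : ℝ} (hB : ∀ x, ‖v x‖ ≤ B) {Φ : ℝ → E → E}
    (hΦ : ∀ x t, HasDerivAt (fun s => Φ s x) (v (Φ t x)) t) (s t : ℝ) (x : E) :
    ‖Φ t x - Φ s x‖ ≤ B * |t - s| := by
  simpa using Convex.norm_image_sub_le_of_norm_hasDerivWithin_le (s := univ) (x := s) (y := t)
    (fun r _ => (hΦ x r).hasDerivWithinAt) (fun r _ => hB _) convex_univ trivial trivial

/-- First-order expansion of the flow with the vector field frozen at a nearby point. -/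
theorem norm_flow_sub_add_smul_le {E : Type*} [NormedAddCommGroup E] [NormedSpace ℝ E]
    {v : E → E} {K : NNReal} (hv : LipschitzWith K v) {B : ℝ} (hB : ∀ x, ‖v x‖ ≤ B)
    {Φ : ℝ → E → E} (hΦ0 : ∀ x, Φ 0 x = x)
    (hΦ : ∀ x t, HasDerivAt (fun s => Φ s x) (v (Φ t x)) t) {ε h : ℝ} {x y : E}
    (hxy : ‖y - x‖ ≤ ε) (hh : |h| ≤ ε) :
    ‖(y + h • v x) - Φ h y‖ ≤ K * (1 + B) * ε * |h| := by
  have hB0 : 0 ≤ B := (norm_nonneg _).trans (hB x)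
  have hd : ∀ r, HasDerivAt (fun s => Φ s y - s • v x) (v (Φ r y) - v x) r := by
    intro r
    have h1 : HasDerivAt (fun s : ℝ => s • v x) (v x) r := by
      simpa using (hasDerivAt_id r).smul_const (v x)
    exact (hΦ y r).sub h1
  have := Convex.norm_image_sub_le_of_norm_hasDerivWithin_le (s := Icc (-|h|) |h|) (x := 0) (y := h)
    (f := fun s => Φ s y - s • v x) (f' := fun r => v (Φ r y) - v x) (C := K * (1 + B) * ε)
    (fun r _ => (hd r).hasDerivWithinAt) (fun r hr => ?_) (convex_Icc _ _)
    ⟨by simp, by simp⟩ ⟨neg_abs_le h, le_abs_self h⟩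
  · rw [← norm_neg]
    simpa [hΦ0, sub_eq_add_neg, add_assoc, add_comm, add_left_comm] using this
  · have h1 : ‖Φ r y - y‖ ≤ B * |r| := by
      simpa [hΦ0] using norm_flow_sub_le hB hΦ 0 r y
    have hr' : |r| ≤ ε := (abs_le.2 hr).trans hh
    calc ‖v (Φ r y) - v x‖ ≤ K * ‖Φ r y - x‖ := hv.norm_sub_le _ _
      _ ≤ K * ((1 + B) * ε) := by
        gcongr
        calc ‖Φ r y - x‖ = ‖(Φ r y - y) + (y - x)‖ := by congr 1; abel
          _ ≤ ‖Φ r y - y‖ + ‖y - x‖ := norm_add_le _ _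
          _ ≤ B * ε + ε := add_le_add (h1.trans (by gcongr)) hxy
          _ = (1 + B) * ε := by ring
      _ = K * (1 + B) * ε := by ring

open scoped Convolution in
/-- Mollification: a continuous function on a finite-dimensional space has a `C¹` regularization
whose directional derivatives and values at `q` obey every one-sided bound satisfied by the
difference quotients, respectively by the values, on the ball of radius `ε` around `q`. -/
theorem exists_contDiff_mollification {G : Type*} [NormedAddCommGroup G] [NormedSpace ℝ G]
    [FiniteDimensional ℝ G] [MeasureSpace G] [BorelSpace G]
    [(volume : Measure G).IsAddHaarMeasure] {u : G → ℝ} (hu : Continuous u) {ε : ℝ} (hε : 0 < ε) :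
    ∃ U : G → ℝ, ContDiff ℝ 1 U ∧
      (∀ (q w : G) (C : ℝ), (∀ᶠ h : ℝ in 𝓝 0, ∀ z ∈ ball q ε, |u (z + h • w) - u z| ≤ C * |h|) →
        |fderiv ℝ U q w| ≤ C) ∧
      ∀ (q : G) (c C : ℝ), (∀ z ∈ ball q ε, |u z - c| ≤ C) → |U q - c| ≤ C := by
  let φ : ContDiffBump (0 : G) := ⟨ε / 2, ε, by linarith, by linarith⟩
  set ρ : G → ℝ := φ.normed volume with hρ
  have hρc : HasCompactSupport ρ := φ.hasCompactSupport_normed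
  have hρcont : Continuous ρ := φ.continuous_normed
  have hint : ∀ g : G → ℝ, Continuous g → Integrable (fun z => ρ z * g z) volume := fun g hg =>
    (hρcont.mul hg).integrable_of_hasCompactSupport hρc.mul_right
  have hρ1 : ∫ z, ρ z = 1 := φ.integral_normed
  have bound : ∀ (g : G → ℝ) (q : G) (C : ℝ), Continuous g → (∀ z ∈ ball q ε, |g z| ≤ C) →
      |∫ z, ρ z * g (q - z)| ≤ C := by
    intro g q C hg hC
    have hg' : Continuous fun z => g (q - z) := by fun_prop
    calc |∫ z, ρ z * g (q - z)| ≤ ∫ z, |ρ z * g (q - z)| := abs_integral_le_integral_abs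
      _ ≤ ∫ z, ρ z * C := by
        refine integral_mono (hint _ hg').abs (hint _ continuous_const) fun z => ?_
        have h0 : 0 ≤ ρ z := φ.nonneg_normed z
        simp only [abs_mul, abs_of_nonneg h0]
        by_cases hz : z ∈ ball (0 : G) ε
        · refine mul_le_mul_of_nonneg_left (hC _ ?_) h0
          simpa [mem_ball, dist_eq_norm] using hz
        · have : ρ z = 0 := by
            have := φ.support_normed_eq (μ := volume)
            by_contra hne
            exact hz (this ▸ (Function.mem_support.2 hne))
          simp [this]
      _ = C := by rw [integral_mul_const, hρ1, one_mul]
  refine ⟨fun q => ∫ z, ρ z * u (q - z), ?_, ?_, ?_⟩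
  · exact hρc.contDiff_convolution_left (ContinuousLinearMap.lsmul ℝ ℝ) φ.contDiff_normed
      (hu.locallyIntegrable (μ := volume))
  · intro q w C hC
    have hdiff : DifferentiableAt ℝ (fun q => ∫ z, ρ z * u (q - z)) q := by
      have : ContDiff ℝ 1 (fun q => ∫ z, ρ z * u (q - z)) :=
        hρc.contDiff_convolution_left (ContinuousLinearMap.lsmul ℝ ℝ) φ.contDiff_normed
          (hu.locallyIntegrable (μ := volume))
      exact this.differentiable one_ne_zero q
    have hline := hdiff.hasFDerivAt.hasLineDerivAt w
    have hC0 : 0 ≤ C := by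
      have h1 : ∀ᶠ h : ℝ in 𝓝[≠] 0, ∀ z ∈ ball q ε, |u (z + h • w) - u z| ≤ C * |h| :=
        hC.filter_mono nhdsWithin_le_nhds
      obtain ⟨h, hh, hne⟩ := (h1.and self_mem_nhdsWithin).exists
      have := (abs_nonneg _).trans (hh q (mem_ball_self hε))
      exact nonneg_of_mul_nonneg_left this (abs_pos.2 hne)
    refine HasDerivAt.le_of_lip' hline hC0 ?_
    filter_upwards [hC] with h hh
    have e : (∫ z, ρ z * u (q + h • w - z)) - ∫ z, ρ z * u (q + (0 : ℝ) • w - z)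
        = ∫ z, ρ z * (fun y => u (y + h • w) - u y) (q - z) := by
      rw [← integral_sub (hint _ (by fun_prop)) (hint _ (by fun_prop))]
      congr 1; ext z
      rw [← mul_sub]
      simp [sub_add_eq_add_sub]
    simp only [Real.norm_eq_abs, sub_zero]
    rw [e]
    exact bound _ _ _ (by fun_prop) hh
  · intro q c C hC
    have e : (∫ z, ρ z * u (q - z)) - c = ∫ z, ρ z * (fun y => u y - c) (q - z) := by
      simp only [mul_sub]
      rw [integral_sub (hint _ (by fun_prop)) (hint _ (by fun_prop)), integral_mul_const, hρ1,
        one_mul]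
    rw [e]
    exact bound _ _ _ (by fun_prop) hC

/-- A bounded continuous nonnegative function is the pointwise limit of its Lipschitz
regularizations from above, which moreover vanish eventually at the interior points of its zero
set. -/
theorem exists_lipschitz_approx_above {β : ℝ → ℝ} (hβ : Continuous β) (hβ0 : ∀ s, 0 ≤ β s)
    {M : ℝ} (hM : ∀ s, β s ≤ M) :
    ∃ f : ℕ → ℝ → ℝ, (∀ n : ℕ, LipschitzWith (n : NNReal) (f n)) ∧ (∀ n s, β s ≤ f n s) ∧
      (∀ n s, f n s ≤ M) ∧ (∀ s, Tendsto (fun n => f n s) atTop (𝓝 (β s))) ∧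
      ∀ s, (∀ᶠ r in 𝓝 s, β r = 0) → ∀ᶠ n in atTop, f n s = 0 := by
  have hbd : ∀ (n : ℕ) (s : ℝ), BddAbove (range fun r => β r - n * |s - r|) := by
    rintro n s
    refine ⟨M, ?_⟩
    rintro _ ⟨r, rfl⟩
    have : 0 ≤ (n : ℝ) * |s - r| := by positivity
    linarith [hM r]
  have hle : ∀ (n : ℕ) s, β s ≤ ⨆ r, (β r - n * |s - r|) := fun n s => by
    simpa using le_ciSup (hbd n s) s
  have hfar : ∀ s C δ, 0 < δ → 0 ≤ C → (∀ r, |r - s| < δ → β r ≤ C) →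
      ∀ᶠ n : ℕ in atTop, ⨆ r, (β r - n * |s - r|) ≤ C := by
    intro s C δ hδ hC h
    obtain ⟨N, hN⟩ := exists_nat_gt (M / δ)
    filter_upwards [eventually_ge_atTop N] with n hn
    refine ciSup_le fun r => ?_
    by_cases hr : |r - s| < δ
    · have : 0 ≤ (n : ℝ) * |s - r| := by positivity
      linarith [h r hr]
    · rw [abs_sub_comm, not_lt] at hr
      have h1 : M < n * δ := by
        rw [div_lt_iff₀ hδ] at hN
        exact hN.trans_le (by gcongr)
      have h2 : (n : ℝ) * δ ≤ n * |s - r| := by gcongr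
      linarith [hM r]
  refine ⟨fun n s => ⨆ r, (β r - n * |s - r|), fun n => ?_, hle, fun n s => ?_, fun s => ?_,
    fun s hs => ?_⟩
  · refine LipschitzWith.of_le_add_mul _ fun s s' => ciSup_le fun r => ?_
    have h1 := le_ciSup (hbd n s') r
    have h2 : (n : ℝ) * |s' - r| ≤ n * |s - r| + n * |s - s'| := by
      rw [← mul_add]
      gcongr
      rw [add_comm, abs_sub_comm s s']
      exact abs_sub_le s' s r
    simp only [Real.dist_eq, NNReal.coe_natCast]
    linarith
  · refine ciSup_le fun r => ?_
    have : 0 ≤ (n : ℝ) * |s - r| := by positivity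
    linarith [hM r]
  · refine tendsto_order.2 ⟨fun a ha => Eventually.of_forall fun n => ha.trans_le (hle n s),
      fun a ha => ?_⟩
    obtain ⟨c, hc, hca⟩ := exists_between ha
    obtain ⟨δ, hδ, h⟩ := Metric.eventually_nhds_iff.1 ((hβ.tendsto s).eventually_lt_const hc)
    filter_upwards [hfar s c δ hδ ((hβ0 s).trans hc.le) fun r hr => (h hr).le] with n hn
    exact hn.trans_lt hca
  · obtain ⟨δ, hδ, h⟩ := Metric.eventually_nhds_iff.1 hs
    filter_upwards [hfar s 0 δ hδ le_rfl fun r hr => (h hr).le] with n hn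
    exact le_antisymm hn ((hβ0 s).trans (hle n s))

/-- Approximate solutions of the backward transport equation: for a bounded Lipschitz vector
field `v` and Lipschitz data `ψ` prescribed at time `τ`, there is a `C¹` function whose derivative
along `(v, 1)` is at most `δ` on `[0,T]`, with bounds on its support and time derivative which
depend only on `ψ` and the bound of `v`. -/
theorem exists_transport_test_function {d : ℕ}
    {v : EuclideanSpace ℝ (Fin d) → EuclideanSpace ℝ (Fin d)} {K B : NNReal}
    (hv : LipschitzWith K v) (hB : ∀ x, ‖v x‖ ≤ B) {ψ : EuclideanSpace ℝ (Fin d) → ℝ}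
    {L : NNReal} (hψ : LipschitzWith L ψ) {R : ℝ} (hR : ∀ x, R < ‖x‖ → ψ x = 0) {T τ : ℝ}
    (hτ : τ ∈ Icc (0 : ℝ) T) {δ : ℝ} (hδ : 0 < δ) :
    ∃ U : EuclideanSpace ℝ (Fin d) × ℝ → ℝ, ContDiff ℝ 1 U ∧
      (∀ x t, R + B * (T + 1) + 1 < ‖x‖ → U (x, t) = 0) ∧
      (∀ x, ∀ t ∈ Icc (0 : ℝ) T, |U (x, t) - ψ x| ≤ L * B * |τ - t| + δ) ∧
      (∀ x, ∀ t ∈ Icc (0 : ℝ) T, |fderiv ℝ U (x, t) (0, 1)| ≤ L * B) ∧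
      ∀ x, ∀ t ∈ Icc (0 : ℝ) T, |fderiv ℝ U (x, t) (v x, 1)| ≤ δ := by
  obtain ⟨Φ, hΦ0, hΦ⟩ := exists_global_flow hv hB
  have hT : 0 ≤ T := hτ.1.trans hτ.2
  let c : ℝ → ℝ := fun t => max (-1) (min t (T + 1))
  have hc_id : ∀ s, -1 ≤ s → s ≤ T + 1 → c s = s := fun s h1 h2 => by
    simp only [c, min_eq_left h2, max_eq_right h1]
  have hc_mem : ∀ s, |τ - c s| ≤ T + 1 := fun s => by
    have h1 : -1 ≤ c s := le_max_left _ _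
    have h2 : c s ≤ T + 1 := max_le (by linarith) (min_le_right _ _)
    rw [abs_le]
    constructor <;> linarith [hτ.1, hτ.2]
  have hc_lip : ∀ s t, |c s - c t| ≤ |s - t| := fun s t =>
    (abs_max_sub_max_le_max _ _ _ _).trans
      (max_le (by simp) ((abs_min_sub_min_le_max _ _ _ _).trans (by simp)))
  have hc_cont : Continuous c := by fun_prop
  have hψ' : ∀ x y, |ψ x - ψ y| ≤ L * ‖x - y‖ := fun x y => hψ.norm_sub_le x y
  have hexp : ∀ r x y, |r| ≤ T + 1 → ‖Φ r x - Φ r y‖ ≤ Real.exp (K * (T + 1)) * ‖x - y‖ := by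
    intro r x y hr
    have := dist_flow_le hv hΦ0 hΦ r x y
    rw [dist_eq_norm, dist_eq_norm, mul_comm] at this
    exact this.trans (by gcongr)
  have hmove : ∀ r x, ‖Φ r x - x‖ ≤ B * |r| := fun r x => by
    simpa [hΦ0] using norm_flow_sub_le hB hΦ 0 r x
  let u : EuclideanSpace ℝ (Fin d) × ℝ → ℝ := fun q => ψ (Φ (τ - c q.2) q.1)
  have hu : Continuous u := by
    refine hψ.continuous.comp
      (continuous_prod_of_continuous_lipschitzWith _ (Real.exp (K * (T + 1))).toNNReal ?_ ?_)
    · intro x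
      have : Continuous fun s => Φ s x :=
        continuous_iff_continuousAt.2 fun s => (hΦ x s).continuousAt
      exact this.comp (by fun_prop)
    · refine fun t => LipschitzWith.of_dist_le_mul fun x y => ?_
      rw [dist_eq_norm, dist_eq_norm, Real.coe_toNNReal _ (Real.exp_pos _).le]
      exact hexp _ _ _ (hc_mem t)
  set A : ℝ := L * Real.exp (K * (T + 1)) * (K * (1 + B)) with hA
  have hA0 : 0 ≤ A := by positivity
  set D : ℝ := A + L * (1 + B) + 1 with hD
  have hD0 : 0 < D := by positivity
  set ε : ℝ := min (1 / 2) (δ / D) with hε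
  have hε0 : 0 < ε := by positivity
  have hε1 : ε ≤ 1 / 2 := min_le_left _ _
  have hεD : D * ε ≤ δ := by
    calc D * ε ≤ D * (δ / D) := by gcongr; exact min_le_right _ _
      _ = δ := by field_simp
  have hAε : A * ε ≤ δ := le_trans (by gcongr; rw [hD]; nlinarith [L.2, B.2, mul_nonneg L.2 B.2]) hεD
  have hLε : L * (1 + B) * ε ≤ δ := le_trans (by gcongr; rw [hD]; linarith) hεD
  have hball : ∀ {x t} {z : EuclideanSpace ℝ (Fin d) × ℝ}, z ∈ ball (x, t) ε →
      ‖z.1 - x‖ < ε ∧ |z.2 - t| < ε := by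
    intro x t z hz
    rw [mem_ball, Prod.dist_eq, max_lt_iff, dist_eq_norm, Real.dist_eq] at hz
    exact hz
  have : (volume : Measure (EuclideanSpace ℝ (Fin d) × ℝ)).IsAddHaarMeasure := by
    rw [Measure.volume_eq_prod]
    infer_instance
  obtain ⟨U, hU, hUd, hUc⟩ := exists_contDiff_mollification hu hε0
  refine ⟨U, hU, fun x t hx => ?_, fun x t ht => ?_, fun x t ht => ?_, fun x t ht => ?_⟩
  · have := hUc (x, t) 0 0 fun z hz => ?_
    · simpa using this
    · obtain ⟨h1, -⟩ := hball hz
      have h2 := hmove (τ - c z.2) z.1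
      have h3 : (B : ℝ) * |τ - c z.2| ≤ B * (T + 1) := by gcongr; exact hc_mem _
      have h4 : ‖x‖ ≤ ‖Φ (τ - c z.2) z.1‖ + ‖Φ (τ - c z.2) z.1 - z.1‖ + ‖z.1 - x‖ := by
        calc ‖x‖ = ‖Φ (τ - c z.2) z.1 - (Φ (τ - c z.2) z.1 - z.1) - (z.1 - x)‖ := by
              congr 1; abel
          _ ≤ _ := (norm_sub_le _ _).trans (by gcongr; exact norm_sub_le _ _)
      have : u z = 0 := hR _ (by linarith)
      simp [this]
  · refine hUc (x, t) (ψ x) _ fun z hz => ?_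
    obtain ⟨h1, h2⟩ := hball hz
    have h3 : |τ - c z.2| ≤ |τ - t| + ε := by
      have h4 := hc_lip t z.2
      rw [hc_id t (by linarith [ht.1]) (by linarith [ht.2]), abs_sub_comm t z.2] at h4
      exact (abs_sub_le τ t _).trans (by linarith)
    calc |u z - ψ x| ≤ L * ‖Φ (τ - c z.2) z.1 - x‖ := hψ' _ _
      _ ≤ L * (B * |τ - c z.2| + ‖z.1 - x‖) := by
        gcongr
        refine le_trans ?_ (add_le_add_left (hmove _ z.1) _)
        exact norm_sub_le_norm_sub_add_norm_sub _ _ _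
      _ ≤ L * (B * (|τ - t| + ε) + ε) := by gcongr
      _ = L * B * |τ - t| + L * (1 + B) * ε := by ring
      _ ≤ _ := by gcongr
  · refine hUd (x, t) _ _ (Eventually.of_forall fun h z _ => ?_)
    calc |u (z + h • (0, 1)) - u z|
        ≤ L * ‖Φ (τ - c (z.2 + h)) z.1 - Φ (τ - c z.2) z.1‖ := by
          simpa [u] using hψ' (Φ (τ - c (z.2 + h)) z.1) (Φ (τ - c z.2) z.1)
      _ ≤ L * (B * |h|) := by
        gcongr
        refine (norm_flow_sub_le hB hΦ _ _ _).trans ?_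
        refine mul_le_mul_of_nonneg_left ?_ B.2
        rw [sub_sub_sub_cancel_left, abs_sub_comm]
        simpa using hc_lip (z.2 + h) z.2
      _ = _ := by ring
  · refine (hUd (x, t) (v x, 1) (A * ε) ?_).trans hAε
    have hsm : ∀ᶠ h : ℝ in 𝓝 0, |h| < ε := by
      simpa using (continuous_abs.tendsto (0 : ℝ)).eventually_lt_const (by simpa using hε0)
    filter_upwards [hsm] with h hh z hz
    obtain ⟨h1, h2⟩ := hball hz
    have h2' := abs_lt.1 h2
    have hh' := abs_lt.1 hh
    have e1 : c z.2 = z.2 := hc_id _ (by linarith [ht.1]) (by linarith [ht.2])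
    have e2 : c (z.2 + h) = z.2 + h := hc_id _ (by linarith [ht.1]) (by linarith [ht.2])
    have e3 : u z = ψ (Φ (τ - c (z.2 + h)) (Φ h z.1)) := by
      simp only [u]
      rw [flow_add hv hΦ0 hΦ, e1, e2]
      congr 2
      ring
    have e4 : u (z + h • (v x, 1)) = ψ (Φ (τ - c (z.2 + h)) (z.1 + h • v x)) := by
      simp [u]
    rw [e3, e4]
    calc |ψ (Φ (τ - c (z.2 + h)) (z.1 + h • v x)) - ψ (Φ (τ - c (z.2 + h)) (Φ h z.1))|
        ≤ L * (Real.exp (K * (T + 1)) * ‖z.1 + h • v x - Φ h z.1‖) :=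
          (hψ' _ _).trans (by gcongr; exact hexp _ _ _ (hc_mem _))
      _ ≤ L * (Real.exp (K * (T + 1)) * (K * (1 + B) * ε * |h|)) := by
        gcongr
        exact norm_flow_sub_add_smul_le hv hB hΦ0 hΦ h1.le hh.le
      _ = A * ε * |h| := by rw [hA]; ring

/-- A family of measures on a pseudometric space depends measurably on the parameter as
soon as the measures of bounded Borel sets do. -/
theorem measurable_measure_of_isBounded {α X : Type*} [MeasurableSpace α] [PseudoMetricSpace X]
    [MeasurableSpace X] [OpensMeasurableSpace X] {p : α → Measure X}
    (h : ∀ s, MeasurableSet s → Bornology.IsBounded s → Measurable fun t => p t s) :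
    Measurable p := by
  refine Measure.measurable_of_measurable_coe _ fun s hs => ?_
  rcases isEmpty_or_nonempty X with hX | ⟨⟨x⟩⟩
  · simp [Set.eq_empty_of_isEmpty s]
  have hs' : s = ⋃ n : ℕ, s ∩ ball x n := by
    rw [← inter_iUnion, iUnion_ball_nat, inter_univ]
  have hmono : Monotone fun n : ℕ => s ∩ ball x n := fun m n hmn =>
    inter_subset_inter_right _ (ball_subset_ball (by exact_mod_cast hmn))
  have : (fun t => p t s) = fun t => ⨆ n : ℕ, p t (s ∩ ball x n) := by
    ext t
    conv_lhs => rw [hs']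
    exact hmono.measure_iUnion
  rw [this]
  exact Measurable.iSup fun n =>
    h _ (hs.inter measurableSet_ball) (isBounded_ball.subset inter_subset_right)

theorem IsLocFamily.measurable_add {d : ℕ} {T : ℝ}
    {p n : ℝ → Measure (EuclideanSpace ℝ (Fin d))} (h : IsLocFamily T p n) :
    Measurable fun t => p t + n t := by
  refine measurable_measure_of_isBounded fun s hs hb => ?_
  exact (h.2.2.1 s hs hb).1.add (h.2.2.1 s hs hb).2

theorem IsLocFamily.lintegral_lt_top {d : ℕ} {T : ℝ}
    {p n : ℝ → Measure (EuclideanSpace ℝ (Fin d))} (h : IsLocFamily T p n)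
    {K : Set (EuclideanSpace ℝ (Fin d))} (hK : IsCompact K) :
    ∫⁻ t in Icc (0 : ℝ) T, (p t + n t) K < ⊤ := by
  have h1 := (h.2.2.2 K hK).2
  rw [hasFiniteIntegral_iff_ofReal (ae_of_all _ fun t => by positivity)] at h1
  refine lt_of_le_of_lt (le_of_eq ?_) h1
  refine setLIntegral_congr_fun measurableSet_Icc fun t ht => ?_
  obtain ⟨hp, hn⟩ := h.1 t ht K hK
  rw [ENNReal.ofReal_add ENNReal.toReal_nonneg ENNReal.toReal_nonneg,
    ENNReal.ofReal_toReal hp.ne, ENNReal.ofReal_toReal hn.ne]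
  rfl

/-- Dominated convergence along a locally bounded family of measures, when the convergence holds off
a set which is negligible for almost every member of the family. -/
theorem IsLocFamily.tendsto_lintegral_lintegral {d : ℕ} {T : ℝ}
    {p n : ℝ → Measure (EuclideanSpace ℝ (Fin d))} (h : IsLocFamily T p n)
    {A : Set (EuclideanSpace ℝ (Fin d))}
    (hA : ∀ᵐ t ∂(volume.restrict (Icc (0 : ℝ) T)), (p t + n t) A = 0)
    {G : ℕ → EuclideanSpace ℝ (Fin d) → ℝ≥0∞} (hG : ∀ k, Measurable (G k))
    {R : ℝ} {c : ℝ≥0∞} (hc : c ≠ ⊤)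
    (hGc : ∀ k x, G k x ≤ (closedBall 0 R).indicator (fun _ => c) x)
    (hlim : ∀ x, x ∉ A → Tendsto (fun k => G k x) atTop (𝓝 0)) :
    Tendsto (fun k => ∫⁻ t in Icc (0 : ℝ) T, ∫⁻ x, G k x ∂(p t + n t)) atTop (𝓝 0) := by
  have hK : IsCompact (closedBall (0 : EuclideanSpace ℝ (Fin d)) R) := isCompact_closedBall _ _
  have key : Tendsto (fun k => ∫⁻ t in Icc (0 : ℝ) T, ∫⁻ x, G k x ∂(p t + n t)) atTop
      (𝓝 (∫⁻ _ in Icc (0 : ℝ) T, 0)) := by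
    refine tendsto_lintegral_of_dominated_convergence
      (fun t => c * (p t + n t) (closedBall 0 R))
      (fun k => (Measure.measurable_lintegral (hG k)).comp h.measurable_add)
      (fun k => ae_of_all _ fun t => ?_) ?_ ?_
    · calc ∫⁻ x, G k x ∂(p t + n t)
          ≤ ∫⁻ x, (closedBall 0 R).indicator (fun _ => c) x ∂(p t + n t) :=
            lintegral_mono (hGc k)
        _ = c * (p t + n t) (closedBall 0 R) := lintegral_indicator_const measurableSet_closedBall _
    · rw [lintegral_const_mul' _ _ hc]
      exact ENNReal.mul_ne_top hc (h.lintegral_lt_top hK).ne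
    · filter_upwards [hA, ae_restrict_mem measurableSet_Icc] with t ht htT
      have : Tendsto (fun k => ∫⁻ x, G k x ∂(p t + n t)) atTop (𝓝 (∫⁻ _, 0 ∂(p t + n t))) := by
        refine tendsto_lintegral_of_dominated_convergence
          ((closedBall 0 R).indicator fun _ => c) hG (fun k => ae_of_all _ (hGc k)) ?_ ?_
        · rw [lintegral_indicator_const measurableSet_closedBall]
          refine ENNReal.mul_ne_top hc ?_
          have := h.1 t htT _ hK
          simpa using ⟨this.1.ne, this.2.ne⟩
        · filter_upwards [measure_eq_zero_iff_ae_notMem.1 ht] with x hx using hlim x hx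
      simpa using this
  simpa using key

theorem enorm_sint_le {d : ℕ} (p n : ℝ → Measure (EuclideanSpace ℝ (Fin d))) (t : ℝ)
    (f : EuclideanSpace ℝ (Fin d) → ℝ) :
    ‖sint p n t f‖ₑ ≤ ∫⁻ x, ‖f x‖ₑ ∂(p t + n t) := by
  rw [lintegral_add_measure]
  exact (enorm_sub_le).trans
    (add_le_add (enorm_integral_le_lintegral_enorm _) (enorm_integral_le_lintegral_enorm _))

theorem sint_sub {d : ℕ} {p n : ℝ → Measure (EuclideanSpace ℝ (Fin d))} {t : ℝ}
    {f g : EuclideanSpace ℝ (Fin d) → ℝ} (hfp : Integrable f (p t)) (hfn : Integrable f (n t))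
    (hgp : Integrable g (p t)) (hgn : Integrable g (n t)) :
    sint p n t (fun x => f x - g x) = sint p n t f - sint p n t g := by
  simp only [sint]
  rw [integral_sub hfp hgp, integral_sub hfn hgn]
  ring

theorem enorm_setIntegral_sint_le {d : ℕ} {p n : ℝ → Measure (EuclideanSpace ℝ (Fin d))} {T t : ℝ}
    (ht : t ≤ T) {f : ℝ → EuclideanSpace ℝ (Fin d) → ℝ} {G : EuclideanSpace ℝ (Fin d) → ℝ≥0∞}
    (hf : ∀ s ∈ Icc 0 T, ∀ x, ‖f s x‖ₑ ≤ G x) :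
    ‖∫ s in Icc (0 : ℝ) t, sint p n s (f s)‖ₑ
      ≤ ∫⁻ s in Icc (0 : ℝ) T, ∫⁻ x, G x ∂(p s + n s) := by
  refine (enorm_integral_le_lintegral_enorm _).trans ?_
  refine (lintegral_mono_set (Icc_subset_Icc_right ht)).trans ?_
  refine setLIntegral_mono' measurableSet_Icc fun s hs => ?_
  exact (enorm_sint_le _ _ _ _).trans (lintegral_mono (hf s hs))

theorem fderiv_apply_prod_one_eq_deriv_add_inner {F : Type*} [NormedAddCommGroup F]
    [InnerProductSpace ℝ F] [CompleteSpace F] {U : F × ℝ → ℝ} (hU : Differentiable ℝ U)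
    (x w : F) (s : ℝ) :
    deriv (fun t => U (x, t)) s + ⟪w, gradient (fun y => U (y, s)) x⟫
      = fderiv ℝ U (x, s) (w, 1) := by
  have h1 : HasDerivAt (fun t => U (x, t)) (fderiv ℝ U (x, s) (0, 1)) s := by
    have := (hU (x, s)).hasFDerivAt.comp_hasDerivAt s
      ((hasDerivAt_const s x).prodMk (hasDerivAt_id s))
    exact this
  have h2 : HasFDerivAt (fun y => U (y, s))
      ((fderiv ℝ U (x, s)).comp (ContinuousLinearMap.inl ℝ F ℝ)) x :=
     (hU (x, s)).hasFDerivAt.comp (f := fun y : F => (y, s)) x (hasFDerivAt_prodMk_left x s)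
  rw [h1.deriv, real_inner_comm, gradient, InnerProductSpace.toDual_symm_apply, h2.fderiv,
    ContinuousLinearMap.comp_apply, ContinuousLinearMap.inl_apply, ← map_add]
  simp

/-- A solution of the continuity equation is almost constant in time when tested against a function
which is almost transported by the drift. -/
theorem IsSolution.ae_enorm_sint_sub_le {d : ℕ} {T : ℝ}
    {b : EuclideanSpace ℝ (Fin d) → ℝ → EuclideanSpace ℝ (Fin d)}
    {νp νn : Measure (EuclideanSpace ℝ (Fin d))} {p n : ℝ → Measure (EuclideanSpace ℝ (Fin d))}
    (hsol : IsSolution T b νp νn p n)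
    (hbdd : ∀ t ∈ Icc (0 : ℝ) T, p t univ < ⊤ ∧ n t univ < ⊤)
    {U : EuclideanSpace ℝ (Fin d) × ℝ → ℝ} (hU : ContDiff ℝ 1 U) {R : ℝ} (hR : 0 < R)
    (hUR : ∀ x t, R < ‖x‖ → U (x, t) = 0)
    {ψ : EuclideanSpace ℝ (Fin d) → ℝ} (hψ : Continuous ψ) (hψR : ∀ x, R < ‖x‖ → ψ x = 0)
    {ε : ℝ → ℝ} (hε : ∀ x, ∀ t ∈ Icc (0 : ℝ) T, |U (x, t) - ψ x| ≤ ε t)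
    {G : EuclideanSpace ℝ (Fin d) → ℝ≥0∞}
    (hG : ∀ s ∈ Icc (0 : ℝ) T, ∀ x, ‖fderiv ℝ U (x, s) (b x s, 1)‖ₑ ≤ G x) :
    ∀ᵐ t ∂(volume.restrict (Icc (0 : ℝ) T)),
      ‖sint p n t ψ - ((∫ x, U (x, 0) ∂νp) - ∫ x, U (x, 0) ∂νn)‖ₑ
        ≤ ENNReal.ofReal (ε t) * (p t + n t) univ
          + ∫⁻ s in Icc (0 : ℝ) T, ∫⁻ x, G x ∂(p s + n s) := by
  have hcs : ∀ f : EuclideanSpace ℝ (Fin d) → ℝ, (∀ x, R < ‖x‖ → f x = 0) →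
      HasCompactSupport f := fun f hf =>
    HasCompactSupport.intro (isCompact_closedBall (0 : EuclideanSpace ℝ (Fin d)) R) fun x hx =>
      hf x (by simpa using hx)
  filter_upwards [hsol.2 (fun x t => U (x, t)) hU ⟨R, hR, hUR⟩, ae_restrict_mem measurableSet_Icc]
    with t ht htT
  have := isFiniteMeasure_iff _ |>.2 (hbdd t htT).1
  have := isFiniteMeasure_iff _ |>.2 (hbdd t htT).2
  have hUc : Continuous fun x => U (x, t) := hU.continuous.comp (by fun_prop)
  have hUs := hcs (fun x => U (x, t)) (fun x => hUR x t)
  have hψs := hcs ψ hψR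
  have hsub := sint_sub (p := p) (n := n) (t := t)
    (hUc.integrable_of_hasCompactSupport hUs) (hUc.integrable_of_hasCompactSupport hUs)
    (hψ.integrable_of_hasCompactSupport hψs) (hψ.integrable_of_hasCompactSupport hψs)
  have hint : sint p n t ψ - ((∫ x, U (x, 0) ∂νp) - ∫ x, U (x, 0) ∂νn)
      = -sint p n t (fun x => U (x, t) - ψ x)
        + ∫ s in Icc (0 : ℝ) t, sint p n s (fun x => fderiv ℝ U (x, s) (b x s, 1)) := by
    simp only [fderiv_apply_prod_one_eq_deriv_add_inner (hU.differentiable one_ne_zero)] at ht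
    rw [hsub]
    linarith
  rw [hint]
  refine (enorm_add_le _ _).trans (add_le_add ?_ (enorm_setIntegral_sint_le htT.2 hG))
  rw [enorm_neg, ← lintegral_const]
  refine (enorm_sint_le _ _ _ _).trans (lintegral_mono fun x => ?_)
  rw [Real.enorm_eq_ofReal_abs]
  exact ENNReal.ofReal_le_ofReal (hε x t htT)

/-- Two bounded solutions of the continuity equation with the same initial data agree on Lipschitz
test functions if the drift is approximated, on the scale of its direction, by bounded Lipschitz
fields off a negligible set. -/
theorem IsSolution.ae_sint_eq {d : ℕ} {T : ℝ} (hT : 0 ≤ T)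
    {b : EuclideanSpace ℝ (Fin d) → ℝ → EuclideanSpace ℝ (Fin d)}
    {v : ℕ → EuclideanSpace ℝ (Fin d) → EuclideanSpace ℝ (Fin d)}
    {θ : ℕ → EuclideanSpace ℝ (Fin d) → ℝ} {K : ℕ → NNReal} {B : NNReal}
    (hv : ∀ k, LipschitzWith (K k) (v k)) (hB : ∀ k x, ‖v k x‖ ≤ B)
    (hθ : ∀ k, Measurable (θ k)) (hθ0 : ∀ k x, 0 ≤ θ k x) (hθ1 : ∀ k x, θ k x ≤ 1)
    (hb : ∀ k x t, b x t = θ k x • v k x)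
    {A : Set (EuclideanSpace ℝ (Fin d))}
    (hlim : ∀ x, x ∉ A → Tendsto (fun k => θ k x) atTop (𝓝 1))
    {νp νn : Measure (EuclideanSpace ℝ (Fin d))}
    {p₁ n₁ p₂ n₂ : ℝ → Measure (EuclideanSpace ℝ (Fin d))}
    (hfam₁ : IsLocFamily T p₁ n₁) (hfam₂ : IsLocFamily T p₂ n₂)
    (hbdd₁ : ∀ t ∈ Icc (0 : ℝ) T, p₁ t univ < ⊤ ∧ n₁ t univ < ⊤)
    (hbdd₂ : ∀ t ∈ Icc (0 : ℝ) T, p₂ t univ < ⊤ ∧ n₂ t univ < ⊤)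
    (hsol₁ : IsSolution T b νp νn p₁ n₁) (hsol₂ : IsSolution T b νp νn p₂ n₂)
    (hA₁ : ∀ᵐ t ∂(volume.restrict (Icc (0 : ℝ) T)), (p₁ t + n₁ t) A = 0)
    (hA₂ : ∀ᵐ t ∂(volume.restrict (Icc (0 : ℝ) T)), (p₂ t + n₂ t) A = 0)
    {ψ : EuclideanSpace ℝ (Fin d) → ℝ} {L : NNReal} (hψ : LipschitzWith L ψ) {R : ℝ}
    (hR : ∀ x, R < ‖x‖ → ψ x = 0) :
    ∀ᵐ t ∂(volume.restrict (Icc (0 : ℝ) T)), sint p₁ n₁ t ψ = sint p₂ n₂ t ψ := by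
  set R' : ℝ := max (R + B * (T + 1) + 1) 1 with hR'
  have hR'R : R ≤ R' := le_max_of_le_left (by nlinarith [B.coe_nonneg])
  set δ : ℕ → ℝ := fun k => 1 / ((k : ℝ) + 1) with hδdef
  have hδ : ∀ k, 0 < δ k := fun k => Nat.one_div_pos_of_nat
  have hδ1 : ∀ k, δ k ≤ 1 := fun k => by
    rw [hδdef]
    exact div_le_one_of_le₀ (by simp) (by positivity)
  have hδlim : Tendsto δ atTop (𝓝 0) := tendsto_one_div_add_atTop_nhds_zero_nat
  choose U hUC hUR hUψ hUt hUv using fun (q : ℚ) (k : ℕ) =>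
    exists_transport_test_function (hv k) (hB k) hψ hR (projIcc 0 T hT q).2 (hδ k)
  set G : ℕ → EuclideanSpace ℝ (Fin d) → ℝ≥0∞ := fun k =>
    (closedBall 0 R').indicator fun x => ENNReal.ofReal (L * B * (1 - θ k x) + δ k) with hGdef
  have hGm : ∀ k, Measurable (G k) := fun k =>
    (((measurable_const.sub (hθ k)).const_mul _).add_const _).ennreal_ofReal.indicator
      measurableSet_closedBall
  have hGc : ∀ k x, G k x ≤ (closedBall 0 R').indicator (fun _ => ENNReal.ofReal (L * B + 1)) x :=
    fun k x => indicator_le_indicator (ENNReal.ofReal_le_ofReal (by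
      have : (0 : ℝ) ≤ L * B := by positivity
      nlinarith [hθ0 k x, hδ1 k]))
  have hGlim : ∀ x, x ∉ A → Tendsto (fun k => G k x) atTop (𝓝 0) := fun x hx => by
    by_cases hxR : x ∈ closedBall 0 R'
    · simp only [hGdef, indicator_of_mem hxR]
      have := ENNReal.tendsto_ofReal
        ((((hlim x hx).const_sub 1).const_mul ((L : ℝ) * B)).add hδlim)
      simpa using this
    · simp [hGdef, indicator_of_notMem hxR]
  have hE₁ := hfam₁.tendsto_lintegral_lintegral hA₁ hGm ENNReal.ofReal_ne_top hGc hGlim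
  have hE₂ := hfam₂.tendsto_lintegral_lintegral hA₂ hGm ENNReal.ofReal_ne_top hGc hGlim
  have hG : ∀ q k, ∀ s ∈ Icc (0 : ℝ) T, ∀ x, ‖fderiv ℝ (U q k) (x, s) (b x s, 1)‖ₑ ≤ G k x := by
    intro q k s hs x
    by_cases hxR : x ∈ closedBall 0 R'
    · rw [hGdef]
      simp only [indicator_of_mem hxR]
      rw [Real.enorm_eq_ofReal_abs]
      refine ENNReal.ofReal_le_ofReal ?_
      have hsplit : ((b x s, 1) : EuclideanSpace ℝ (Fin d) × ℝ)
          = (1 - θ k x) • (0, 1) + θ k x • (v k x, 1) := by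
        rw [hb k x s]
        ext <;> simp
      rw [hsplit, map_add, map_smul, map_smul, smul_eq_mul, smul_eq_mul]
      refine (abs_add_le _ _).trans ?_
      rw [abs_mul, abs_mul, abs_of_nonneg (hθ0 k x), abs_of_nonneg (sub_nonneg.2 (hθ1 k x)),
        mul_comm ((L : ℝ) * B)]
      exact add_le_add (mul_le_mul_of_nonneg_left (hUt q k x s hs) (sub_nonneg.2 (hθ1 k x)))
        ((mul_le_of_le_one_left (abs_nonneg _) (hθ1 k x)).trans (hUv q k x s hs))
    · have hnorm : R' < ‖x‖ := by simpa using hxR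
      have hev : U q k =ᶠ[𝓝 (x, s)] fun _ => 0 := by
        have : ∀ᶠ y : EuclideanSpace ℝ (Fin d) × ℝ in 𝓝 (x, s), R' < ‖y.1‖ :=
          (continuous_fst.norm.continuousAt (x := (x, s))).eventually (lt_mem_nhds hnorm)
        filter_upwards [this] with y hy
          using hUR q k y.1 y.2 ((le_max_left _ _).trans_lt hy)
      rw [hev.fderiv_eq]
      simp
  have hest₁ := fun q k => hsol₁.ae_enorm_sint_sub_le hbdd₁ (hUC q k) (R := R') (by positivity)
    (fun x t h => hUR q k x t ((le_max_left _ _).trans_lt h)) hψ.continuous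
    (fun x h => hR x (hR'R.trans_lt h)) (hUψ q k) (hG q k)
  have hest₂ := fun q k => hsol₂.ae_enorm_sint_sub_le hbdd₂ (hUC q k) (R := R') (by positivity)
    (fun x t h => hUR q k x t ((le_max_left _ _).trans_lt h)) hψ.continuous
    (fun x h => hR x (hR'R.trans_lt h)) (hUψ q k) (hG q k)
  filter_upwards [ae_all_iff.2 fun q => ae_all_iff.2 (hest₁ q),
    ae_all_iff.2 fun q => ae_all_iff.2 (hest₂ q), ae_restrict_mem measurableSet_Icc]
    with t ht₁ ht₂ htT
  set M := (p₁ t + n₁ t) univ + (p₂ t + n₂ t) univ with hMdef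
  have hM : M ≠ ⊤ := by
    simp [hMdef, (hbdd₁ t htT).1.ne, (hbdd₁ t htT).2.ne, (hbdd₂ t htT).1.ne, (hbdd₂ t htT).2.ne]
  have hq : ∀ q : ℚ, ‖sint p₁ n₁ t ψ - sint p₂ n₂ t ψ‖ₑ
      ≤ ENNReal.ofReal (L * B * |(projIcc 0 T hT q : ℝ) - t|) * M := by
    intro q
    have hlimq : Tendsto (fun k => ENNReal.ofReal (L * B * |(projIcc 0 T hT q : ℝ) - t| + δ k) * M
        + ((∫⁻ s in Icc (0 : ℝ) T, ∫⁻ x, G k x ∂(p₁ s + n₁ s))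
          + ∫⁻ s in Icc (0 : ℝ) T, ∫⁻ x, G k x ∂(p₂ s + n₂ s))) atTop
        (𝓝 (ENNReal.ofReal (L * B * |(projIcc 0 T hT q : ℝ) - t| + 0) * M + (0 + 0))) :=
      (ENNReal.Tendsto.mul_const (ENNReal.tendsto_ofReal (hδlim.const_add _)) (Or.inr hM)).add
        (hE₁.add hE₂)
    simp only [add_zero] at hlimq
    refine ge_of_tendsto' hlimq fun k => ?_
    rw [← sub_sub_sub_cancel_right _ _
      ((∫ x, U q k (x, 0) ∂νp) - ∫ x, U q k (x, 0) ∂νn)]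
    refine enorm_sub_le.trans ((add_le_add (ht₁ q k) (ht₂ q k)).trans (le_of_eq ?_))
    rw [hMdef]
    ring
  have hr : ∀ r : ℝ, ‖sint p₁ n₁ t ψ - sint p₂ n₂ t ψ‖ₑ
      ≤ ENNReal.ofReal (L * B * |(projIcc 0 T hT r : ℝ) - t|) * M := by
    intro r
    refine Rat.denseRange_cast.induction_on (p := fun r : ℝ => ‖sint p₁ n₁ t ψ - sint p₂ n₂ t ψ‖ₑ
      ≤ ENNReal.ofReal (L * B * |(projIcc 0 T hT r : ℝ) - t|) * M) r ?_ hq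
    refine isClosed_le continuous_const ?_
    refine (ENNReal.continuous_mul_const hM).comp (ENNReal.continuous_ofReal.comp ?_)
    have : Continuous fun r : ℝ => (projIcc 0 T hT r : ℝ) :=
      continuous_subtype_val.comp continuous_projIcc
    fun_prop
  have := hr t
  rw [projIcc_of_mem hT htT] at this
  simpa [sub_eq_zero] using this

/-- The Borel sets of a second countable proper metric space are generated by a countable π-system
of compact sets. -/
theorem exists_countable_isPiSystem_isCompact (X : Type*) [PseudoMetricSpace X] [ProperSpace X]
    [SecondCountableTopology X] [Nonempty X] [MeasurableSpace X] [BorelSpace X] :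
    ∃ C : Set (Set X), C.Countable ∧ IsPiSystem C ∧ (∀ s ∈ C, IsCompact s) ∧
      (∀ s ∈ C, IsClosed s) ∧ ‹MeasurableSpace X› = MeasurableSpace.generateFrom C ∧
      ∃ B : ℕ → Set X, ⋃ i, B i = univ ∧ ∀ i, B i ∈ C := by
  classical
  obtain ⟨x₀⟩ := ‹Nonempty X›
  let b := TopologicalSpace.countableBasis X
  have : Countable b := TopologicalSpace.countable_countableBasis X
  let S : ℕ × Finset b → Set X := fun i => closedBall x₀ i.1 ∩ ⋂ V ∈ i.2, (V : Set X)ᶜ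
  have hclosed : ∀ i, IsClosed (S i) := fun i =>
    isClosed_closedBall.inter (isClosed_biInter fun V _ =>
      (TopologicalSpace.isOpen_of_mem_countableBasis V.2).isClosed_compl)
  refine ⟨range S, countable_range S, ?_, ?_, ?_, ?_, fun n => S (n, ∅), ?_, fun n => ⟨_, rfl⟩⟩
  · rintro _ ⟨⟨m, F⟩, rfl⟩ _ ⟨⟨n, F'⟩, rfl⟩ -
    refine ⟨(min m n, F ∪ F'), ?_⟩
    ext x
    simp only [S, mem_inter_iff, mem_closedBall, mem_iInter, Finset.mem_union, Nat.cast_min,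
      le_min_iff]
    grind
  · rintro _ ⟨i, rfl⟩
    exact (isCompact_closedBall x₀ _).of_isClosed_subset (hclosed i) inter_subset_left
  · rintro _ ⟨i, rfl⟩
    exact hclosed i
  · refine le_antisymm ?_ (MeasurableSpace.generateFrom_le ?_)
    · rw [BorelSpace.measurable_eq (α := X),
        (TopologicalSpace.isBasis_countableBasis X).borel_eq_generateFrom]
      refine MeasurableSpace.generateFrom_le fun V hV => ?_
      have hVc : Vᶜ = ⋃ n : ℕ, S (n, {⟨V, hV⟩}) := by
        simp only [S, Finset.set_biInter_singleton, ← iUnion_inter, iUnion_closedBall_nat, univ_inter]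
      rw [← compl_compl V, hVc]
      exact (MeasurableSet.iUnion fun n =>
        MeasurableSpace.measurableSet_generateFrom (mem_range_self (f := S) _)).compl
    · rintro _ ⟨i, rfl⟩
      exact (hclosed i).measurableSet
  · simp [S, iUnion_closedBall_nat]

/-- Families of finite signed measures are determined almost everywhere by countably many compactly
supported Lipschitz test functions. -/
theorem ae_add_eq_of_forall_lipschitz_sint_eq {d : ℕ} {m : Measure ℝ}
    {p₁ n₁ p₂ n₂ : ℝ → Measure (EuclideanSpace ℝ (Fin d))}
    (hbdd₁ : ∀ᵐ t ∂m, p₁ t univ < ⊤ ∧ n₁ t univ < ⊤)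
    (hbdd₂ : ∀ᵐ t ∂m, p₂ t univ < ⊤ ∧ n₂ t univ < ⊤)
    (h : ∀ (ψ : EuclideanSpace ℝ (Fin d) → ℝ) (L : NNReal) (R : ℝ), LipschitzWith L ψ →
      (∀ x, R < ‖x‖ → ψ x = 0) → ∀ᵐ t ∂m, sint p₁ n₁ t ψ = sint p₂ n₂ t ψ) :
    ∀ᵐ t ∂m, p₁ t + n₂ t = p₂ t + n₁ t := by
  obtain ⟨C, hCc, hCpi, hCK, hCcl, hCgen, S, hSU, hSC⟩ :=
    exists_countable_isPiSystem_isCompact (EuclideanSpace ℝ (Fin d))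
  have hδ : ∀ k : ℕ, 0 < 1 / ((k : ℝ) + 1) := fun k => Nat.one_div_pos_of_nat
  have hae : ∀ᵐ t ∂m, ∀ s ∈ C, ∀ k : ℕ,
      sint p₁ n₁ t (fun x => (thickenedIndicator (hδ k) s x : ℝ))
        = sint p₂ n₂ t (fun x => (thickenedIndicator (hδ k) s x : ℝ)) := by
    refine (ae_ball_iff hCc).2 fun s hs => ae_all_iff.2 fun k => ?_
    obtain ⟨R, hR⟩ := ((hCK s hs).isBounded.thickening
      (δ := 1 / ((k : ℝ) + 1))).subset_closedBall (0 : EuclideanSpace ℝ (Fin d))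
    refine h _ _ R ((LipschitzWith.subtype_val _).comp (lipschitzWith_thickenedIndicator (hδ k) s))
      fun x hx => ?_
    have : x ∉ thickening (1 / ((k : ℝ) + 1)) s := fun hxs => by
      have := hR hxs
      rw [mem_closedBall_zero_iff] at this
      linarith
    exact NNReal.coe_eq_zero.2 (thickenedIndicator_zero (hδ k) s this)
  filter_upwards [hbdd₁, hbdd₂, hae] with t h₁ h₂ ht
  have := isFiniteMeasure_iff _ |>.2 h₁.1
  have := isFiniteMeasure_iff _ |>.2 h₁.2
  have := isFiniteMeasure_iff _ |>.2 h₂.1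
  have := isFiniteMeasure_iff _ |>.2 h₂.2
  refine Measure.ext_of_generateFrom_of_iUnion C S hCgen hCpi hSU hSC
    (fun i => measure_ne_top _ _) fun s hs => ?_
  have hlim := fun μ : Measure (EuclideanSpace ℝ (Fin d)) => fun _ : IsFiniteMeasure μ =>
    tendsto_lintegral_thickenedIndicator_of_isClosed μ (hCcl s hs) hδ
      tendsto_one_div_add_atTop_nhds_zero_nat
  refine tendsto_nhds_unique (hlim _ inferInstance) ((hlim _ inferInstance).congr fun k => ?_)
  have hi := fun μ : Measure (EuclideanSpace ℝ (Fin d)) => fun _ : IsFiniteMeasure μ =>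
    integrable_thickenedIndicator (μ := μ) s (hδ k)
  rw [lintegral_coe_eq_integral _ (hi _ inferInstance),
    lintegral_coe_eq_integral _ (hi _ inferInstance),
    integral_add_measure (hi _ inferInstance) (hi _ inferInstance),
    integral_add_measure (hi _ inferInstance) (hi _ inferInstance)]
  have := ht s hs k
  simp only [sint] at this
  congr 1
  linarith

theorem LipschitzWith.smul_of_bounded {X F : Type*} [PseudoMetricSpace X]
    [NormedAddCommGroup F] [NormedSpace ℝ F] {f : X → ℝ} {g : X → F} {Kf Kg Mf Mg : NNReal}
    (hf : LipschitzWith Kf f) (hg : LipschitzWith Kg g) (hMf : ∀ x, ‖f x‖ ≤ Mf)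
    (hMg : ∀ x, ‖g x‖ ≤ Mg) :
    LipschitzWith (Mf * Kg + Kf * Mg) fun x => f x • g x := by
  refine LipschitzWith.of_dist_le_mul fun x y => ?_
  have h : f x • g x - f y • g y = f x • (g x - g y) + (f x - f y) • g y := by
    rw [smul_sub, sub_smul]
    abel
  rw [dist_eq_norm, h]
  refine (norm_add_le _ _).trans ?_
  rw [norm_smul, norm_smul, ← dist_eq_norm, ← dist_eq_norm]
  calc ‖f x‖ * dist (g x) (g y) + dist (f x) (f y) * ‖g y‖
      ≤ Mf * (Kg * dist x y) + Kf * dist x y * Mg := by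
        gcongr
        · exact hMf x
        · exact hg.dist_le_mul x y
        · exact hf.dist_le_mul x y
        · exact hMg y
    _ = (Mf * Kg + Kf * Mg : NNReal) * dist x y := by
        push_cast
        ring

theorem norm_gradient {F : Type*} [NormedAddCommGroup F] [InnerProductSpace ℝ F] [CompleteSpace F]
    (f : F → ℝ) (x : F) : ‖gradient f x‖ = ‖fderiv ℝ f x‖ :=
  LinearIsometryEquiv.norm_map _ _

/-- A bound on the second derivative makes the gradient Lipschitz. -/
theorem lipschitzWith_gradient {F : Type*} [NormedAddCommGroup F] [InnerProductSpace ℝ F]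
    [CompleteSpace F] {f : F → ℝ} (hf : ContDiff ℝ 2 f) {M : NNReal}
    (hM : ∀ x, ‖iteratedFDeriv ℝ 2 f x‖ ≤ M) : LipschitzWith M (gradient f) := by
  have h : LipschitzWith M (fderiv ℝ f) := by
    refine lipschitzWith_of_nnnorm_fderiv_le
      ((hf.fderiv_right (m := 1) (by norm_num)).differentiable one_ne_zero) fun x => ?_
    rw [← NNReal.coe_le_coe, coe_nnnorm, ← norm_iteratedFDeriv_one, norm_iteratedFDeriv_fderiv]
    exact hM x
  have := (InnerProductSpace.toDual ℝ F).symm.lipschitz.comp h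
  rwa [one_mul] at this

/-- Along a gradient direction the drift vanishes near any point outside the frontier of its zero
set at which it vanishes, because `W` is open there. -/
theorem eventually_comp_eq_zero_of_notMem_frontier {F : Type*} [NormedAddCommGroup F]
    [InnerProductSpace ℝ F] [CompleteSpace F] {W : F → ℝ} (hW : ContDiff ℝ 1 W) {β : ℝ → ℝ} {x : F}
    (hx : x ∉ frontier {y | β (W y) = 0}) (hβ : β (W x) = 0) (hgrad : gradient W x ≠ 0) :
    ∀ᶠ r in 𝓝 (W x), β r = 0 := by
  have hint : x ∈ interior {y | β (W y) = 0} := by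
    by_contra hxi
    exact hx ⟨subset_closure hβ, hxi⟩
  have hne : fderiv ℝ W x ≠ 0 := fun h0 => hgrad (by simp [gradient, h0])
  have hstrict : HasStrictFDerivAt W (fderiv ℝ W x) x :=
    hW.contDiffAt.hasStrictFDerivAt one_ne_zero
  have hsurj : (fderiv ℝ W x).range = ⊤ := by
    refine LinearMap.range_eq_top.2 fun c => ?_
    obtain ⟨w, hw⟩ : ∃ w, fderiv ℝ W x w ≠ 0 := by
      by_contra! hall
      exact hne (ContinuousLinearMap.ext hall)
    exact ⟨(c / fderiv ℝ W x w) • w, by simp [hw]⟩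
  rw [← hstrict.map_nhds_eq_of_surj hsurj]
  exact mem_interior_iff_mem_nhds.1 hint


/-- **Example (gradient-type drift).** Let `b(x) = -β(W(x)) ∇W(x)` where `W` is
a smooth bounded function on `ℝ^d` with bounded derivatives and `β ≥ 0` is
continuous with `s ↦ β(s) - Λ s` decreasing for some `Λ > 0`.  Then the Cauchy
problem `∂_t μ + div(b μ) = 0`, `μ|_{t=0} = ν` has at most one solution in the
class of all bounded measures given by families of bounded measures `(μ_t)` with
`|μ_t|(∂Z ∖ 𝒲) = 0` for a.e. `t`, where `Z = {x : β(W(x)) = 0}` and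
`𝒲 = {x : ∇W(x) = 0}`. -/
theorem uniqueness_gradient_drift
    {d : ℕ} (T : ℝ) (hT : 0 < T)
    (W : EuclideanSpace ℝ (Fin d) → ℝ)
    (hWsm : ContDiff ℝ (⊤ : ℕ∞) W)
    (hWbdd : ∃ M : ℝ, ∀ x, |W x| ≤ M)
    (hWder : ∀ i : ℕ, 0 < i → ∃ M : ℝ, ∀ x, ‖iteratedFDeriv ℝ i W x‖ ≤ M)
    (β : ℝ → ℝ) (hβcont : Continuous β) (hβ0 : ∀ s, 0 ≤ β s)
    (hβdec : ∃ Λ : ℝ, 0 < Λ ∧ Antitone (fun s => β s - Λ * s))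
    (b : EuclideanSpace ℝ (Fin d) → ℝ → EuclideanSpace ℝ (Fin d))
    (hbdef : ∀ x t, b x t = -(β (W x)) • gradient W x)
    (νp νn : Measure (EuclideanSpace ℝ (Fin d)))
    (hνfin : νp univ < ⊤ ∧ νn univ < ⊤)
    (p₁ n₁ p₂ n₂ : ℝ → Measure (EuclideanSpace ℝ (Fin d)))
    (hfam₁ : IsLocFamily T p₁ n₁) (hfam₂ : IsLocFamily T p₂ n₂)
    (hbdd₁ : ∀ t ∈ Icc (0:ℝ) T, p₁ t univ < ⊤ ∧ n₁ t univ < ⊤)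
    (hbdd₂ : ∀ t ∈ Icc (0:ℝ) T, p₂ t univ < ⊤ ∧ n₂ t univ < ⊤)
    (hsol₁ : IsSolution T b νp νn p₁ n₁) (hsol₂ : IsSolution T b νp νn p₂ n₂)
    (hZ₁ : ∀ᵐ t ∂(volume.restrict (Icc (0:ℝ) T)),
      (p₁ t + n₁ t)
        (frontier {x : EuclideanSpace ℝ (Fin d) | β (W x) = 0}
          \ {x : EuclideanSpace ℝ (Fin d) | gradient W x = 0}) = 0)
    (hZ₂ : ∀ᵐ t ∂(volume.restrict (Icc (0:ℝ) T)),
      (p₂ t + n₂ t)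
        (frontier {x : EuclideanSpace ℝ (Fin d) | β (W x) = 0}
          \ {x : EuclideanSpace ℝ (Fin d) | gradient W x = 0}) = 0) :
    ∀ᵐ t ∂(volume.restrict (Icc (0:ℝ) T)), p₁ t + n₂ t = p₂ t + n₁ t := by
  obtain ⟨M, hM⟩ := hWbdd
  obtain ⟨M₁, hM₁⟩ := hWder 1 one_pos
  obtain ⟨M₂, hM₂⟩ := hWder 2 two_pos
  have hgrad : ∀ x, ‖gradient W x‖ ≤ M₁.toNNReal := fun x => by
    rw [norm_gradient, ← norm_iteratedFDeriv_one]
    exact (hM₁ x).trans (Real.le_coe_toNNReal _)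
  have hgradLip : LipschitzWith M₂.toNNReal (gradient W) :=
    lipschitzWith_gradient (contDiff_infty.1 hWsm 2) fun x =>
      (hM₂ x).trans (Real.le_coe_toNNReal _)
  have hW1 : ContDiff ℝ 1 W := contDiff_infty.1 hWsm 1
  have hWLip : LipschitzWith M₁.toNNReal W :=
    lipschitzWith_of_nnnorm_fderiv_le (hW1.differentiable one_ne_zero) fun x => by
      rw [← NNReal.coe_le_coe, coe_nnnorm, ← norm_gradient]
      exact hgrad x
  obtain ⟨N, hN⟩ := (isCompact_Icc (a := -M) (b := M)).exists_bound_of_continuousOn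
    hβcont.continuousOn
  have hM0 : -M ≤ M := by linarith [abs_nonneg (W 0), hM 0]
  set γ : ℝ → ℝ := fun s => β (projIcc (-M) M hM0 s) with hγ
  have hγW : ∀ x, γ (W x) = β (W x) := fun x => by
    rw [hγ]
    simp only
    rw [projIcc_of_mem hM0 (abs_le.1 (hM x))]
  have hγN : ∀ s, γ s ≤ N := fun s => (le_abs_self _).trans (hN _ (projIcc (-M) M hM0 s).2)
  obtain ⟨f, hfLip, hγf, hfN, hflim, hfzero⟩ := exists_lipschitz_approx_above (β := γ)
    (hβcont.comp (continuous_subtype_val.comp continuous_projIcc)) (fun s => hβ0 _) hγN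
  have hf0 : ∀ k s, 0 ≤ f k s := fun k s => (hβ0 _).trans (hγf k s)
  have hfb : ∀ k x, ‖-f k (W x)‖ ≤ N.toNNReal := fun k x => by
    rw [norm_neg, Real.norm_of_nonneg (hf0 _ _)]
    exact (hfN k _).trans (Real.le_coe_toNNReal _)
  have hmeas : Measurable fun x => β (W x) := (hβcont.comp hWsm.continuous).measurable
  have hfmeas : ∀ k, Measurable fun x => f k (W x) := fun k =>
    ((hfLip k).continuous.comp hWsm.continuous).measurable
  classical
  refine ae_add_eq_of_forall_lipschitz_sint_eq
    ((ae_restrict_mem measurableSet_Icc).mono hbdd₁)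
    ((ae_restrict_mem measurableSet_Icc).mono hbdd₂) fun ψ L R hψ hR => ?_
  refine IsSolution.ae_sint_eq hT.le (v := fun k x => -f k (W x) • gradient W x)
    (θ := fun k x => if gradient W x = 0 ∨ f k (W x) = 0 then 1 else β (W x) / f k (W x))
    (B := N.toNNReal * M₁.toNNReal)
    (fun k => ((hfLip k).comp hWLip).neg.smul_of_bounded hgradLip (hfb k) hgrad)
    (fun k x => ?_) (fun k => ?_) (fun k x => ?_) (fun k x => ?_) (fun k x t => ?_) (fun x hx => ?_)
    hfam₁ hfam₂ hbdd₁ hbdd₂ hsol₁ hsol₂ hZ₁ hZ₂ hψ hR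
  · rw [norm_smul, NNReal.coe_mul]
    exact mul_le_mul (hfb k x) (hgrad x) (norm_nonneg _) (NNReal.coe_nonneg _)
  · refine Measurable.ite ?_ measurable_const (hmeas.div (hfmeas k))
    exact (isClosed_eq hgradLip.continuous continuous_const).measurableSet.union
      (hfmeas k (measurableSet_singleton 0))
  · split_ifs
    · exact zero_le_one
    · exact div_nonneg (hβ0 _) (hf0 _ _)
  · split_ifs
    · exact le_rfl
    · exact div_le_one_of_le₀ ((hγW x).symm.le.trans (hγf k _)) (hf0 _ _)
  · rw [hbdef]
    split_ifs with h
    · rcases h with h | h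
      · simp [h]
      · have : β (W x) = 0 := le_antisymm (by simpa [h, hγW] using hγf k (W x)) (hβ0 _)
        simp [h, this]
    · rw [not_or] at h
      rw [smul_smul, mul_neg, div_mul_cancel₀ _ h.2]
  · by_cases hg : gradient W x = 0
    · simp [hg]
    by_cases hβx : β (W x) = 0
    · have hev : ∀ᶠ r in 𝓝 (W x), γ r = 0 := by
        refine eventually_comp_eq_zero_of_notMem_frontier hW1 ?_ ((hγW x).trans hβx) hg
        simp only [hγW]
        exact fun hfr => hx ⟨hfr, hg⟩
      refine tendsto_const_nhds.congr' ?_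
      filter_upwards [hfzero _ hev] with k hk
      simp [hk]
    · have hlim : Tendsto (fun k => β (W x) / f k (W x)) atTop (𝓝 1) := by
        have := (tendsto_const_nhds (x := β (W x))).div (hflim (W x)) (by rwa [hγW])
        rwa [hγW, div_self hβx] at this
      refine hlim.congr fun k => ?_
      have : f k (W x) ≠ 0 :=
        ((lt_of_le_of_ne (hβ0 _) (Ne.symm hβx)).trans_le ((hγW x).symm.le.trans (hγf k _))).ne'
      simp [hg, this]
end
end

section
/- Assume that b : ℝ^d × [0,T] → ℝ^d is continuous and there exist a sequence of vector fields b_k ∈ C^∞(ℝ^d × ℝ, ℝ^d) and a sequence of positive functions V_k ∈ C¹(ℝ^d) such that: (i) there exist numbers C₁, C₂, C₃ with V_k ≤ C₁ V_m + C₂ whenever k ≤ m, and ⟨b_k(x,t), ∇V_k(x)⟩ ≤ C₃ V_k(x) for all (x,t) ∈ ℝ^d × [0,T]; (ii) the function (1+|x|)^{−1}|b_k(x,t)| is bounded for every k, and b_k → b uniformly on U × [0,T] for every ball U. Then for every nonnegative finite initial measure ν with sup_k ∫ V_k dν < ∞ there exists a family of nonnegative finite measures (μ_t)_{t∈[0,T]}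 solving the Cauchy problem ∂_t μ + div(b μ) = 0, μ|_{t=0} = ν such that for every ball U one has lim_{k→∞} ∫₀ᵀ ∫_U |b − b_k| √(V_k) dμ_t dt = 0. -/
open MeasureTheory Metric Set Filter
open scoped Topology ENNReal RealInnerProductSpace

noncomputable section

/-- The family `(μ_t)_{t∈[0,T]}` of nonnegative Borel measures on `ℝ^d` is a
solution of the Cauchy problem `∂_t μ + div (b μ) = 0`, `μ|_{t=0} = ν` on `[0,T]`:
`t ↦ μ_t(B)` is measurable, `t ↦ μ_t(K)` is in `L¹[0,T]` for compact `K`,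
`b` is `μ_t dt`-integrable on `U × [0,T]` for every ball `U` and the weak identity
`∫ u(x,t) μ_t(dx) = ∫ u(x,0) ν(dx) + ∫₀ᵗ ∫ [∂_t u + ⟨b,∇u⟩] μ_s(dx) ds`
holds for a.e. `t ∈ [0,T]`, for every `C¹` test function `u` vanishing for
`|x| > R` for some `R`. -/
def IsNonnegSolution {d : ℕ} (T : ℝ)
    (b : EuclideanSpace ℝ (Fin d) → ℝ → EuclideanSpace ℝ (Fin d))
    (ν : Measure (EuclideanSpace ℝ (Fin d)))
    (μ : ℝ → Measure (EuclideanSpace ℝ (Fin d))) : Prop :=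
  (∀ B : Set (EuclideanSpace ℝ (Fin d)), MeasurableSet B → Bornology.IsBounded B →
      Measurable (fun t => μ t B)) ∧
  (∀ t ∈ Icc (0:ℝ) T, ∀ K : Set (EuclideanSpace ℝ (Fin d)), IsCompact K → μ t K < ⊤) ∧
  (∀ K : Set (EuclideanSpace ℝ (Fin d)), IsCompact K →
      IntegrableOn (fun t => (μ t K).toReal) (Icc (0:ℝ) T)) ∧
  (∀ (x₀ : EuclideanSpace ℝ (Fin d)) (R : ℝ), 0 < R →
      (∫⁻ t in Icc (0:ℝ) T, ∫⁻ x in ball x₀ R, ENNReal.ofReal ‖b x t‖ ∂(μ t)) < ⊤) ∧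
  ∀ u : EuclideanSpace ℝ (Fin d) → ℝ → ℝ,
    ContDiff ℝ 1 (fun q : EuclideanSpace ℝ (Fin d) × ℝ => u q.1 q.2) →
    (∃ R > 0, ∀ x t, R < ‖x‖ → u x t = 0) →
    ∀ᵐ t ∂(volume.restrict (Icc (0:ℝ) T)),
      (∫ x, u x t ∂(μ t))
        = (∫ x, u x 0 ∂ν)
          + ∫ s in Icc (0:ℝ) t,
              ∫ x, (deriv (u x) s + ⟪b x s, gradient (fun y => u y s) x⟫) ∂(μ s)

section ContinuityEquation

variable {E : Type*} [NormedAddCommGroup E] [InnerProductSpace ℝ E] [FiniteDimensional ℝ E]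

/-- A bounded `C¹` time-dependent vector field has a flow on `[0,T]` starting from a ball, which
can be chosen continuous on the whole space-time. -/
lemma exists_continuous_flow {T r : ℝ} (hT : 0 ≤ T) (hr : 0 < r) (c : E → ℝ → E)
    (hc : ContDiff ℝ 1 (fun p : E × ℝ => c p.1 p.2))
    (hL : ∃ L : ℝ, ∀ x, ∀ t ∈ Icc (0 : ℝ) T, ‖c x t‖ ≤ L) :
    ∃ X : E → ℝ → E, Continuous (fun p : E × ℝ => X p.1 p.2) ∧
      ∀ x ∈ closedBall (0 : E) r, X x 0 = x ∧
        ∀ t ∈ Icc (0 : ℝ) T, HasDerivWithinAt (X x) (c (X x t) t) (Icc 0 T) t := by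
  obtain ⟨L, hL⟩ := hL
  have hL0 : 0 ≤ L := (norm_nonneg _).trans (hL 0 0 ⟨le_rfl, hT⟩)
  set a : ℝ := r + L * T with ha
  have ha0 : 0 ≤ a := by positivity
  have hdiff : ∀ t x, HasFDerivAt (fun y => c y t)
      ((fderiv ℝ (fun p : E × ℝ => c p.1 p.2) (x, t)).comp (ContinuousLinearMap.inl ℝ E ℝ)) x := by
    intro t x
    have h1 := (hc.differentiable one_ne_zero (x, t)).hasFDerivAt
    exact HasFDerivAt.comp (f := fun y : E => (y, t)) x h1 (hasFDerivAt_prodMk_left x t)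
  have hcont : Continuous (fun p : E × ℝ =>
      (fderiv ℝ (fun p : E × ℝ => c p.1 p.2) p).comp (ContinuousLinearMap.inl ℝ E ℝ)) :=
    (hc.continuous_fderiv one_ne_zero).clm_comp continuous_const
  obtain ⟨K, hK⟩ := ((isCompact_closedBall (0 : E) a).prod
    (isCompact_Icc (a := (0 : ℝ)) (b := T))).exists_bound_of_continuousOn hcont.continuousOn
  have hPL : IsPicardLindelof (fun t x => c x t) (⟨0, le_rfl, hT⟩ : Icc (0 : ℝ) T) (0 : E)
      ⟨a, ha0⟩ ⟨r, hr.le⟩ ⟨L, hL0⟩ K.toNNReal := by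
    refine ⟨fun t ht => ?_, fun x hx => ?_, fun t ht x hx => hL x t ht, ?_⟩
    · refine (convex_closedBall (0 : E) a).lipschitzOnWith_of_nnnorm_hasFDerivWithin_le
        (fun x hx => (hdiff t x).hasFDerivWithinAt) (fun x hx => ?_)
      rw [← NNReal.coe_le_coe]
      exact (hK (x, t) ⟨hx, ht⟩).trans (Real.le_coe_toNNReal K)
    · exact (hc.continuous.comp (by fun_prop : Continuous fun t : ℝ => (x, t))).continuousOn
    · have : L * max (T - 0) (0 - 0) ≤ a - r := by simp [ha, hT]
      exact this
  obtain ⟨α, hα, hαc⟩ := hPL.exists_forall_mem_closedBall_eq_hasDerivWithinAt_continuousOn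
  let ρ : E → E := fun x => (r / max r ‖x‖) • x
  let τ : ℝ → ℝ := fun t => max 0 (min T t)
  have hρc : Continuous ρ := by
    refine Continuous.smul (continuous_const.div (by fun_prop) fun x => ?_) continuous_id
    exact (lt_max_of_lt_left hr).ne'
  have hρm : ∀ x, ρ x ∈ closedBall (0 : E) r := by
    intro x
    have h0 : 0 < max r ‖x‖ := lt_max_of_lt_left hr
    rw [mem_closedBall_zero_iff, norm_smul, Real.norm_of_nonneg (by positivity), div_mul_eq_mul_div,
      div_le_iff₀ h0]
    gcongr
    exact le_max_right _ _
  have hρe : ∀ x ∈ closedBall (0 : E) r, ρ x = x := by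
    intro x hx
    rw [mem_closedBall_zero_iff] at hx
    simp [ρ, max_eq_left hx, div_self hr.ne']
  have hτe : ∀ t ∈ Icc (0 : ℝ) T, τ t = t := fun t ht => by simp [τ, ht.1, ht.2]
  have hτm : ∀ t, τ t ∈ Icc (0 : ℝ) T := fun t => by simp [τ, hT]
  refine ⟨fun x t => α (ρ x, τ t), ?_, fun x hx => ⟨?_, fun t ht => ?_⟩⟩
  · have : Continuous fun p : E × ℝ => (ρ p.1, τ p.2) := by fun_prop
    exact hαc.comp_continuous this fun p => ⟨hρm _, hτm _⟩
  · simpa [hρe x hx, hτe 0 ⟨le_rfl, hT⟩] using (hα x hx).1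
  · simp only [hρe x hx, hτe t ht]
    exact ((hα x hx).2 t ht).congr (fun s hs => by simp only [hτe s hs]) (by simp only [hτe t ht])

/-- Uniformly equicontinuous families converging pointwise on a compact set have a continuous
limit and converge uniformly. -/
lemma tendstoUniformlyOn_of_equicontinuous {ι : Type*} {l : Filter ι} [NeBot l] {F : ι → ℝ → ℝ}
    {G : ℝ → ℝ} {K : Set ℝ} (hK : IsCompact K)
    (heq : ∀ ε > 0, ∃ δ > 0, ∀ᶠ i in l, ∀ s ∈ K, ∀ s' ∈ K, |s - s'| < δ → |F i s - F i s'| ≤ ε)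
    (hpt : ∀ s ∈ K, Tendsto (fun i => F i s) l (𝓝 (G s))) :
    ContinuousOn G K ∧ TendstoUniformlyOn F G l K := by
  have hG : ∀ ε > 0, ∃ δ > 0, ∀ s ∈ K, ∀ s' ∈ K, |s - s'| < δ → |G s - G s'| ≤ ε := by
    intro ε hε
    obtain ⟨δ, hδ, h⟩ := heq ε hε
    refine ⟨δ, hδ, fun s hs s' hs' hss => ?_⟩
    refine le_of_tendsto ((hpt s hs).sub (hpt s' hs')).abs ?_
    filter_upwards [h] with i hi using hi s hs s' hs' hss
  constructor
  · rw [Metric.continuousOn_iff]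
    intro s hs ε hε
    obtain ⟨δ, hδ, h⟩ := hG (ε / 2) (by positivity)
    refine ⟨δ, hδ, fun s' hs' hd => ?_⟩
    rw [Real.dist_eq] at hd ⊢
    linarith [h s' hs' s hs hd]
  · rw [Metric.tendstoUniformlyOn_iff]
    intro ε hε
    obtain ⟨δ₁, hδ₁, h₁⟩ := hG (ε / 4) (by positivity)
    obtain ⟨δ₂, hδ₂, h₂⟩ := heq (ε / 4) (by positivity)
    obtain ⟨N, hNK, hNf, hN⟩ := hK.finite_cover_balls (lt_min hδ₁ hδ₂)
    have h₃ : ∀ᶠ i in l, ∀ s ∈ N, dist (F i s) (G s) < ε / 4 :=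
      (hNf.eventually_all).2 fun s hs =>
        Metric.tendsto_nhds.1 (hpt s (hNK hs)) (ε / 4) (by positivity)
    filter_upwards [h₂, h₃] with i hi₂ hi₃ s hs
    obtain ⟨y, hyN, hy⟩ := mem_iUnion₂.1 (hN hs)
    rw [mem_ball, Real.dist_eq, lt_min_iff] at hy
    have e₁ := h₁ s hs y (hNK hyN) hy.1
    have e₂ := hi₂ s hs y (hNK hyN) hy.2
    have e₃ := hi₃ y hyN
    rw [Real.dist_eq] at e₃ ⊢
    rw [abs_le] at e₁ e₂
    rw [abs_lt] at e₃ ⊢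
    constructor <;> linarith

/-- `X k` is a flow on `[0,T]` of the continuous vector field `c k`, started from the ball of
radius `k`, and the fields `c k` converge to `b` locally uniformly. -/
structure IsFlowApprox (T : ℝ) (b : E → ℝ → E) (c X : ℕ → E → ℝ → E) : Prop where
  continuous_limit : Continuous (fun p : E × ℝ => b p.1 p.2)
  continuous_field : ∀ k, Continuous (fun p : E × ℝ => c k p.1 p.2)
  continuous_flow : ∀ k, Continuous (fun p : E × ℝ => X k p.1 p.2)
  initial : ∀ k : ℕ, ∀ x ∈ closedBall (0 : E) k, X k x 0 = x
  hasDerivWithinAt : ∀ k : ℕ, ∀ x ∈ closedBall (0 : E) k, ∀ t ∈ Icc (0 : ℝ) T,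
    HasDerivWithinAt (X k x) (c k (X k x t) t) (Icc 0 T) t
  tendstoUniformlyOn : ∀ R : ℝ, TendstoUniformlyOn (fun k (p : E × ℝ) => c k p.1 p.2)
    (fun p => b p.1 p.2) atTop (closedBall 0 R ×ˢ Icc 0 T)

namespace IsFlowApprox

variable {T : ℝ} {b : E → ℝ → E} {c X : ℕ → E → ℝ → E}

/-- Observables that are `C¹` with compact support are uniformly Lipschitz along the flows. -/
lemma exists_lipschitz_comp (h : IsFlowApprox T b c X) {F : Type*} [NormedAddCommGroup F]
    [NormedSpace ℝ F] {ψ : E → F} (hψ : ContDiff ℝ 1 ψ) (hψc : HasCompactSupport ψ) :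
    ∃ L : ℝ, ∀ᶠ k : ℕ in atTop, ∀ x ∈ closedBall (0 : E) k, ∀ s ∈ Icc (0 : ℝ) T,
      ∀ s' ∈ Icc (0 : ℝ) T, ‖ψ (X k x s) - ψ (X k x s')‖ ≤ L * |s - s'| := by
  obtain ⟨R, hR⟩ := (hψc.fderiv (𝕜 := ℝ)).isCompact.isBounded.subset_closedBall (0 : E)
  obtain ⟨M, hM⟩ := ((isCompact_closedBall (0 : E) R).prod
    (isCompact_Icc (a := (0 : ℝ)) (b := T))).exists_bound_of_continuousOn
      h.continuous_limit.continuousOn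
  obtain ⟨D, hD⟩ := (hψ.continuous_fderiv one_ne_zero).bounded_above_of_compact_support
    (hψc.fderiv (𝕜 := ℝ))
  have hD0 : 0 ≤ D := (norm_nonneg _).trans (hD 0)
  refine ⟨D * (|M| + 1), ?_⟩
  filter_upwards [Metric.tendstoUniformlyOn_iff.1 (h.tendstoUniformlyOn R) 1 one_pos]
    with k hk x hx s hs s' hs'
  refine (convex_Icc (0 : ℝ) T).norm_image_sub_le_of_norm_hasDerivWithin_le (C := D * (|M| + 1))
    (f := fun s => ψ (X k x s)) (f' := fun s => fderiv ℝ ψ (X k x s) (c k (X k x s) s))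
    (fun t ht => ?_) (fun t ht => ?_) hs' hs
  · exact ((hψ.differentiable one_ne_zero _).hasFDerivAt).comp_hasDerivWithinAt t
      (h.hasDerivWithinAt k x hx t ht)
  · by_cases hz : fderiv ℝ ψ (X k x t) = 0
    · simp only [hz, zero_apply, norm_zero]; positivity
    · have hmem : X k x t ∈ closedBall (0 : E) R := hR (subset_tsupport _ hz)
      refine (ContinuousLinearMap.le_opNorm _ _).trans ?_
      refine mul_le_mul (hD _) ?_ (norm_nonneg _) hD0
      have h1 := hk (X k x t, t) ⟨hmem, ht⟩
      have h2 := (hM (X k x t, t) ⟨hmem, ht⟩).trans (le_abs_self M)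
      rw [dist_eq_norm, norm_sub_rev] at h1
      have h3 := norm_le_norm_add_norm_sub' (c k (X k x t) t) (b (X k x t) t)
      simp only at h1 h2
      linarith

/-- Continuous observables with compact support in space are uniformly equicontinuous along the
flows. -/
lemma equicontinuous_comp (h : IsFlowApprox T b c X) {g : E → ℝ → ℝ}
    (hg : Continuous (fun p : E × ℝ => g p.1 p.2)) {R : ℝ}
    (hgR : ∀ x t, R < ‖x‖ → g x t = 0) {ε : ℝ} (hε : 0 < ε) :
    ∃ δ > 0, ∀ᶠ k : ℕ in atTop, ∀ x ∈ closedBall (0 : E) k, ∀ s ∈ Icc (0 : ℝ) T,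
      ∀ s' ∈ Icc (0 : ℝ) T, |s - s'| < δ → |g (X k x s) s - g (X k x s') s'| ≤ ε := by
  have hR0 := abs_nonneg R
  let φ₁ : ContDiffBump (0 : E) := ⟨|R| + 1, |R| + 2, by positivity, by linarith⟩
  let φ₂ : ContDiffBump (0 : E) := ⟨|R| + 2, |R| + 3, by positivity, by linarith⟩
  let ψ : E → ℝ × E := fun x => (φ₁ x, φ₂ x • x)
  have hψ : ContDiff ℝ 1 ψ := φ₁.contDiff.prodMk (φ₂.contDiff.smul contDiff_id)
  have hψc : HasCompactSupport ψ := by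
    refine HasCompactSupport.of_support_subset_isCompact (isCompact_closedBall (0 : E) (|R| + 3))
      fun x hx => ?_
    by_contra hx'
    rw [mem_closedBall_zero_iff, not_le] at hx'
    refine hx ?_
    have e₁ : φ₁ x = 0 := φ₁.zero_of_le_dist (by simp only [φ₁, dist_zero_right]; linarith)
    have e₂ : φ₂ x = 0 := φ₂.zero_of_le_dist (by simp only [φ₂, dist_zero_right]; linarith)
    simp [ψ, e₁, e₂]
  let H : (ℝ × E) × ℝ → ℝ := fun q => q.1.1 * g q.1.2 q.2
  have hH : Continuous H := by
    have : Continuous fun q : (ℝ × E) × ℝ => g q.1.2 q.2 :=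
      hg.comp (by fun_prop : Continuous fun q : (ℝ × E) × ℝ => (q.1.2, q.2))
    fun_prop
  have hgH : ∀ x t, g x t = H (ψ x, t) := by
    intro x t
    by_cases hx : ‖x‖ ≤ |R| + 1
    · have e₁ : φ₁ x = 1 := φ₁.one_of_mem_closedBall (by simpa [φ₁] using hx)
      have e₂ : φ₂ x = 1 := φ₂.one_of_mem_closedBall (by simp [φ₂]; linarith)
      simp [H, ψ, e₁, e₂]
    · rw [not_le] at hx
      have h0 : g x t = 0 := hgR x t (by linarith [le_abs_self R])
      by_cases hx' : ‖x‖ ≤ |R| + 2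
      · have e₂ : φ₂ x = 1 := φ₂.one_of_mem_closedBall (by simpa [φ₂] using hx')
        simp [H, ψ, e₂, h0]
      · have e₁ : φ₁ x = 0 :=
          φ₁.zero_of_le_dist (by simp only [φ₁, dist_zero_right]; linarith)
        simp [H, ψ, e₁, h0]
  have hK : IsCompact (range ψ) := hψc.isCompact_range hψ.continuous
  have hu := (hK.prod (isCompact_Icc (a := (0 : ℝ)) (b := T))).uniformContinuousOn_of_continuous
    hH.continuousOn
  rw [Metric.uniformContinuousOn_iff] at hu
  obtain ⟨δ, hδ, hu⟩ := hu ε hε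
  obtain ⟨L, hL⟩ := h.exists_lipschitz_comp hψ hψc
  refine ⟨δ / (|L| + 1), by positivity, ?_⟩
  filter_upwards [hL] with k hk x hx s hs s' hs' hss
  rw [hgH, hgH, ← Real.dist_eq]
  refine (hu _ ⟨mem_range_self _, hs⟩ _ ⟨mem_range_self _, hs'⟩ ?_).le
  rw [lt_div_iff₀ (by positivity)] at hss
  rw [Prod.dist_eq, max_lt_iff, dist_eq_norm, Real.dist_eq]
  have h1 := hk x hx s hs s' hs'
  have h2 : L * |s - s'| ≤ |L| * |s - s'| := by gcongr; exact le_abs_self L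
  have h3 : 0 ≤ |L| * |s - s'| := by positivity
  constructor <;> nlinarith [abs_nonneg (s - s')]

end IsFlowApprox

variable (E) in
/-- A sequence of smooth compactly supported cutoffs on `E`. -/
def cutoff (n : ℕ) : ContDiffBump (0 : E) :=
  ⟨n + 1, n + 2, by positivity, by linarith⟩

lemma cutoff_eq_one {n : ℕ} {x : E} (hx : ‖x‖ ≤ n) : cutoff E n x = 1 :=
  (cutoff E n).one_of_mem_closedBall (by simp only [cutoff, mem_closedBall_zero_iff]; linarith)

lemma eventually_cutoff_eq_one (x : E) : ∀ᶠ n : ℕ in atTop, cutoff E n x = 1 := by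
  filter_upwards [eventually_ge_atTop ⌈‖x‖⌉₊] with n hn
  exact cutoff_eq_one (Nat.ceil_le.1 hn)

lemma hasCompactSupport_of_zero_outside {F : Type*} [Zero F] {f : E → F} {R : ℝ}
    (hf : ∀ x, R < ‖x‖ → f x = 0) : HasCompactSupport f :=
  HasCompactSupport.of_support_subset_isCompact (isCompact_closedBall (0 : E) R) fun x hx => by
    by_contra hx'
    rw [mem_closedBall_zero_iff, not_le] at hx'
    exact hx (hf x hx')

section Vague

variable [MeasurableSpace E] [BorelSpace E]

/-- Along an ultrafilter, every family of measures of uniformly bounded mass converges vaguely. -/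
lemma exists_vague_limit {ι : Type*} (l : Ultrafilter ι) (κ : ι → Measure E)
    [∀ i, IsFiniteMeasure (κ i)] {M : ℝ} (hM : ∀ i, (κ i).real univ ≤ M) :
    ∃ μ : Measure E, IsFiniteMeasureOnCompacts μ ∧ ∀ f : E → ℝ, Continuous f →
      HasCompactSupport f → Tendsto (fun i => ∫ x, f x ∂κ i) l (𝓝 (∫ x, f x ∂μ)) := by
  have hint : ∀ (f : CompactlySupportedContinuousMap E ℝ) i, Integrable f (κ i) := fun f i =>
    f.continuous.integrable_of_hasCompactSupport f.hasCompactSupport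
  have hlim : ∀ f : CompactlySupportedContinuousMap E ℝ,
      ∃ y, Tendsto (fun i => ∫ x, f x ∂κ i) l (𝓝 y) := by
    intro f
    obtain ⟨C, hC⟩ := f.continuous.bounded_above_of_compact_support f.hasCompactSupport
    have hC0 : 0 ≤ C := (norm_nonneg _).trans (hC 0)
    obtain ⟨y, -, hy⟩ := (isCompact_closedBall (0 : ℝ) (C * M)).ultrafilter_le_nhds
      (l.map fun i => ∫ x, f x ∂κ i) (by
        rw [le_principal_iff]
        refine Ultrafilter.mem_map.2 (univ_mem' fun i => ?_)
        rw [mem_preimage, mem_closedBall_zero_iff]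
        refine (norm_integral_le_of_norm_le_const (ae_of_all _ hC)).trans ?_
        gcongr
        exact hM i)
    exact ⟨y, hy⟩
  choose Λ hΛ using hlim
  let Φ : CompactlySupportedContinuousMap E ℝ →ₗ[ℝ] ℝ :=
    { toFun := Λ
      map_add' := fun f g => by
        refine tendsto_nhds_unique (hΛ (f + g)) (((hΛ f).add (hΛ g)).congr fun i => ?_)
        rw [← integral_add (hint f i) (hint g i)]
        rfl
      map_smul' := fun a f => by
        refine tendsto_nhds_unique (hΛ (a • f)) (((hΛ f).const_mul a).congr fun i => ?_)
        rw [← integral_const_mul]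
        rfl }
  let Ψ : CompactlySupportedContinuousMap E ℝ →ₚ[ℝ] ℝ := PositiveLinearMap.mk₀ Φ fun f hf =>
    ge_of_tendsto (hΛ f) (Eventually.of_forall fun i => integral_nonneg fun x => hf x)
  refine ⟨RealRMK.rieszMeasure Ψ, inferInstance, fun f hf hfc => ?_⟩
  have := RealRMK.integral_rieszMeasure Ψ ⟨⟨f, hf⟩, hfc⟩
  have h2 := hΛ ⟨⟨f, hf⟩, hfc⟩
  simp only [CompactlySupportedContinuousMap.coe_mk, ContinuousMap.coe_mk] at this h2
  rw [this]
  exact h2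

/-- Integrals of nonnegative continuous functions are lower semicontinuous for vague
convergence. -/
lemma lintegral_le_of_vague_limit {ι : Type*} {l : Filter ι} [NeBot l] {κ : ι → Measure E}
    [∀ i, IsFiniteMeasureOnCompacts (κ i)] {μ : Measure E} [IsFiniteMeasureOnCompacts μ]
    (hμ : ∀ f : E → ℝ, Continuous f → HasCompactSupport f →
      Tendsto (fun i => ∫ x, f x ∂κ i) l (𝓝 (∫ x, f x ∂μ)))
    {W : E → ℝ} (hW : Continuous W) (hW0 : ∀ x, 0 ≤ W x) {A : ℝ≥0∞}
    (hA : ∀ᶠ i in l, ∫⁻ x, ENNReal.ofReal (W x) ∂κ i ≤ A) :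
    ∫⁻ x, ENNReal.ofReal (W x) ∂μ ≤ A := by
  let g : ℕ → E → ℝ := fun n x => cutoff E n x * W x
  have hgc : ∀ n, Continuous (g n) := fun n => (cutoff E n).continuous.mul hW
  have hgs : ∀ n, HasCompactSupport (g n) := fun n => (cutoff E n).hasCompactSupport.mul_right
  have hg0 : ∀ n x, 0 ≤ g n x := fun n x => mul_nonneg (cutoff E n).nonneg (hW0 x)
  have hgW : ∀ n x, g n x ≤ W x := fun n x =>
    mul_le_of_le_one_left (hW0 x) (cutoff E n).le_one
  have hn : ∀ n, ∫⁻ x, ENNReal.ofReal (g n x) ∂μ ≤ A := by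
    intro n
    rw [← ofReal_integral_eq_lintegral_ofReal
      ((hgc n).integrable_of_hasCompactSupport (hgs n)) (ae_of_all _ (hg0 n))]
    refine le_of_tendsto ((ENNReal.continuous_ofReal.tendsto _).comp (hμ _ (hgc n) (hgs n))) ?_
    filter_upwards [hA] with i hi
    rw [Function.comp_apply, ofReal_integral_eq_lintegral_ofReal
      ((hgc n).integrable_of_hasCompactSupport (hgs n)) (ae_of_all _ (hg0 n))]
    exact (lintegral_mono fun x => ENNReal.ofReal_le_ofReal (hgW n x)).trans hi
  calc ∫⁻ x, ENNReal.ofReal (W x) ∂μ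
      = ∫⁻ x, liminf (fun n => ENNReal.ofReal (g n x)) atTop ∂μ := by
        refine lintegral_congr fun x => (Tendsto.liminf_eq ?_).symm
        refine tendsto_const_nhds.congr' ?_
        filter_upwards [eventually_cutoff_eq_one x] with n hx
        simp [g, hx]
    _ ≤ liminf (fun n => ∫⁻ x, ENNReal.ofReal (g n x) ∂μ) atTop :=
        lintegral_liminf_le fun n => (hgc n).measurable.ennreal_ofReal
    _ ≤ A := liminf_le_of_frequently_le' (Frequently.of_forall hn)

/-- A family of finite measures whose integrals of compactly supported continuous functions depend
measurably on the parameter is measurable. -/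
lemma measurable_of_measurable_integral {α : Type*} [MeasurableSpace α] {μ : α → Measure E}
    [∀ t, IsFiniteMeasure (μ t)]
    (hμ : ∀ f : E → ℝ, Continuous f → HasCompactSupport f → Measurable fun t => ∫ x, f x ∂μ t) :
    Measurable μ := by
  have hb : ∀ f : BoundedContinuousFunction E NNReal,
      Measurable fun t => ∫⁻ x, (f x : ℝ≥0∞) ∂μ t := by
    intro f
    let g : ℕ → E → ℝ := fun n x => cutoff E n x * f x
    have hfc : Continuous fun x => (f x : ℝ) := NNReal.continuous_coe.comp f.continuous
    have hgc : ∀ n, Continuous (g n) := fun n => (cutoff E n).continuous.mul hfc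
    have hgs : ∀ n, HasCompactSupport (g n) := fun n => (cutoff E n).hasCompactSupport.mul_right
    have hg0 : ∀ n x, 0 ≤ g n x := fun n x => mul_nonneg (cutoff E n).nonneg (f x).2
    have hgf : ∀ n x, g n x ≤ f x := fun n x =>
      mul_le_of_le_one_left (f x).2 (cutoff E n).le_one
    have hgm : ∀ n, Measurable fun t => ∫⁻ x, ENNReal.ofReal (g n x) ∂μ t := by
      intro n
      simp_rw [fun t => (ofReal_integral_eq_lintegral_ofReal (μ := μ t)
        ((hgc n).integrable_of_hasCompactSupport (hgs n)) (ae_of_all _ (hg0 n))).symm]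
      exact (hμ _ (hgc n) (hgs n)).ennreal_ofReal
    refine measurable_of_tendsto_metrizable hgm (tendsto_pi_nhds.2 fun t => ?_)
    refine tendsto_lintegral_of_dominated_convergence (fun x => (f x : ℝ≥0∞))
      (fun n => (hgc n).measurable.ennreal_ofReal) (fun n => ae_of_all _ fun x => ?_)
      (f.lintegral_lt_top_of_nnreal (μ t)).ne (ae_of_all _ fun x => ?_)
    · exact ENNReal.ofReal_le_of_le_toReal (by simpa using hgf n x)
    · refine tendsto_const_nhds.congr' ?_
      filter_upwards [eventually_cutoff_eq_one x] with n hx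
      simp [g, hx]
  have hcl : ∀ s : Set E, IsClosed s → Measurable fun t => μ t s := by
    intro s hs
    refine measurable_of_tendsto_metrizable (fun n => hb (hs.apprSeq n))
      (tendsto_pi_nhds.2 fun t => ?_)
    exact HasOuterApproxClosed.tendsto_lintegral_apprSeq hs (μ t)
  refine Measurable.measure_of_isPiSystem (S := {s : Set E | IsClosed s}) ?_ isPiSystem_isClosed
    hcl (hcl univ isClosed_univ)
  rw [BorelSpace.measurable_eq (α := E), borel_eq_generateFrom_isClosed]

end Vague

namespace IsFlowApprox

variable [MeasurableSpace E] [BorelSpace E]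
variable {T : ℝ} {b : E → ℝ → E} {c X : ℕ → E → ℝ → E} {ν : Measure E}

/-- The image of the initial measure, restricted to the ball of radius `k`, under the `k`-th
flow. -/
def transport (ν : Measure E) (X : ℕ → E → ℝ → E) (k : ℕ) (t : ℝ) : Measure E :=
  (ν.restrict (closedBall 0 k)).map (fun x => X k x t)

instance [IsFiniteMeasure ν] (k : ℕ) (t : ℝ) : IsFiniteMeasure (transport ν X k t) := by
  unfold transport; infer_instance

omit [FiniteDimensional ℝ E] [MeasurableSpace E] [BorelSpace E] in
lemma continuous_flow_apply (h : IsFlowApprox T b c X) (k : ℕ) (t : ℝ) :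
    Continuous fun x => X k x t :=
  (h.continuous_flow k).comp (by fun_prop : Continuous fun x : E => (x, t))

omit [FiniteDimensional ℝ E] in
lemma integral_transport (h : IsFlowApprox T b c X) {f : E → ℝ} (hf : Continuous f) (k : ℕ)
    (t : ℝ) : ∫ x, f x ∂transport ν X k t = ∫ x in closedBall 0 k, f (X k x t) ∂ν :=
  integral_map (h.continuous_flow_apply k t).aemeasurable hf.aestronglyMeasurable

omit [FiniteDimensional ℝ E] in
lemma lintegral_transport (h : IsFlowApprox T b c X) {f : E → ℝ≥0∞} (hf : Measurable f) (k : ℕ)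
    (t : ℝ) : ∫⁻ x, f x ∂transport ν X k t = ∫⁻ x in closedBall 0 k, f (X k x t) ∂ν :=
  lintegral_map hf (h.continuous_flow_apply k t).measurable

omit [FiniteDimensional ℝ E] in
lemma transport_univ_le (h : IsFlowApprox T b c X) (k : ℕ) (t : ℝ) :
    transport ν X k t univ ≤ ν univ := by
  rw [transport, Measure.map_apply (h.continuous_flow_apply k t).measurable MeasurableSet.univ]
  exact Measure.restrict_apply_le _ _ |>.trans (measure_mono (subset_univ _))

/-- `μ t` is the vague limit, along an ultrafilter, of the measures transported by the flows. -/
def IsLimit (T : ℝ) (X : ℕ → E → ℝ → E) (ν : Measure E) (μ : ℝ → Measure E) : Prop :=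
  ∀ t ∈ Icc (0 : ℝ) T, ∀ f : E → ℝ, Continuous f → HasCompactSupport f →
    Tendsto (fun k => ∫ x, f x ∂transport ν X k t) (hyperfilter ℕ : Filter ℕ)
      (𝓝 (∫ x, f x ∂μ t))

/-- Integrals of time-dependent observables converge uniformly in time. -/
lemma tendstoUniformlyOn_integral [IsFiniteMeasure ν] (h : IsFlowApprox T b c X)
    {μ : ℝ → Measure E} (hμ : IsLimit T X ν μ) {g : E → ℝ → ℝ}
    (hg : Continuous (fun p : E × ℝ => g p.1 p.2)) {R : ℝ} (hgR : ∀ x t, R < ‖x‖ → g x t = 0) :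
    ContinuousOn (fun s => ∫ x, g x s ∂μ s) (Icc 0 T) ∧
      TendstoUniformlyOn (fun (k : ℕ) s => ∫ x in closedBall 0 (k : ℝ), g (X k x s) s ∂ν)
        (fun s => ∫ x, g x s ∂μ s) (hyperfilter ℕ : Filter ℕ) (Icc 0 T) := by
  have hgs : ∀ s, Continuous fun x => g x s := fun s =>
    hg.comp (by fun_prop : Continuous fun x : E => (x, s))
  refine tendstoUniformlyOn_of_equicontinuous isCompact_Icc (fun ε hε => ?_) fun s hs => ?_
  · set m := ν.real univ
    have hm : 0 ≤ m := measureReal_nonneg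
    obtain ⟨δ, hδ, hk⟩ := h.equicontinuous_comp hg hgR (ε := ε / (m + 1)) (by positivity)
    refine ⟨δ, hδ, ?_⟩
    filter_upwards [Nat.hyperfilter_le_atTop hk] with k hk s hs s' hs' hss
    have hint : ∀ s, IntegrableOn (fun x => g (X k x s) s) (closedBall 0 k) ν := fun s =>
      ((hgs s).comp (h.continuous_flow_apply k s)).continuousOn.integrableOn_compact
        (isCompact_closedBall _ _)
    rw [← integral_sub (hint s) (hint s'), ← Real.norm_eq_abs]
    refine (norm_setIntegral_le_of_norm_le_const (measure_lt_top _ _)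
      (fun x hx => hk x hx s hs s' hs' hss)).trans ?_
    have : ν.real (closedBall 0 (k : ℝ)) ≤ m := measureReal_mono (subset_univ _)
    calc ε / (m + 1) * ν.real (closedBall 0 (k : ℝ)) ≤ ε / (m + 1) * (m + 1) := by
          gcongr; linarith
      _ = ε := by field_simp
  · have := hμ s hs _ (hgs s) (hasCompactSupport_of_zero_outside fun x hx => hgR x s hx)
    exact this.congr fun k => h.integral_transport (hgs s) k s

lemma lintegral_le [IsFiniteMeasure ν] (h : IsFlowApprox T b c X) {μ : ℝ → Measure E}
    (hμ : IsLimit T X ν μ) {t : ℝ} (ht : t ∈ Icc 0 T) [IsFiniteMeasureOnCompacts (μ t)]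
    {W : E → ℝ} (hW : Continuous W) (hW0 : ∀ x, 0 ≤ W x) {A : ℝ≥0∞}
    (hA : ∀ᶠ k : ℕ in atTop,
      ∫⁻ x in closedBall 0 (k : ℝ), ENNReal.ofReal (W (X k x t)) ∂ν ≤ A) :
    ∫⁻ x, ENNReal.ofReal (W x) ∂μ t ≤ A := by
  refine lintegral_le_of_vague_limit (hμ t ht) hW hW0 ?_
  filter_upwards [Nat.hyperfilter_le_atTop hA] with k hk
  rwa [h.lintegral_transport (hW.measurable.ennreal_ofReal)]

/-- Existence of a measurable family of limit measures. -/
lemma exists_isLimit [IsFiniteMeasure ν] (h : IsFlowApprox T b c X) (hT : 0 ≤ T) :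
    ∃ μ : ℝ → Measure E, IsLimit T X ν μ ∧ Measurable μ ∧ ∀ t, μ t univ ≤ ν univ := by
  have hex : ∀ t, ∃ μ : Measure E, IsFiniteMeasureOnCompacts μ ∧ ∀ f : E → ℝ, Continuous f →
      HasCompactSupport f → Tendsto (fun k => ∫ x, f x ∂transport ν X k t)
        (hyperfilter ℕ : Filter ℕ) (𝓝 (∫ x, f x ∂μ)) := fun t =>
    exists_vague_limit (hyperfilter ℕ) (fun k => transport ν X k t) (M := ν.real univ) fun k =>
      ENNReal.toReal_mono (measure_ne_top _ _) (h.transport_univ_le k t)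
  choose μ₀ hfin hμ₀ using hex
  let τ : ℝ → ℝ := fun t => max 0 (min T t)
  have hτc : Continuous τ := by fun_prop
  have hτe : ∀ t ∈ Icc (0 : ℝ) T, τ t = t := fun t ht => by simp [τ, ht.1, ht.2]
  have hτm : ∀ t, τ t ∈ Icc (0 : ℝ) T := fun t => by simp [τ, hT]
  have hlim : IsLimit T X ν fun t => μ₀ (τ t) := by
    intro t ht f hf hfc
    simp only [hτe t ht]
    exact hμ₀ t f hf hfc
  have hmass : ∀ t, μ₀ t univ ≤ ν univ := by
    intro t
    have := lintegral_le_of_vague_limit (hμ₀ t) (W := fun _ => 1) continuous_const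
      (fun _ => zero_le_one) (A := ν univ)
      (Eventually.of_forall fun k => by simpa using h.transport_univ_le k t)
    simpa using this
  have : ∀ t, IsFiniteMeasure (μ₀ (τ t)) := fun t =>
    ⟨(hmass _).trans_lt (measure_lt_top _ _)⟩
  refine ⟨fun t => μ₀ (τ t), hlim, measurable_of_measurable_integral fun f hf hfc => ?_,
    fun t => hmass _⟩
  obtain ⟨R, hR⟩ := hfc.isCompact.isBounded.subset_closedBall (0 : E)
  have hc := (h.tendstoUniformlyOn_integral hlim (g := fun x _ => f x) (hf.comp continuous_fst)
    (R := R) fun x t hx => by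
      by_contra hne
      have := hR (subset_tsupport _ hne)
      rw [mem_closedBall_zero_iff] at this
      linarith).1
  have hc' := hc.comp_continuous hτc hτm
  refine Continuous.measurable (hc'.congr fun t => ?_)
  change ∫ x, f x ∂μ₀ (τ (τ t)) = ∫ x, f x ∂μ₀ (τ t)
  rw [hτe _ (hτm t)]

end IsFlowApprox

/-- Uniform convergence of continuous functions on `[a,b]` implies convergence of the integrals,
along an arbitrary filter. -/
lemma tendsto_setIntegral_of_tendstoUniformlyOn {ι : Type*} {l : Filter ι} {F : ι → ℝ → ℝ}
    {G : ℝ → ℝ} {a b : ℝ} (hF : ∀ i, ContinuousOn (F i) (Icc a b)) (hG : ContinuousOn G (Icc a b))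
    (h : TendstoUniformlyOn F G l (Icc a b)) :
    Tendsto (fun i => ∫ s in Icc a b, F i s) l (𝓝 (∫ s in Icc a b, G s)) := by
  rw [Metric.tendsto_nhds]
  intro ε hε
  have hm : 0 ≤ volume.real (Icc a b) := measureReal_nonneg
  filter_upwards [Metric.tendstoUniformlyOn_iff.1 h (ε / (volume.real (Icc a b) + 1))
    (by positivity)] with i hi
  rw [dist_eq_norm, ← integral_sub ((hF i).integrableOn_compact isCompact_Icc)
    (hG.integrableOn_compact isCompact_Icc)]
  refine (norm_setIntegral_le_of_norm_le_const isCompact_Icc.measure_lt_top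
    (C := ε / (volume.real (Icc a b) + 1)) (fun s hs => ?_)).trans_lt ?_
  · rw [← dist_eq_norm, dist_comm]
    exact (hi s hs).le
  · rw [div_mul_eq_mul_div, div_lt_iff₀ (by positivity)]
    nlinarith

namespace IsFlowApprox

variable {T : ℝ} {b : E → ℝ → E} {c X : ℕ → E → ℝ → E}

omit [FiniteDimensional ℝ E] in
/-- A Lyapunov function grows at most exponentially along the flows. -/
lemma lyapunov_le (h : IsFlowApprox T b c X) {V : E → ℝ} (hV : ContDiff ℝ 1 V) {C : ℝ} {k : ℕ}
    (hVC : ∀ x, ∀ t ∈ Icc (0 : ℝ) T, fderiv ℝ V x (c k x t) ≤ C * V x) {x : E}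
    (hx : x ∈ closedBall (0 : E) k) {t : ℝ} (ht : t ∈ Icc 0 T) :
    V (X k x t) ≤ Real.exp (C * t) * V x := by
  have hd : ∀ s ∈ Icc (0 : ℝ) T, HasDerivWithinAt (fun s => Real.exp (-C * s) * V (X k x s))
      (Real.exp (-C * s) * (-C) * V (X k x s) +
        Real.exp (-C * s) * fderiv ℝ V (X k x s) (c k (X k x s) s)) (Icc 0 T) s := by
    intro s hs
    have h1 : HasDerivAt (fun s => Real.exp (-C * s)) (Real.exp (-C * s) * (-C)) s := by
      simpa using ((hasDerivAt_id s).const_mul (-C)).exp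
    exact h1.hasDerivWithinAt.mul
      (((hV.differentiable one_ne_zero _).hasFDerivAt).comp_hasDerivWithinAt s
        (h.hasDerivWithinAt k x hx s hs))
  have hanti := antitoneOn_of_deriv_nonpos (convex_Icc (0 : ℝ) T)
    (fun s hs => (hd s hs).continuousWithinAt)
    (fun s hs => ((hd s (interior_subset hs)).mono interior_subset).differentiableWithinAt)
    (fun s hs => by
      rw [((hd s (interior_subset hs)).hasDerivAt (mem_interior_iff_mem_nhds.1 hs)).deriv]
      have := mul_le_mul_of_nonneg_left (hVC (X k x s) s (interior_subset hs))
        (Real.exp_pos (-C * s)).le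
      linarith)
  have h2 := hanti ⟨le_rfl, ht.1.trans ht.2⟩ ht ht.1
  simp only [mul_zero, Real.exp_zero, one_mul, h.initial k x hx] at h2
  have h3 := mul_le_mul_of_nonneg_left h2 (Real.exp_pos (C * t)).le
  rwa [← mul_assoc, ← Real.exp_add, neg_mul, add_neg_cancel, Real.exp_zero, one_mul] at h3

variable [MeasurableSpace E] [BorelSpace E] {ν : Measure E}

/-- The weak form of the continuity equation for the transported measures. -/
lemma setIntegral_flow_eq [IsFiniteMeasure ν] (h : IsFlowApprox T b c X) {U : E × ℝ → ℝ}
    (hU : ContDiff ℝ 1 U) (k : ℕ) {t : ℝ} (ht : t ∈ Icc 0 T) :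
    ∫ x in closedBall 0 (k : ℝ), U (X k x t, t) ∂ν =
      ∫ x in closedBall 0 (k : ℝ), U (x, 0) ∂ν +
        ∫ s in Icc 0 t, ∫ x in closedBall 0 (k : ℝ),
          fderiv ℝ U (X k x s, s) (c k (X k x s) s, 1) ∂ν := by
  have hw : Continuous fun p : E × ℝ =>
      fderiv ℝ U (X k p.1 p.2, p.2) (c k (X k p.1 p.2) p.2, 1) := by
    have h1 : Continuous fun p : E × ℝ => (X k p.1 p.2, p.2) :=
      (h.continuous_flow k).prodMk continuous_snd
    exact ((hU.continuous_fderiv one_ne_zero).comp h1).clm_apply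
      (((h.continuous_field k).comp h1).prodMk continuous_const)
  have hftc : ∀ x ∈ closedBall (0 : E) (k : ℝ), U (X k x t, t) = U (x, 0) +
      ∫ s in Icc 0 t, fderiv ℝ U (X k x s, s) (c k (X k x s) s, 1) := by
    intro x hx
    have hd : ∀ s ∈ Icc (0 : ℝ) T, HasDerivWithinAt (fun s => U (X k x s, s))
        (fderiv ℝ U (X k x s, s) (c k (X k x s) s, 1)) (Icc 0 T) s := fun s hs =>
      ((hU.differentiable one_ne_zero (X k x s, s)).hasFDerivAt).comp_hasDerivWithinAt
        (f := fun s => (X k x s, s)) s ((h.hasDerivWithinAt k x hx s hs).prodMk (hasDerivWithinAt_id s _))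
    have hsub : Icc 0 t ⊆ Icc 0 T := Icc_subset_Icc_right ht.2
    have := intervalIntegral.integral_eq_sub_of_hasDerivAt_of_le ht.1
      (fun s hs => ((hd s (hsub hs)).mono hsub).continuousWithinAt)
      (fun s hs => ((hd s (hsub (Ioo_subset_Icc_self hs))).mono hsub).hasDerivAt
        (Icc_mem_nhds hs.1 hs.2))
      ((hw.comp (by fun_prop : Continuous fun s : ℝ => (x, s))).intervalIntegrable 0 t)
    rw [integral_Icc_eq_integral_Ioc, ← intervalIntegral.integral_of_le ht.1, this,
      h.initial k x hx]
    ring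
  have hswap := integral_integral_swap (μ := ν.restrict (closedBall 0 (k : ℝ)))
    (ν := volume.restrict (Icc 0 t))
    (f := fun x s => fderiv ℝ U (X k x s, s) (c k (X k x s) s, 1)) (by
      rw [Measure.prod_restrict]
      exact hw.continuousOn.integrableOn_compact
        ((isCompact_closedBall _ _).prod isCompact_Icc))
  rw [← hswap, ← integral_add]
  · exact setIntegral_congr_fun isClosed_closedBall.measurableSet hftc
  · exact (hU.continuous.comp (by fun_prop : Continuous fun x : E =>
      (x, (0 : ℝ)))).continuousOn.integrableOn_compact (isCompact_closedBall _ _)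
  · exact (continuous_parametric_integral_of_continuous (f := fun x s =>
      fderiv ℝ U (X k x s, s) (c k (X k x s) s, 1)) hw
      isCompact_Icc).continuousOn.integrableOn_compact (isCompact_closedBall _ _)

/-- The limit measures satisfy the weak form of the continuity equation. -/
lemma integral_limit_eq [IsFiniteMeasure ν] (h : IsFlowApprox T b c X) {μ : ℝ → Measure E}
    (hμ : IsLimit T X ν μ) {U : E × ℝ → ℝ} (hU : ContDiff ℝ 1 U) {R : ℝ}
    (hUR : ∀ x t, R < ‖x‖ → U (x, t) = 0) {t : ℝ} (ht : t ∈ Icc 0 T) :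
    ∫ x, U (x, t) ∂μ t = ∫ x, U (x, 0) ∂ν +
      ∫ s in Icc 0 t, ∫ x, fderiv ℝ U (x, s) (b x s, 1) ∂μ s := by
  have hsub : Icc 0 t ⊆ Icc 0 T := Icc_subset_Icc_right ht.2
  have hdU := hU.continuous_fderiv one_ne_zero
  have hdU0 : ∀ x t, R < ‖x‖ → fderiv ℝ U (x, t) = 0 := by
    intro x t hx
    have : U =ᶠ[𝓝 (x, t)] fun _ => 0 := by
      filter_upwards [(isOpen_lt continuous_const (by fun_prop : Continuous fun p : E × ℝ =>
        ‖p.1‖)).mem_nhds hx] with p hp using hUR p.1 p.2 hp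
    rw [this.fderiv_eq]
    simp
  have hg : Continuous fun p : E × ℝ => fderiv ℝ U (p.1, p.2) (b p.1 p.2, 1) :=
    hdU.clm_apply (h.continuous_limit.prodMk continuous_const)
  have hlim₁ := (h.tendstoUniformlyOn_integral hμ (g := fun x t => U (x, t)) hU.continuous
    hUR).2.tendsto_at ht
  obtain ⟨hGc, hGu⟩ := h.tendstoUniformlyOn_integral hμ
    (g := fun x s => fderiv ℝ U (x, s) (b x s, 1)) hg (R := R)
    (fun x s hx => by simp [hdU0 x s hx])
  have hlim₂ : Tendsto (fun k : ℕ => ∫ x in closedBall 0 (k : ℝ), U (x, 0) ∂ν)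
      (hyperfilter ℕ : Filter ℕ) (𝓝 (∫ x, U (x, 0) ∂ν)) := by
    refine tendsto_const_nhds.congr' ?_
    filter_upwards [Nat.hyperfilter_le_atTop (eventually_ge_atTop ⌈R⌉₊)] with k hk
    refine (setIntegral_eq_integral_of_forall_compl_eq_zero fun x hx => hUR x 0 ?_).symm
    rw [mem_closedBall_zero_iff, not_le] at hx
    exact (Nat.ceil_le.1 hk).trans_lt hx
  have hunif : TendstoUniformlyOn (fun (k : ℕ) s => ∫ x in closedBall 0 (k : ℝ),
      fderiv ℝ U (X k x s, s) (c k (X k x s) s, 1) ∂ν)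
      (fun s => ∫ x, fderiv ℝ U (x, s) (b x s, 1) ∂μ s) (hyperfilter ℕ : Filter ℕ)
      (Icc 0 T) := by
    obtain ⟨D, hD⟩ := ((isCompact_closedBall (0 : E) R).prod
      (isCompact_Icc (a := (0 : ℝ)) (b := T))).exists_bound_of_continuousOn hdU.continuousOn
    set m := ν.real univ
    have hm : 0 ≤ m := measureReal_nonneg
    rw [Metric.tendstoUniformlyOn_iff] at hGu ⊢
    intro ε hε
    filter_upwards [hGu (ε / 2) (by positivity), Nat.hyperfilter_le_atTop
      (Metric.tendstoUniformlyOn_iff.1 (h.tendstoUniformlyOn R)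
        (ε / (4 * (|D| + 1) * (m + 1))) (by positivity))] with k hk₁ hk₂ s hs
    have hXs := h.continuous_flow_apply k s
    have hXs' : Continuous fun x => (X k x s, s) := hXs.prodMk continuous_const
    have hint₁ : IntegrableOn (fun x => fderiv ℝ U (X k x s, s) (b (X k x s) s, 1))
        (closedBall 0 (k : ℝ)) ν :=
      (hg.comp hXs').continuousOn.integrableOn_compact (isCompact_closedBall _ _)
    have hint₂ : IntegrableOn (fun x => fderiv ℝ U (X k x s, s) (c k (X k x s) s, 1))
        (closedBall 0 (k : ℝ)) ν :=
      ((hdU.comp hXs').clm_apply (((h.continuous_field k).comp hXs').prodMk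
        continuous_const)).continuousOn.integrableOn_compact (isCompact_closedBall _ _)
    refine (dist_triangle _ (∫ x in closedBall 0 (k : ℝ),
      fderiv ℝ U (X k x s, s) (b (X k x s) s, 1) ∂ν) _).trans_lt ?_
    have key : dist (∫ x in closedBall 0 (k : ℝ), fderiv ℝ U (X k x s, s) (b (X k x s) s, 1) ∂ν)
        (∫ x in closedBall 0 (k : ℝ), fderiv ℝ U (X k x s, s) (c k (X k x s) s, 1) ∂ν)
        ≤ ε / 4 := by
      rw [dist_eq_norm, ← integral_sub hint₁ hint₂]
      refine (norm_setIntegral_le_of_norm_le_const (measure_lt_top _ _)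
        (C := ε / (4 * (m + 1))) (fun x _ => ?_)).trans ?_
      · rw [← map_sub]
        by_cases hxR : ‖X k x s‖ ≤ R
        · have hmem : (X k x s, s) ∈ closedBall (0 : E) R ×ˢ Icc (0 : ℝ) T :=
            ⟨mem_closedBall_zero_iff.2 hxR, hs⟩
          refine (ContinuousLinearMap.le_opNorm _ _).trans ?_
          have e₁ := (hD _ hmem).trans (le_abs_self D)
          have e₂ := (hk₂ _ hmem).le
          rw [dist_eq_norm] at e₂
          have e₃ : ‖(b (X k x s) s, (1 : ℝ)) - (c k (X k x s) s, 1)‖ =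
              ‖b (X k x s) s - c k (X k x s) s‖ := by simp [Prod.norm_def]
          rw [e₃]
          calc _ ≤ (|D| + 1) * (ε / (4 * (|D| + 1) * (m + 1))) := by
                gcongr
                linarith
            _ = ε / (4 * (m + 1)) := by field_simp
        · rw [not_le] at hxR
          rw [hdU0 _ _ hxR, zero_apply, norm_zero]
          positivity
      · have : ν.real (closedBall 0 (k : ℝ)) ≤ m := measureReal_mono (subset_univ _)
        calc _ ≤ ε / (4 * (m + 1)) * (m + 1) := by gcongr; linarith
          _ = ε / 4 := by field_simp
    linarith [hk₁ s hs]
  have hlim₃ := tendsto_setIntegral_of_tendstoUniformlyOn (fun k => ?_) (hGc.mono hsub)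
    (hunif.mono hsub)
  · exact tendsto_nhds_unique hlim₁
      ((hlim₂.add hlim₃).congr fun k => (h.setIntegral_flow_eq hU k ht).symm)
  · have h1 : Continuous fun p : ℝ × E => (X k p.2 p.1, p.1) :=
      ((h.continuous_flow k).comp continuous_swap).prodMk continuous_fst
    exact (continuous_parametric_integral_of_continuous (f := fun s x =>
      fderiv ℝ U (X k x s, s) (c k (X k x s) s, 1)) ((hdU.comp h1).clm_apply
        (((h.continuous_field k).comp h1).prodMk continuous_const))
      (isCompact_closedBall _ _)).continuousOn

end IsFlowApprox

lemma exists_isFlowApprox {T : ℝ} (hT : 0 ≤ T) {b : E → ℝ → E}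
    (hb : Continuous (fun p : E × ℝ => b p.1 p.2)) {a : ℕ → E → ℝ → E}
    (ha : ∀ k, ContDiff ℝ 1 (fun p : E × ℝ => a k p.1 p.2))
    (hconv : ∀ R : ℝ, TendstoUniformlyOn (fun k (p : E × ℝ) => a k p.1 p.2)
      (fun p => b p.1 p.2) atTop (closedBall 0 R ×ˢ Icc 0 T)) :
    ∃ X, IsFlowApprox T b (fun k x t => cutoff E k x • a k x t) X := by
  have hc : ∀ k, ContDiff ℝ 1 (fun p : E × ℝ => cutoff E k p.1 • a k p.1 p.2) := fun k =>
    ((cutoff E k).contDiff.comp contDiff_fst).smul (ha k)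
  have hbdd : ∀ k, ∃ L : ℝ, ∀ x, ∀ t ∈ Icc (0 : ℝ) T, ‖cutoff E k x • a k x t‖ ≤ L := by
    intro k
    obtain ⟨L, hL⟩ := ((isCompact_closedBall (0 : E) (k + 2)).prod
      (isCompact_Icc (a := (0 : ℝ)) (b := T))).exists_bound_of_continuousOn
        (hc k).continuous.continuousOn
    have hL0 : 0 ≤ L := (norm_nonneg _).trans
      (hL (0, 0) ⟨mem_closedBall_self (by positivity), le_rfl, hT⟩)
    refine ⟨L, fun x t ht => ?_⟩
    by_cases hx : x ∈ closedBall (0 : E) (k + 2)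
    · exact hL (x, t) ⟨hx, ht⟩
    · have : cutoff E k x = 0 := (cutoff E k).zero_of_le_dist (not_le.1 hx).le
      simpa [this] using hL0
  choose X hXc hX using fun k : ℕ => exists_continuous_flow (r := k + 1) hT (by positivity)
    (fun x t => cutoff E k x • a k x t) (hc k) (hbdd k)
  have hmem : ∀ (k : ℕ) (x : E), x ∈ closedBall (0 : E) k → x ∈ closedBall (0 : E) (k + 1) :=
    fun k x hx => closedBall_subset_closedBall (by linarith) hx
  refine ⟨X, hb, fun k => (hc k).continuous, hXc, fun k x hx => (hX k x (hmem k x hx)).1,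
    fun k x hx => (hX k x (hmem k x hx)).2, fun R => (hconv R).congr ?_⟩
  obtain ⟨n, hn⟩ := exists_nat_ge R
  filter_upwards [eventually_ge_atTop n] with k hk p hp
  have hp1 : ‖p.1‖ ≤ k :=
    (mem_closedBall_zero_iff.1 hp.1).trans (hn.trans (by exact_mod_cast hk))
  simp [cutoff_eq_one hp1]

section Bounds

variable [MeasurableSpace E] [BorelSpace E]

/-- The limit measures integrate every Lyapunov function, uniformly in time and in the index. -/
lemma IsFlowApprox.lintegral_lyapunov_le {T : ℝ} {b : E → ℝ → E} {c X : ℕ → E → ℝ → E}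
    {ν : Measure E} [IsFiniteMeasure ν] (h : IsFlowApprox T b c X) {μ : ℝ → Measure E}
    (hμ : IsFlowApprox.IsLimit T X ν μ) {V : ℕ → E → ℝ} (hV : ∀ k, ContDiff ℝ 1 (V k))
    (hV0 : ∀ k x, 0 < V k x) {C C₁ C₂ : ℝ} (hC : 0 ≤ C) (hC₁ : 0 ≤ C₁)
    (hVC : ∀ k, ∀ x, ∀ t ∈ Icc 0 T, fderiv ℝ (V k) x (c k x t) ≤ C * V k x)
    (hcomp : ∀ k m, k ≤ m → ∀ x, V k x ≤ C₁ * V m x + C₂) {M : ℝ≥0∞}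
    (hM : ∀ k, ∫⁻ x, ENNReal.ofReal (V k x) ∂ν ≤ M) {t : ℝ} (ht : t ∈ Icc 0 T)
    [IsFiniteMeasureOnCompacts (μ t)] (m : ℕ) :
    ∫⁻ x, ENNReal.ofReal (V m x) ∂μ t ≤
      ENNReal.ofReal (C₁ * Real.exp (C * T)) * M + ENNReal.ofReal C₂ * ν univ := by
  refine h.lintegral_le hμ ht (hV m).continuous (fun x => (hV0 m x).le) ?_
  filter_upwards [eventually_ge_atTop m] with k hk
  have hpt : ∀ x ∈ closedBall (0 : E) k, ENNReal.ofReal (V m (X k x t)) ≤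
      ENNReal.ofReal (C₁ * Real.exp (C * T)) * ENNReal.ofReal (V k x) + ENNReal.ofReal C₂ := by
    intro x hx
    rw [← ENNReal.ofReal_mul (by positivity)]
    refine le_trans (ENNReal.ofReal_le_ofReal ?_) ENNReal.ofReal_add_le
    refine (hcomp m k hk _).trans ?_
    have h1 := h.lyapunov_le (hV k) (hVC k) hx ht
    have h2 : Real.exp (C * t) ≤ Real.exp (C * T) :=
      Real.exp_le_exp.2 (mul_le_mul_of_nonneg_left ht.2 hC)
    have h3 : V k (X k x t) ≤ Real.exp (C * T) * V k x :=
      h1.trans (mul_le_mul_of_nonneg_right h2 (hV0 k x).le)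
    have := mul_le_mul_of_nonneg_left h3 hC₁
    linarith
  have hmeas : Measurable fun x => ENNReal.ofReal (V k x) :=
    (hV k).continuous.measurable.ennreal_ofReal
  calc _ ≤ ∫⁻ x in closedBall (0 : E) k, (ENNReal.ofReal (C₁ * Real.exp (C * T)) *
          ENNReal.ofReal (V k x) + ENNReal.ofReal C₂) ∂ν :=
        setLIntegral_mono (by fun_prop) hpt
    _ ≤ ∫⁻ x, (ENNReal.ofReal (C₁ * Real.exp (C * T)) *
          ENNReal.ofReal (V k x) + ENNReal.ofReal C₂) ∂ν := setLIntegral_le_lintegral _ _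
    _ ≤ _ := by
        rw [lintegral_add_right _ measurable_const, lintegral_const_mul _ hmeas, lintegral_const]
        gcongr
        exact hM k

omit [InnerProductSpace ℝ E] [FiniteDimensional ℝ E] [BorelSpace E] in
lemma tendsto_setIntegral_norm_sub_mul_sqrt {T : ℝ} {S : Set E} (hS : MeasurableSet S)
    {b : E → ℝ → E} {a : ℕ → E → ℝ → E} {V : ℕ → E → ℝ} (hV0 : ∀ k x, 0 < V k x)
    (hconv : TendstoUniformlyOn (fun k (p : E × ℝ) => a k p.1 p.2)
      (fun p => b p.1 p.2) atTop (S ×ˢ Icc 0 T)) {μ : ℝ → Measure E} {N A : ℝ≥0∞}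
    (hN : N ≠ ⊤) (hA : A ≠ ⊤) (hμN : ∀ t ∈ Icc 0 T, μ t univ ≤ N)
    (hμA : ∀ t ∈ Icc 0 T, ∀ k, ∫⁻ x, ENNReal.ofReal (V k x) ∂μ t ≤ A) :
    Tendsto (fun k => ∫ t in Icc (0 : ℝ) T, ∫ x in S,
      ‖b x t - a k x t‖ * Real.sqrt (V k x) ∂(μ t)) atTop (𝓝 0) := by
  set B : ℝ := (N + A).toReal with hB
  have hB0 : 0 ≤ B := ENNReal.toReal_nonneg
  have key : ∀ ε > 0, ∀ᶠ k in atTop, ∀ t ∈ Icc (0 : ℝ) T,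
      ‖∫ x in S, ‖b x t - a k x t‖ * Real.sqrt (V k x) ∂(μ t)‖ ≤ ε * B := by
    intro ε hε
    filter_upwards [Metric.tendstoUniformlyOn_iff.1 hconv ε hε] with k hk t ht
    have hle : ∫⁻ x in S, ENNReal.ofReal ‖‖b x t - a k x t‖ * Real.sqrt (V k x)‖ ∂μ t ≤
        ENNReal.ofReal ε * (N + A) := by
      calc _ ≤ ∫⁻ x in S, ENNReal.ofReal ε * (1 + ENNReal.ofReal (V k x)) ∂μ t := by
            refine setLIntegral_mono' hS fun x hx => ?_
            rw [← ENNReal.ofReal_one, ← ENNReal.ofReal_add zero_le_one (hV0 k x).le,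
              ← ENNReal.ofReal_mul hε.le]
            refine ENNReal.ofReal_le_ofReal ?_
            rw [Real.norm_of_nonneg (by positivity)]
            have h1 : ‖b x t - a k x t‖ ≤ ε := by
              rw [← dist_eq_norm]; exact (hk (x, t) ⟨hx, ht⟩).le
            have h2 : Real.sqrt (V k x) ≤ 1 + V k x := by
              nlinarith [Real.sq_sqrt (hV0 k x).le, sq_nonneg (Real.sqrt (V k x) - 1),
                Real.sqrt_nonneg (V k x)]
            exact mul_le_mul h1 h2 (Real.sqrt_nonneg _) hε.le
        _ ≤ ∫⁻ x, ENNReal.ofReal ε * (1 + ENNReal.ofReal (V k x)) ∂μ t :=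
            setLIntegral_le_lintegral _ _
        _ = ENNReal.ofReal ε * (μ t univ + ∫⁻ x, ENNReal.ofReal (V k x) ∂μ t) := by
            rw [lintegral_const_mul' _ _ ENNReal.ofReal_ne_top,
              lintegral_add_left measurable_const, lintegral_const, one_mul]
        _ ≤ _ := by gcongr; exacts [hμN t ht, hμA t ht k]
    refine (norm_integral_le_lintegral_norm _).trans ?_
    refine (ENNReal.toReal_mono (by finiteness) hle).trans ?_
    rw [ENNReal.toReal_mul, ENNReal.toReal_ofReal hε.le]
  rw [Metric.tendsto_nhds]
  intro ε hε
  have hpos : 0 < ε / ((B + 1) * (|T| + 1)) := by positivity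
  filter_upwards [key _ hpos] with k hk
  rw [dist_zero_right]
  refine (norm_setIntegral_le_of_norm_le_const (by simp) hk).trans_lt ?_
  have hvol : volume.real (Icc (0 : ℝ) T) ≤ |T| := by
    rw [Real.volume_real_Icc]
    simp [le_abs_self]
  calc _ ≤ ε / ((B + 1) * (|T| + 1)) * B * |T| := by gcongr
    _ < ε := by
      rw [div_mul_eq_mul_div, div_mul_eq_mul_div, div_lt_iff₀ (by positivity)]
      nlinarith [mul_nonneg hB0 (abs_nonneg T), abs_nonneg T]

end Bounds

omit [FiniteDimensional ℝ E] in
lemma fderiv_apply_prod_one {U : E × ℝ → ℝ} (hU : Differentiable ℝ U) (x v : E) (s : ℝ) :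
    fderiv ℝ U (x, s) (v, 1) =
      deriv (fun r => U (x, r)) s + fderiv ℝ (fun y => U (y, s)) x v := by
  have h1 : HasDerivAt (fun r => U (x, r)) (fderiv ℝ U (x, s) (0, 1)) s :=
    (hU (x, s)).hasFDerivAt.comp_hasDerivAt s ((hasDerivAt_const s x).prodMk (hasDerivAt_id s))
  have h2 := (hU (x, s)).hasFDerivAt.comp x (hasFDerivAt_prodMk_left (𝕜 := ℝ) x s)
  have h3 : fderiv ℝ (fun y => U (y, s)) x v = fderiv ℝ U (x, s) (v, 0) := by
    have := h2.fderiv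
    rw [show (U ∘ fun y => (y, s)) = fun y => U (y, s) from rfl] at this
    rw [this]; simp
  rw [h1.deriv, h3, ← map_add]
  simp

omit [FiniteDimensional ℝ E] in
lemma inner_gradient_eq_fderiv [CompleteSpace E] (f : E → ℝ) (x v : E) :
    ⟪v, gradient f x⟫ = fderiv ℝ f x v := by
  rw [real_inner_comm, gradient, InnerProductSpace.toDual_symm_apply]

end ContinuityEquation

/-- **Proposition 1 (existence in the uniqueness class).** Let
`b : ℝ^d × [0,T] → ℝ^d` be continuous and suppose there are smooth vector
fields `b_k` and positive `C¹` functions `V_k` such that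
(i) `V_k ≤ C₁ V_m + C₂` for `k ≤ m` and `⟨b_k, ∇V_k⟩ ≤ C₃ V_k` on `ℝ^d × [0,T]`;
(ii) `(1+|x|)⁻¹|b_k(x,t)|` is bounded for every `k` and `b_k → b` uniformly on
`U × [0,T]` for every ball `U`.  Then for every nonnegative finite initial
measure `ν` with `sup_k ∫ V_k dν < ∞` there is a family of nonnegative finite
measures `(μ_t)_{t∈[0,T]}` solving the Cauchy problem and satisfying
`∫₀ᵀ ∫_U |b - b_k| √V_k dμ_t dt → 0` for every ball `U`. -/
theorem existence_in_uniqueness_class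
    {d : ℕ} (T : ℝ) (hT : 0 < T)
    (b : EuclideanSpace ℝ (Fin d) → ℝ → EuclideanSpace ℝ (Fin d))
    (hb : ContinuousOn (fun q : EuclideanSpace ℝ (Fin d) × ℝ => b q.1 q.2)
      ((univ : Set (EuclideanSpace ℝ (Fin d))) ×ˢ Icc (0:ℝ) T))
    (bk : ℕ → EuclideanSpace ℝ (Fin d) → ℝ → EuclideanSpace ℝ (Fin d))
    (Vk : ℕ → EuclideanSpace ℝ (Fin d) → ℝ)
    (hbksm : ∀ k, ContDiff ℝ (⊤ : ℕ∞)
      (fun q : EuclideanSpace ℝ (Fin d) × ℝ => bk k q.1 q.2))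
    (hVkC1 : ∀ k, ContDiff ℝ 1 (Vk k))
    (hVkpos : ∀ k x, 0 < Vk k x)
    -- (i)
    (hVcomp : ∃ C₁ C₂ : ℝ, ∀ k m : ℕ, k ≤ m → ∀ x, Vk k x ≤ C₁ * Vk m x + C₂)
    (hLyap : ∃ C₃ : ℝ, ∀ k, ∀ x : EuclideanSpace ℝ (Fin d), ∀ t ∈ Icc (0:ℝ) T,
      ⟪bk k x t, gradient (Vk k) x⟫ ≤ C₃ * Vk k x)
    -- (ii)
    (hbkgrowth : ∀ k, ∃ M : ℝ, ∀ x : EuclideanSpace ℝ (Fin d), ∀ t ∈ Icc (0:ℝ) T,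
      ‖bk k x t‖ ≤ M * (1 + ‖x‖))
    (hconv : ∀ (x₀ : EuclideanSpace ℝ (Fin d)) (R : ℝ), 0 < R →
      TendstoUniformlyOn (fun k (q : EuclideanSpace ℝ (Fin d) × ℝ) => bk k q.1 q.2)
        (fun q => b q.1 q.2) atTop (ball x₀ R ×ˢ Icc (0:ℝ) T))
    (ν : Measure (EuclideanSpace ℝ (Fin d))) [IsFiniteMeasure ν]
    (hνV : ∃ M : ℝ≥0∞, M < ⊤ ∧ ∀ k, ∫⁻ x, ENNReal.ofReal (Vk k x) ∂ν ≤ M) :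
    ∃ μ : ℝ → Measure (EuclideanSpace ℝ (Fin d)),
      (∀ t ∈ Icc (0:ℝ) T, μ t univ < ⊤) ∧
      IsNonnegSolution T b ν μ ∧
      ∀ (x₀ : EuclideanSpace ℝ (Fin d)) (R : ℝ), 0 < R →
        Tendsto (fun k => ∫ t in Icc (0:ℝ) T, ∫ x in ball x₀ R,
            ‖b x t - bk k x t‖ * Real.sqrt (Vk k x) ∂(μ t)) atTop (𝓝 0) := by
  obtain ⟨C₁, C₂, hVcomp⟩ := hVcomp
  obtain ⟨C₃, hLyap⟩ := hLyap
  obtain ⟨M, hM, hνV⟩ := hνV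
  set τ : ℝ → ℝ := fun t => max 0 (min T t) with hτ
  have hτc : Continuous τ := by fun_prop
  have hτm : ∀ t, τ t ∈ Icc (0 : ℝ) T := fun t => by simp [hτ, hT.le]
  have hτe : ∀ t ∈ Icc (0 : ℝ) T, τ t = t := fun t ht => by simp [hτ, ht.1, ht.2]
  have hbc : Continuous (fun p : EuclideanSpace ℝ (Fin d) × ℝ => b p.1 (τ p.2)) :=
    hb.comp_continuous (f := fun p : EuclideanSpace ℝ (Fin d) × ℝ => (p.1, τ p.2))
      (by fun_prop) fun p => ⟨mem_univ _, hτm _⟩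
  have hconv' : ∀ R : ℝ, TendstoUniformlyOn
      (fun k (p : EuclideanSpace ℝ (Fin d) × ℝ) => bk k p.1 p.2)
      (fun p => b p.1 (τ p.2)) atTop (closedBall 0 R ×ˢ Icc (0 : ℝ) T) := by
    intro R
    refine ((hconv 0 (|R| + 1) (by positivity)).mono (prod_mono_left
      (closedBall_subset_ball (by linarith [le_abs_self R])))).congr_right ?_
    intro p hp
    simp only [hτe p.2 hp.2]
  obtain ⟨X, h⟩ := exists_isFlowApprox (b := fun x t => b x (τ t)) hT.le hbc
    (fun k => (hbksm k).of_le (by exact_mod_cast le_top)) hconv'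
  obtain ⟨μ, hμ, hμm, hμν⟩ := h.exists_isLimit (ν := ν) hT.le
  have hfin : ∀ t, IsFiniteMeasure (μ t) := fun t => ⟨(hμν t).trans_lt (measure_lt_top _ _)⟩
  have hVC : ∀ k, ∀ x, ∀ t ∈ Icc (0 : ℝ) T,
      fderiv ℝ (Vk k) x (cutoff (EuclideanSpace ℝ (Fin d)) k x • bk k x t) ≤ |C₃| * Vk k x := by
    intro k x t ht
    have h0 := (cutoff (EuclideanSpace ℝ (Fin d)) k).nonneg (x := x)
    have h1 := (cutoff (EuclideanSpace ℝ (Fin d)) k).le_one (x := x)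
    have hV := hVkpos k x
    rw [map_smul, smul_eq_mul, ← inner_gradient_eq_fderiv]
    calc _ ≤ cutoff (EuclideanSpace ℝ (Fin d)) k x * (|C₃| * Vk k x) :=
          mul_le_mul_of_nonneg_left ((hLyap k x t ht).trans
            (mul_le_mul_of_nonneg_right (le_abs_self _) hV.le)) h0
      _ ≤ |C₃| * Vk k x := mul_le_of_le_one_left (by positivity) h1
  have hcomp : ∀ k m, k ≤ m → ∀ x, Vk k x ≤ |C₁| * Vk m x + C₂ := fun k m hkm x =>
    (hVcomp k m hkm x).trans (by gcongr; exacts [(hVkpos m x).le, le_abs_self _])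
  have hA : ENNReal.ofReal (|C₁| * Real.exp (|C₃| * T)) * M + ENNReal.ofReal C₂ * ν univ ≠ ⊤ :=
    ENNReal.add_ne_top.2 ⟨ENNReal.mul_ne_top ENNReal.ofReal_ne_top hM.ne,
      ENNReal.mul_ne_top ENNReal.ofReal_ne_top (measure_ne_top _ _)⟩
  refine ⟨μ, fun t _ => measure_lt_top _ _, ⟨fun B hB _ => (Measure.measurable_coe hB).comp hμm,
    fun t _ K _ => measure_lt_top _ _, fun K hK => ?_, fun x₀ R hR => ?_, ?_⟩, fun x₀ R hR => ?_⟩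
  · have hmeas : Measurable fun t => (μ t K).toReal :=
      ((Measure.measurable_coe hK.measurableSet).comp hμm).ennreal_toReal
    refine Measure.integrableOn_of_bounded (M := (ν univ).toReal) (by simp)
      hmeas.aestronglyMeasurable (ae_of_all _ fun t => ?_)
    rw [Real.norm_of_nonneg ENNReal.toReal_nonneg]
    exact ENNReal.toReal_mono (measure_ne_top _ _) ((measure_mono (subset_univ _)).trans (hμν t))
  · obtain ⟨L, hL⟩ := ((isCompact_closedBall x₀ R).prod
      (isCompact_Icc (a := (0 : ℝ)) (b := T))).exists_bound_of_continuousOn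
        (hb.mono (prod_mono_left (subset_univ _)))
    have hle : ∀ t ∈ Icc (0 : ℝ) T, ∫⁻ x in ball x₀ R, ENNReal.ofReal ‖b x t‖ ∂(μ t) ≤
        ENNReal.ofReal L * ν univ := by
      intro t ht
      calc _ ≤ ∫⁻ x in ball x₀ R, ENNReal.ofReal L ∂(μ t) :=
            setLIntegral_mono' measurableSet_ball fun x hx =>
              ENNReal.ofReal_le_ofReal (hL (x, t) ⟨ball_subset_closedBall hx, ht⟩)
        _ ≤ _ := by
            rw [setLIntegral_const]
            exact mul_le_mul_right ((measure_mono (subset_univ _)).trans (hμν t)) _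
    refine (setLIntegral_mono' measurableSet_Icc hle).trans_lt ?_
    rw [setLIntegral_const]
    exact ENNReal.mul_lt_top (ENNReal.mul_lt_top ENNReal.ofReal_lt_top (measure_lt_top _ _))
      (by simp)
  · rintro u hu ⟨R, -, huR⟩
    refine (ae_restrict_iff' measurableSet_Icc).2 (ae_of_all _ fun t ht => ?_)
    rw [h.integral_limit_eq hμ hu huR ht]
    congr 1
    refine setIntegral_congr_fun measurableSet_Icc fun s hs => ?_
    refine integral_congr_ae (ae_of_all _ fun x => ?_)
    simp only
    rw [hτe s ⟨hs.1, hs.2.trans ht.2⟩, fderiv_apply_prod_one (hu.differentiable one_ne_zero),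
      inner_gradient_eq_fderiv]
  · exact tendsto_setIntegral_norm_sub_mul_sqrt measurableSet_ball hVkpos (hconv x₀ R hR)
      (measure_ne_top ν univ) hA (fun t _ => hμν t) fun t ht m =>
        h.lintegral_lyapunov_le hμ hVkC1 hVkpos (abs_nonneg _) (abs_nonneg _) hVC hcomp hνV ht m
end
end
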